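/- Let G be a simple bipartite graph with n vertices and m edges, where m ≥ (17/4)n. Then the crossing number of G satisfies cr(G) ≥ (16/289)·m³/n². -/

import Mathlib

open Set

/-- A topological drawing of a simple graph in the plane: vertices are mapped to distinct
points, each edge to a Jordan arc (parametrized over `[0,1]`) connecting its endpoints;
no arc passes through a vertex other than its endpoints; two adjacent edges meet only at
their shared endpoint (i.e. adjacent edges do not cross); two independent edges meet in at
most one point (so no edge crosses another more than once). -/
structure Drawing {V : Type*} (G : SimpleGraph V) where
  vert : V → ℝ × ℝ
  vert_inj : Function.Injective vert
  arc : G.edgeSet → ℝ → ℝ × ℝ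
  arc_cont : ∀ e, ContinuousOn (arc e) (Set.Icc 0 1)
  arc_inj : ∀ e, Set.InjOn (arc e) (Set.Icc 0 1)
  arc_ends : ∀ (e : G.edgeSet) (u v : V), (e : Sym2 V) = s(u, v) →
      ({arc e 0, arc e 1} : Set (ℝ × ℝ)) = {vert u, vert v}
  arc_vertex : ∀ (e : G.edgeSet), ∀ t ∈ Set.Icc (0:ℝ) 1, ∀ w : V,
      arc e t = vert w → w ∈ (e : Sym2 V)
  adj_meet : ∀ e f : G.edgeSet, e ≠ f →
      (∃ w : V, w ∈ (e : Sym2 V) ∧ w ∈ (f : Sym2 V)) →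
      ∀ p ∈ arc e '' Set.Icc (0:ℝ) 1, p ∈ arc f '' Set.Icc (0:ℝ) 1 →
        ∃ w : V, w ∈ (e : Sym2 V) ∧ w ∈ (f : Sym2 V) ∧ p = vert w
  nonadj_meet : ∀ e f : G.edgeSet,
      (¬ ∃ w : V, w ∈ (e : Sym2 V) ∧ w ∈ (f : Sym2 V)) →
      ((arc e '' Set.Icc (0:ℝ) 1) ∩ (arc f '' Set.Icc (0:ℝ) 1)).Subsingleton

/-- The image (point set) of an edge in a drawing. -/
def Drawing.img {V : Type*} {G : SimpleGraph V} (D : Drawing G) (e : G.edgeSet) :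
    Set (ℝ × ℝ) :=
  D.arc e '' Set.Icc (0:ℝ) 1

/-- Two edges cross in a drawing if they are distinct and meet at a point that is not the
image of any vertex. -/
def Drawing.Crosses {V : Type*} {G : SimpleGraph V} (D : Drawing G) (e f : G.edgeSet) :
    Prop :=
  e ≠ f ∧ ∃ p ∈ D.img e ∩ D.img f, ∀ w : V, D.vert w ≠ p

/-- In the drawing `D`, every edge is crossed at most `k` times (any two edges cross at
most once, so this is the number of edges crossing it). -/
def Drawing.AtMostKCrossings {V : Type*} {G : SimpleGraph V} (D : Drawing G) (k : ℕ) :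
    Prop :=
  ∀ e : G.edgeSet, {f : G.edgeSet | D.Crosses e f}.ncard ≤ k

/-- A graph is bipartite: its vertices can be split in two parts such that every edge
joins the two parts. -/
def IsBipartite {V : Type*} (G : SimpleGraph V) : Prop :=
  ∃ c : V → Bool, ∀ u v : V, G.Adj u v → c u ≠ c v

/-- The number of crossings in a drawing: since any two edges cross at most once, this
is the number of unordered pairs of crossing edges. -/
noncomputable def Drawing.crossingCount {V : Type*} {G : SimpleGraph V}
    (D : Drawing G) : ℕ :=
  {p : G.edgeSet × G.edgeSet | D.Crosses p.1 p.2}.ncard / 2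

/-- The crossing number of a graph: the minimum number of edge crossings over all
drawings of the graph in the plane. -/
noncomputable def crossingNumber {V : Type*} (G : SimpleGraph V) : ℕ :=
  sInf (Set.range fun D : Drawing G => D.crossingCount)


namespace BCL

/-- A planar combinatorial map (planarity expressed by cycle = boundary modulo two). -/
structure PMap (D L : Type) where
  σ : Equiv.Perm D
  α : D → D
  lab : D → L
  αα : ∀ d, α (α d) = d
  αne : ∀ d, α d ≠ d
  labσ : ∀ d, lab (σ d) = lab d
  trans : ∀ f : D → Prop, (∀ d, f d → f (σ d)) → ∀ d d', lab d = lab d' → f d → f d'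
  H : ∀ z c : D → ZMod 2, (∀ d, z (α d) = z d) → (∀ d, z (σ d) = c (σ d) + c d) →
    ∃ w : D → ZMod 2, (∀ d, w (α (σ d)) = w d) ∧ ∀ d, w d + w (α d) = z d

lemma z2_add_self (a : ZMod 2) : a + a = 0 := by revert a; decide
lemma z2_add_eq (a b c : ZMod 2) (h : a = b + c) : b + a = c := by
  revert a b c; decide

inductive Hit {D : Type} (τ : D → D) (A : Set D) : D → D → Prop
  | base (d : D) (h : d ∈ A) : Hit τ A d d
  | step (d b : D) (h : d ∉ A) (hb : Hit τ A (τ d) b) : Hit τ A d b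

namespace Hit
variable {D : Type} {τ : D → D} {A : Set D}

lemma mem {d b : D} (h : Hit τ A d b) : b ∈ A := by
  induction h with
  | base d h => exact h
  | step d b h hb ih => exact ih

lemma of_mem {d b : D} (h : Hit τ A d b) (hd : d ∈ A) : b = d := by
  cases h with
  | base d h => rfl
  | step d b h hb => exact absurd hd h

lemma of_not {d b : D} (h : Hit τ A d b) (hd : d ∉ A) : Hit τ A (τ d) b := by
  cases h with
  | base d h => exact absurd h hd
  | step d b h hb => exact hb

lemma det {d b b' : D} (h : Hit τ A d b) (h' : Hit τ A d b') : b = b' := by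
  induction h with
  | base d h => exact (h'.of_mem h).symm
  | step d b h hb ih => exact ih (h'.of_not h)

lemma iff_not {d b : D} (hd : d ∉ A) : Hit τ A (τ d) b ↔ Hit τ A d b :=
  ⟨fun h => .step _ _ hd h, fun h => h.of_not hd⟩

lemma exists_of_iter (n : ℕ) : ∀ d : D, τ^[n] d ∈ A → ∃ b, Hit τ A d b := by
  induction n with
  | zero => intro d h; exact ⟨d, .base _ h⟩
  | succ n ih =>
    intro d h
    by_cases hd : d ∈ A
    · exact ⟨d, .base _ hd⟩
    · obtain ⟨b, hb⟩ := ih (τ d) (by simpa using h)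
      exact ⟨b, .step _ _ hd hb⟩

end Hit

section restrict
variable {D L : Type}

open Classical in
theorem restrict (τ : Equiv.Perm D) (α : D → D) (lab : D → L) (αα : ∀ d, α (α d) = d)
    (αne : ∀ d, α d ≠ d) (labτ : ∀ d, lab (τ d) = lab d)
    (trans : ∀ f : D → Prop, (∀ d, f d → f (τ d)) → ∀ d d', lab d = lab d' → f d → f d')
    (hper : ∀ d, ∃ n, τ^[n + 1] d = d)
    (A : Set D) (hfin : Finite A) (hA : ∀ d ∈ A, α d ∈ A)
    (Hon : ∀ z c : D → ZMod 2, (∀ d, z (α d) = z d) → (∀ d, d ∉ A → z d = 0) →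
      (∀ d, z (τ d) = c (τ d) + c d) → ∃ w v : D → ZMod 2, (∀ y, w (α (τ y)) = v y) ∧
        (∀ x ∈ A, v x = w x ∧ w x + w (α x) = z x) ∧ (∀ x, x ∉ A → v x = w (α x))) :
    ∃ M : PMap A L, (∀ a : A, (M.α a : D) = α a) ∧ (∀ a : A, M.lab a = lab a) := by
  have hex : ∀ a : A, ∃ b : A, Hit τ A (τ a) b := by
    intro a
    obtain ⟨n, hn⟩ := hper a
    obtain ⟨b, hb⟩ := Hit.exists_of_iter (τ := τ) (A := A) n (τ a)
      (by rw [← Function.iterate_succ_apply, hn]; exact a.2)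
    exact ⟨⟨b, hb.mem⟩, hb⟩
  choose ret hret using hex
  have hinj : Function.Injective ret := by
    -- the previous-hit argument: use the inverse walk
    have key : ∀ d b, Hit τ A d b → ∀ a a' : A, ∀ n m : ℕ, (∀ k < n, τ^[k+1] (a:D) ∉ A) →
        (∀ k < m, τ^[k+1] (a':D) ∉ A) → τ^[n+1] (a:D) = b → τ^[m+1] (a':D) = b → n ≤ m → a = a' := by
      intro d b h a a' n m hn hm h1 h2 hle
      obtain ⟨j, rfl⟩ := Nat.exists_eq_add_of_le hle
      have : τ^[n+1] (τ^[j] (a':D)) = τ^[n+1] (a:D) := by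
        rw [← Function.iterate_add_apply, h1, ← h2]; congr 1; omega
      have h3 : τ^[j] (a':D) = (a:D) := (τ.injective.iterate (n+1)) this
      rcases Nat.eq_zero_or_pos j with rfl | hj
      · exact Subtype.ext h3.symm
      · exfalso
        have := hm (j-1) (by omega)
        rw [Nat.sub_add_cancel hj, h3] at this
        exact this a.2
    have hit_iter : ∀ d b, Hit τ A d b → ∃ n, (∀ k < n, τ^[k] d ∉ A) ∧ τ^[n] d = b := by
      intro d b h
      induction h with
      | base d h => exact ⟨0, by simp, rfl⟩
      | step d b h hb ih =>
        obtain ⟨n, h1, h2⟩ := ih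
        refine ⟨n+1, ?_, by simpa using h2⟩
        intro k hk
        cases k with
        | zero => simpa using h
        | succ k => simpa using h1 k (by omega)
    intro a a' h
    obtain ⟨n, h1, h2⟩ := hit_iter _ _ (hret a)
    obtain ⟨m, h3, h4⟩ := hit_iter _ _ (hret a')
    rw [← h] at h4
    rcases le_total n m with hle | hle
    · exact key _ _ (hret a) a a' n m (by simpa using h1) (by simpa using h3) (by simpa using h2)
        (by simpa using h4) hle
    · exact (key _ _ (hret a) a' a m n (by simpa using h3) (by simpa using h1) (by simpa using h4)
        (by simpa using h2) hle).symm
  have hbij : Function.Bijective ret := Finite.injective_iff_bijective.mp hinj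
  have hlab : ∀ d b, Hit τ A d b → lab b = lab d := by
    intro d b h
    induction h with
    | base d h => rfl
    | step d b h hb ih => rw [ih, labτ]
  refine ⟨⟨Equiv.ofBijective ret hbij, fun a => ⟨α a, hA _ a.2⟩, fun a => lab a, ?_, ?_, ?_, ?_, ?_⟩,
    fun a => rfl, fun a => rfl⟩
  · intro d; exact Subtype.ext (αα _)
  · intro d h; exact αne d (congrArg Subtype.val h)
  · intro d
    simp only [Equiv.ofBijective_apply]
    rw [hlab _ _ (hret d), labτ]
  · intro f hf d d' hl hfd
    have := trans (fun x => ∀ a : A, Hit τ A x a → f a) ?_ d d' hl ?_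
    · exact this d' (.base _ d'.2)
    · intro x hx a ha
      by_cases hxA : x ∈ A
      · have h1 := hx ⟨x, hxA⟩ (.base _ hxA)
        have h2 := hf _ h1
        have : a = ret ⟨x, hxA⟩ := Subtype.ext (ha.det (hret ⟨x, hxA⟩))
        rw [this]; exact h2
      · exact hx a (.step _ _ hxA ha)
    · intro a ha
      have : a = d := Subtype.ext (ha.of_mem d.2)
      rw [this]; exact hfd
  · intro z' c' hz hc
    let e : D → ZMod 2 := fun d => if h : ∃ b : A, Hit τ A d b then c' h.choose + z' h.choose else 0
    have he1 : ∀ (d : D) (b : A), Hit τ A d b → e d = c' b + z' b := by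
      intro d b h
      have h' : ∃ b : A, Hit τ A d b := ⟨b, h⟩
      have : h'.choose = b := Subtype.ext (h'.choose_spec.det h)
      simp only [e, dif_pos h', this]
    have he2 : ∀ d, d ∉ A → e (τ d) = e d := by
      intro d hd
      simp only [e, Hit.iff_not hd]
    have hex := Hon (fun d => if h : d ∈ A then z' ⟨d, h⟩ else 0)
      (fun d => e (τ d)) ?_ ?_ ?_
    rotate_left
    · intro d
      by_cases hd : d ∈ A
      · simpa [hd, hA d hd] using hz ⟨d, hd⟩
      · have : α d ∉ A := fun h => hd (by simpa [αα] using hA _ h)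
        simp [hd, this]
    · intro d hd; simp [hd]
    · intro d
      by_cases hd : τ d ∈ A
      · simp only [dif_pos hd]
        rw [he1 (τ d) ⟨τ d, hd⟩ (.base _ hd), he1 (τ (τ d)) _ (hret ⟨τ d, hd⟩)]
        have := hc ⟨τ d, hd⟩
        simp only [Equiv.ofBijective_apply] at this
        rw [this]
        generalize c' _ = x
        generalize c' _ = y
        generalize z' _ = t
        revert x y t; decide
      · simp only [dif_neg hd, he2 _ hd, z2_add_self]
    · obtain ⟨w, v, hw1, hw2, hw3⟩ := hex
      refine ⟨fun a => w a, ?_, ?_⟩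
      · intro d
        have h : ∀ x b, Hit τ A x b → w (α b) = w (α x) := by
          intro x b h
          induction h with
          | base d h => rfl
          | step d b h hb ih => rw [ih, hw1, hw3 _ h]
        simp only [Equiv.ofBijective_apply]
        rw [h _ _ (hret d), hw1, (hw2 d d.2).1]
      · intro d
        have := (hw2 d d.2).2
        simpa using this

end restrict

end BCL


namespace BCL

section minor
variable {D L : Type}

lemma perm_per [Finite D] (τ : Equiv.Perm D) (d : D) : ∃ n, τ^[n + 1] d = d := by
  have h : 0 < orderOf τ := orderOf_pos τ
  refine ⟨orderOf τ - 1, ?_⟩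
  rw [Nat.sub_add_cancel h, Equiv.Perm.iterate_eq_pow, pow_orderOf_eq_one]
  rfl

def edgeCompl (M : PMap D L) (d0 : D) : Set D := {d | d ≠ d0 ∧ d ≠ M.α d0}

lemma edgeCompl_closed (M : PMap D L) (d0 : D) : ∀ d ∈ edgeCompl M d0, M.α d ∈ edgeCompl M d0 := by
  rintro d ⟨h1, h2⟩
  refine ⟨fun h => h2 ?_, fun h => h1 ?_⟩
  · rw [← h, M.αα]
  · rw [← M.αα d, h, M.αα]

theorem PMap.delete [Finite D] (M : PMap D L) (d0 : D) :
    ∃ M' : PMap (edgeCompl M d0) L, (∀ a, (M'.α a : D) = M.α a) ∧ (∀ a, M'.lab a = M.lab a) := by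
  refine restrict M.σ M.α M.lab M.αα M.αne M.labσ M.trans (perm_per M.σ) _ inferInstance
    (edgeCompl_closed M d0) ?_
  intro z c hz hz0 hc
  obtain ⟨w, hw1, hw2⟩ := M.H z c hz hc
  refine ⟨w, w, hw1, fun x _ => ⟨rfl, hw2 x⟩, fun x hx => ?_⟩
  have := hw2 x
  rw [hz0 x hx] at this
  generalize w x = a at *
  generalize w (M.α x) = b at *
  revert a b; decide

open Classical in
theorem PMap.contract [Finite D] (M : PMap D L) (d0 : D) (hne : M.lab d0 ≠ M.lab (M.α d0)) :
    ∃ M' : PMap (edgeCompl M d0) L, (∀ a, (M'.α a : D) = M.α a) ∧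
      (∀ a, M'.lab a = if M.lab a = M.lab (M.α d0) then M.lab d0 else M.lab a) := by
  set ρ : L → L := fun l => if l = M.lab (M.α d0) then M.lab d0 else l with hρ
  set s := Equiv.swap d0 (M.α d0) with hs
  have hs0 : s d0 = M.α d0 := Equiv.swap_apply_left _ _
  have hs1 : s (M.α d0) = d0 := Equiv.swap_apply_right _ _
  have hs2 : ∀ d, d ≠ d0 → d ≠ M.α d0 → s d = d := fun d h1 h2 => Equiv.swap_apply_of_ne_of_ne h1 h2
  have hρ0 : ρ (M.lab d0) = M.lab d0 := by simp [hρ, hne]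
  have hρ1 : ρ (M.lab (M.α d0)) = M.lab d0 := by simp [hρ]
  refine restrict (M.σ * s) M.α (fun d => ρ (M.lab d)) M.αα M.αne ?_ ?_ (perm_per _) _ inferInstance
    (edgeCompl_closed M d0) ?_
  · intro d
    simp only [Equiv.Perm.mul_apply, M.labσ]
    by_cases h0 : d = d0
    · subst h0; rw [hs0, hρ0, hρ1]
    · by_cases h1 : d = M.α d0
      · subst h1; rw [hs1, hρ0, hρ1]
      · rw [hs2 d h0 h1]
  · intro f hf d d' hl hfd
    simp only [Equiv.Perm.mul_apply] at hf
    have hf0 : f d0 → f (M.σ (M.α d0)) := fun h => by simpa [hs0] using hf _ h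
    have hf1 : f (M.α d0) → f (M.σ d0) := fun h => by simpa [hs1] using hf _ h
    have hf2 : ∀ d, d ≠ d0 → d ≠ M.α d0 → f d → f (M.σ d) := fun d h1 h2 h => by
      simpa [hs2 d h1 h2] using hf _ h
    have hu : ∀ x, M.lab x = M.lab d0 → f x → f d0 := by
      intro x hx hfx
      have := M.trans (fun y => M.lab y = M.lab d0 → f y ∨ f d0) ?_ x d0 hx (fun _ => .inl hfx) rfl
      · tauto
      · intro y hy hly
        rw [M.labσ] at hly
        rcases hy hly with h | h
        · by_cases h0 : y = d0
          · subst h0; exact .inr h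
          · refine .inl (hf2 y h0 (fun h' => hne ?_) h)
            rw [← h', hly]
        · exact .inr h
    have hv : ∀ x, M.lab x = M.lab (M.α d0) → f x → f (M.α d0) := by
      intro x hx hfx
      have := M.trans (fun y => M.lab y = M.lab (M.α d0) → f y ∨ f (M.α d0)) ?_ x (M.α d0) hx
        (fun _ => .inl hfx) rfl
      · tauto
      · intro y hy hly
        rw [M.labσ] at hly
        rcases hy hly with h | h
        · by_cases h0 : y = M.α d0
          · subst h0; exact .inr h
          · refine .inl (hf2 y (fun h' => hne ?_) h0 h)
            rw [← hly, h']
        · exact .inr h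
    have huv : f d0 → f (M.α d0) := fun h => hv _ (M.labσ _) (hf0 h)
    have hvu : f (M.α d0) → f d0 := fun h => hu _ (M.labσ _) (hf1 h)
    have hall : f d0 → ∀ x, (M.lab x = M.lab d0 ∨ M.lab x = M.lab (M.α d0)) → f x := by
      intro h
      have hcl : ∀ y, f y → f (M.σ y) := by
        intro y hy
        by_cases h0 : y = d0
        · subst h0; exact hf1 (huv h)
        · by_cases h1 : y = M.α d0
          · subst h1; exact hf0 h
          · exact hf2 y h0 h1 hy
      rintro x (hx | hx)
      · exact M.trans f hcl _ _ hx.symm h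
      · exact M.trans f hcl _ _ hx.symm (huv h)
    by_cases hc : M.lab d = M.lab d0 ∨ M.lab d = M.lab (M.α d0)
    · have hc' : M.lab d' = M.lab d0 ∨ M.lab d' = M.lab (M.α d0) := by
        by_contra hcon
        push Not at hcon
        have h1 : ρ (M.lab d) = M.lab d0 := by
          rcases hc with h | h
          · rw [h, hρ0]
          · rw [h, hρ1]
        have h2 : ρ (M.lab d') = M.lab d' := by simp [hρ, hcon.2]
        simp only [h1, h2] at hl
        exact hcon.1 hl.symm
      refine hall ?_ d' hc'
      rcases hc with h | h
      · exact hu _ h hfd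
      · exact hvu (hv _ h hfd)
    · push Not at hc
      have h1 : ρ (M.lab d) = M.lab d := by simp [hρ, hc.2]
      have hc' : M.lab d' = M.lab d := by
        simp only [h1] at hl
        by_cases h : M.lab d' = M.lab (M.α d0)
        · rw [h, hρ1] at hl; exact absurd hl hc.1
        · simp only [hρ, h, if_false] at hl; exact hl.symm
      refine M.trans (fun y => M.lab y = M.lab d → f y) ?_ d d' hc'.symm (fun _ => hfd) hc'
      intro y hy hly
      rw [M.labσ] at hly
      refine hf2 y ?_ ?_ (hy hly)
      · rintro rfl; exact hc.1 hly.symm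
      · rintro rfl; exact hc.2 hly.symm
  · intro z c hz hz0 hc
    simp only [Equiv.Perm.mul_apply] at hc
    have hss : ∀ y, s (s y) = y := fun y => Equiv.swap_apply_self _ _ _
    obtain ⟨w, hw1, hw2⟩ := M.H (fun x => z x + if x = d0 ∨ x = M.α d0 then c d0 + c (M.α d0) else 0)
      (fun y => c (s y)) (by
        intro d
        have : (M.α d = d0 ∨ M.α d = M.α d0) ↔ (d = d0 ∨ d = M.α d0) := by
          constructor
          · rintro (h | h)
            · right; rw [← h, M.αα]
            · left; rw [← M.αα d, h, M.αα]
          · rintro (h | h)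
            · right; rw [h]
            · left; rw [h, M.αα]
        simp only [hz, this]) (by
        intro y
        have h := hc (s y)
        rw [hss] at h
        by_cases h0 : M.σ y = d0
        · simp only [h0, hs0] at h ⊢
          rw [h]
          simp only [true_or, if_true]
          generalize c d0 = a
          generalize c _ = b
          generalize c _ = b
          revert a b; decide +revert
        · by_cases h1 : M.σ y = M.α d0
          · simp only [h1, hs1] at h ⊢
            rw [h]
            simp only [or_true, if_true]
            generalize c d0 = a
            generalize c _ = b
            generalize c _ = b
            revert a b; decide +revert
          · simp only [h0, h1, or_self, if_false, add_zero, hs2 _ h0 h1]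
            exact h)
    refine ⟨w, fun y => w (s y), fun y => hw1 _, ?_, ?_⟩
    · rintro x ⟨h0, h1⟩
      refine ⟨by simp only [hs2 _ h0 h1], ?_⟩
      have := hw2 x
      simpa [h0, h1] using this
    · intro x hx
      have : x = d0 ∨ x = M.α d0 := by
        by_contra h; push Not at h; exact hx h
      rcases this with rfl | rfl
      · simp only [hs0]
      · simp only [hs1, M.αα]

open Classical in
theorem PMap.minor {L T S : Type} (t : L → T) (αS : S → S) (hS : ∀ s, αS (αS s) = s) :
    ∀ (N : ℕ) (D : Type) [Finite D] (_ : Nat.card D ≤ N) (M : PMap D L) (ι : S → D)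
    (_ : Function.Injective ι) (_ : ∀ s, ι (αS s) = M.α (ι s))
    (_ : ∀ s, t (M.lab (ι s)) ≠ t (M.lab (M.α (ι s))))
    (_ : ∀ s s', t (M.lab (ι s)) = t (M.lab (ι s')) →
      Relation.EqvGen (fun a b => ∃ d, M.lab d = a ∧ M.lab (M.α d) = b ∧ t a = t b)
        (M.lab (ι s)) (M.lab (ι s'))),
    ∃ M' : PMap S T, (∀ s, M'.α s = αS s) ∧ ∀ s, M'.lab s = t (M.lab (ι s)) := by
  intro N
  induction N with
  | zero =>
    intro D _ hD M ι hι hα hne hcon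
    have hE : IsEmpty D := by
      rcases isEmpty_or_nonempty D with h | h
      · exact h
      · have := Nat.card_pos (α := D); omega
    have : IsEmpty S := ⟨fun s => hE.elim (ι s)⟩
    refine ⟨⟨Equiv.refl _, αS, fun s => t (M.lab (ι s)), hS, fun s => this.elim s, fun s => rfl,
      fun f _ d => this.elim d, fun z c _ _ => ⟨fun _ => 0, fun d => this.elim d, fun d => this.elim d⟩⟩,
      fun s => rfl, fun s => rfl⟩
  | succ N ih =>
    intro D _ hD M ι hι hα hne hcon
    by_cases hall : ∀ d, d ∈ Set.range ι
    · -- transport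
      let e : S ≃ D := Equiv.ofBijective ι ⟨hι, hall⟩
      have he : ∀ s, e s = ι s := fun s => rfl
      have hesymm : ∀ d, ι (e.symm d) = d := fun d => e.apply_symm_apply d
      have heq : ∀ a b, Relation.EqvGen (fun a b => ∃ d, M.lab d = a ∧ M.lab (M.α d) = b ∧ t a = t b)
          a b → a = b := by
        intro a b h
        induction h with
        | rel a b h =>
          obtain ⟨d, rfl, rfl, h⟩ := h
          obtain ⟨s, rfl⟩ := hall d
          exact absurd h (hne s)
        | refl a => rfl
        | symm a b _ ih => exact ih.symm
        | trans a b c _ _ ih1 ih2 => exact ih1.trans ih2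
      refine ⟨⟨(e.trans M.σ).trans e.symm, αS, fun s => t (M.lab (ι s)), hS, ?_, ?_, ?_, ?_⟩,
        fun s => rfl, fun s => rfl⟩
      · intro s h
        have := hα s
        rw [h] at this
        exact M.αne _ this.symm
      · intro s
        simp only [Equiv.trans_apply, hesymm, he, M.labσ]
      · intro f hf s s' hl hfs
        have := M.trans (fun d => f (e.symm d)) ?_ (ι s) (ι s') (heq _ _ (hcon _ _ hl)) ?_
        · simpa [← he] using this
        · intro d hd
          have := hf _ hd
          simpa using this
        · simpa [← he] using hfs
      · intro z c hz hc
        have hex := M.H (fun d => z (e.symm d)) (fun d => c (e.symm d)) ?_ ?_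
        rotate_left
        · intro d
          obtain ⟨s, rfl⟩ := hall d
          rw [← hα]
          simp only [← he, Equiv.symm_apply_apply, hz]
        · intro d
          have := hc (e.symm d)
          simpa using this
        · obtain ⟨w, hw1, hw2⟩ := hex
          refine ⟨fun s => w (ι s), ?_, ?_⟩
          · intro s
            simp only [hα, Equiv.trans_apply, hesymm, he, hw1]
          · intro s
            simp only [hα, hw2]
            simp [← he]
    · push Not at hall
      obtain ⟨d0, hd0⟩ := hall
      have hd0' : M.α d0 ∉ Set.range ι := by
        rintro ⟨s, hs⟩
        exact hd0 ⟨αS s, by rw [hα, hs, M.αα]⟩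
      have hmem : ∀ s, ι s ∈ edgeCompl M d0 :=
        fun s => ⟨fun h => hd0 ⟨s, h⟩, fun h => hd0' ⟨s, h⟩⟩
      have hcard : Nat.card (edgeCompl M d0) ≤ N := by
        have : Nat.card (edgeCompl M d0) < Nat.card D := by
          have h := Set.ncard_lt_card (s := edgeCompl M d0) (fun h => by
            have : d0 ∈ edgeCompl M d0 := by rw [h]; trivial
            exact this.1 rfl)
          simpa [Set.ncard_def] using h
        omega
      by_cases hdel : M.lab d0 = M.lab (M.α d0) ∨ t (M.lab d0) ≠ t (M.lab (M.α d0))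
      · obtain ⟨M', hM1, hM2⟩ := M.delete d0
        have hι' : ∀ s, M'.α ⟨ι s, hmem s⟩ = ⟨ι (αS s), hmem _⟩ := fun s =>
          Subtype.ext (by rw [hM1]; exact (hα s).symm)
        obtain ⟨M'', h1, h2⟩ := ih _ hcard M' (fun s => ⟨ι s, hmem s⟩)
          (fun s s' h => hι (congrArg Subtype.val h)) (fun s => (hι' s).symm) (fun s => by
            rw [hM2, hM2, hM1]; exact hne s) (fun s s' h => by
            rw [hM2, hM2] at h ⊢
            have h3 := hcon s s' h
            generalize M.lab (ι s) = a at h3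
            change Relation.EqvGen _ a (M.lab (ι s'))
            generalize M.lab (ι s') = b at h3
            clear h
            induction h3 with
            | rel a b h =>
              obtain ⟨d, rfl, rfl, h⟩ := h
              by_cases hd : d ∈ edgeCompl M d0
              · exact .rel _ _ ⟨⟨d, hd⟩, hM2 _, by rw [hM2, hM1], h⟩
              · have hdd : d = d0 ∨ d = M.α d0 := by
                  by_contra h; push Not at h; exact hd h
                have : M.lab d = M.lab (M.α d) := by
                  rcases hdel with h' | h'
                  · rcases hdd with rfl | rfl
                    · exact h'
                    · rw [M.αα, h']
                  · exfalso
                    rcases hdd with rfl | rfl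
                    · exact h' h
                    · rw [M.αα] at h; exact h' h.symm
                rw [← this]; exact .refl _
            | refl a => exact .refl _
            | symm a b _ ih => exact .symm _ _ ih
            | trans a b c _ _ ih1 ih2 => exact .trans _ _ _ ih1 ih2)
        exact ⟨M'', h1, fun s => by rw [h2, hM2]⟩
      · push Not at hdel
        obtain ⟨hl, ht⟩ := hdel
        obtain ⟨M', hM1, hM2⟩ := M.contract d0 hl
        set ρ : L → L := fun l => if l = M.lab (M.α d0) then M.lab d0 else l with hρ
        replace hM2 : ∀ a, M'.lab a = ρ (M.lab a) := hM2
        have hρ0 : ρ (M.lab d0) = M.lab d0 := by simp [hρ, hl]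
        have hρ1 : ρ (M.lab (M.α d0)) = M.lab d0 := by simp [hρ]
        have htρ : ∀ l, t (ρ l) = t l := by
          intro l
          by_cases h : l = M.lab (M.α d0)
          · rw [h, hρ1, ht]
          · simp [hρ, h]
        have hι' : ∀ s, M'.α ⟨ι s, hmem s⟩ = ⟨ι (αS s), hmem _⟩ := fun s =>
          Subtype.ext (by rw [hM1]; exact (hα s).symm)
        obtain ⟨M'', h1, h2⟩ := ih _ hcard M' (fun s => ⟨ι s, hmem s⟩)
          (fun s s' h => hι (congrArg Subtype.val h)) (fun s => (hι' s).symm) (fun s => by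
            rw [hM2, hM2, hM1, htρ, htρ]; exact hne s) (fun s s' h => by
            rw [hM2, hM2, htρ, htρ] at h
            rw [hM2, hM2]
            have h3 := hcon s s' h
            change Relation.EqvGen _ (ρ (M.lab (ι s))) (ρ (M.lab (ι s')))
            generalize M.lab (ι s) = a at h3
            generalize M.lab (ι s') = b at h3
            clear h
            induction h3 with
            | rel a b h =>
              obtain ⟨d, rfl, rfl, h⟩ := h
              by_cases hd : d ∈ edgeCompl M d0
              · exact .rel _ _ ⟨⟨d, hd⟩, hM2 _, by rw [hM2, hM1], by rw [htρ, htρ, h]⟩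
              · have hdd : d = d0 ∨ d = M.α d0 := by
                  by_contra h; push Not at h; exact hd h
                have : ρ (M.lab d) = ρ (M.lab (M.α d)) := by
                  rcases hdd with rfl | rfl
                  · rw [hρ0, hρ1]
                  · rw [M.αα, hρ0, hρ1]
                rw [← this]; exact .refl _
            | refl a => exact .refl _
            | symm a b _ ih => exact .symm _ _ ih
            | trans a b c _ _ ih1 ih2 => exact .trans _ _ _ ih1 ih2)
        exact ⟨M'', h1, fun s => by rw [h2, hM2, htρ]⟩

end minor

end BCL


namespace BCL

lemma exists_prim (g : ℤ → ZMod 2) : ∃ P : ℤ → ZMod 2, P 0 = 0 ∧ ∀ x, P x + P (x - 1) = g x := by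
  let P : ℤ → ZMod 2 := fun x => match x with
    | Int.ofNat n => ∑ k ∈ Finset.range n, g (k + 1)
    | Int.negSucc n => ∑ k ∈ Finset.range (n + 1), g (-k)
  have h1 : ∀ n : ℕ, P n = ∑ k ∈ Finset.range n, g (k + 1) := fun n => rfl
  have h2 : ∀ n : ℕ, P (-(n:ℤ) - 1) = ∑ k ∈ Finset.range (n + 1), g (-k) := by
    intro n
    have : -(n:ℤ) - 1 = Int.negSucc n := by rw [Int.negSucc_eq]; ring
    rw [this]
  refine ⟨P, by have := h1 0; simpa using this, ?_⟩
  intro x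
  rcases lt_or_ge 0 x with hx | hx
  · obtain ⟨n, rfl⟩ : ∃ n : ℕ, x = n + 1 := ⟨(x - 1).toNat, by omega⟩
    have e : ((n:ℤ) + 1 - 1) = (n:ℤ) := by ring
    have e' : ((n:ℤ) + 1) = ((n + 1 : ℕ) : ℤ) := by push_cast; ring
    rw [e, h1 n, e', h1 (n+1), Finset.sum_range_succ]
    push_cast
    generalize g _ = a
    generalize (Finset.sum _ _ : ZMod 2) = b
    revert a b; decide
  · obtain ⟨n, rfl⟩ : ∃ n : ℕ, x = -(n:ℤ) := ⟨(-x).toNat, by omega⟩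
    rw [h2]
    rcases Nat.eq_zero_or_pos n with rfl | hn
    · have := h1 0
      simp at this
      simp [this]
    · obtain ⟨m, rfl⟩ : ∃ m, n = m + 1 := ⟨n - 1, by omega⟩
      have e : (-((m + 1 : ℕ) : ℤ)) = -(m:ℤ) - 1 := by push_cast; ring
      rw [e, h2, Finset.sum_range_succ _ (m+1)]
      push_cast
      have e : (-1 + -(m:ℤ)) = -(m:ℤ) - 1 := by ring
      rw [show (-((m:ℤ) + 1)) = -(m:ℤ) - 1 by ring]
      generalize g _ = a
      generalize (Finset.sum _ _ : ZMod 2) = b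
      revert a b; decide

abbrev Pt := ℤ × ℤ
abbrev GD := Pt × ZMod 4

def gstep : ZMod 4 → Pt := ![(1, 0), (0, 1), (-1, 0), (0, -1)]

lemma gstep_add (i : ZMod 4) : gstep i + gstep (i + 2) = 0 := by revert i; decide

def gα (d : GD) : GD := (d.1 + gstep d.2, d.2 + 2)
def gσ : Equiv.Perm GD where
  toFun d := (d.1, d.2 + 1)
  invFun d := (d.1, d.2 - 1)
  left_inv d := by simp
  right_inv d := by simp

lemma gαα (d : GD) : gα (gα d) = d := by
  obtain ⟨p, i⟩ := d
  simp only [gα, add_assoc, gstep_add]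
  refine Prod.ext (by simp) ?_
  change i + (2 + 2) = i
  revert i; decide

lemma gαne (d : GD) : gα d ≠ d := by
  obtain ⟨p, i⟩ := d
  intro h
  have := congrArg Prod.snd h
  simp only [gα] at this
  clear h
  revert this; revert i; decide

lemma grid_H (z c : GD → ZMod 2) (hz : ∀ d, z (gα d) = z d)
    (hc : ∀ d, z (gσ d) = c (gσ d) + c d) :
    ∃ w : GD → ZMod 2, (∀ d, w (gα (gσ d)) = w d) ∧ ∀ d, w d + w (gα d) = z d := by
  choose PX hX0 hX using fun x : ℤ => exists_prim (fun y => z ((x, y), 0))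
  obtain ⟨PY, hY0, hY⟩ := exists_prim (fun x => z ((x, 0), 1))
  have hz2 : ∀ x y, z ((x, y), 2) = z ((x - 1, y), 0) := by
    intro x y
    rw [← hz ((x - 1, y), 0)]
    simp [gα, gstep]
  have hz3 : ∀ x y, z ((x, y), 3) = z ((x, y - 1), 1) := by
    intro x y
    rw [← hz ((x, y - 1), 1)]
    simp only [gα, gstep]
    congr 1
    ext <;> simp
    decide
  have hv : ∀ x y, z ((x, y), 0) + z ((x, y), 1) + z ((x - 1, y), 0) + z ((x, y - 1), 1) = 0 := by
    intro x y
    rw [← hz2, ← hz3]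
    have h0 := hc ((x, y), 0)
    have h1 := hc ((x, y), 1)
    have h2 := hc ((x, y), 2)
    have h3 := hc ((x, y), 3)
    simp only [gσ, Equiv.coe_fn_mk, zero_add, show (1 + 1 : ZMod 4) = 2 from rfl,
      show (2 + 1 : ZMod 4) = 3 from rfl, show (3 + 1 : ZMod 4) = 0 from rfl] at h0 h1 h2 h3
    rw [h0, h1, h2, h3]
    generalize c _ = a1
    generalize c _ = a2
    generalize c _ = a3
    generalize c _ = a4
    revert a1 a2 a3 a4; decide
  set W : ℤ → ℤ → ZMod 2 := fun x y => PY x + PX x y with hW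
  have hWx : ∀ x y, W x y + W x (y - 1) = z ((x, y), 0) := by
    intro x y
    rw [← hX x y]
    simp only [hW]
    generalize PY x = a
    generalize PX _ _ = b
    generalize PX _ _ = c
    revert a b c; decide
  have hWy : ∀ x y, W x y + W (x - 1) y = z ((x, y), 1) := by
    intro x
    have step : ∀ y, (W x y + W (x - 1) y = z ((x, y), 1)) ↔
        (W x (y-1) + W (x - 1) (y-1) = z ((x, y-1), 1)) := by
      intro y
      have h1 := hWx x y
      have h2 := hWx (x - 1) y
      have h3 := hv x y
      rw [← h1, ← h2] at h3
      generalize z ((x, y), 1) = a1 at *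
      generalize z ((x, y - 1), 1) = a2 at *
      generalize W _ _ = a3 at *
      generalize W _ _ = a4 at *
      generalize W _ _ = a5 at *
      generalize W _ _ = a6 at *
      clear h1 h2
      revert a1 a2 a3 a4 a5 a6; decide
    intro y
    induction y with
    | zero =>
      have := hY x
      simp only [hW, hX0, add_zero]; exact this
    | succ i ih => rw [step, add_sub_cancel_right]; exact ih
    | pred i ih => exact (step _).1 ih
  let w : GD → ZMod 2 := fun d => (![W d.1.1 d.1.2, W (d.1.1 - 1) d.1.2, W (d.1.1 - 1) (d.1.2 - 1),
    W d.1.1 (d.1.2 - 1)] : Fin 4 → ZMod 2) d.2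
  refine ⟨w, ?_, ?_⟩
  · rintro ⟨⟨x, y⟩, i⟩
    have : i = 0 ∨ i = 1 ∨ i = 2 ∨ i = 3 := by revert i; decide
    rcases this with rfl | rfl | rfl | rfl
    · change w ((x, y) + gstep 1, 3) = w ((x,y),0)
      simp [w, gstep]
    · change w ((x, y) + gstep 2, 0) = w ((x,y),1)
      simp [w, gstep]; rfl
    · change w ((x, y) + gstep 3, 1) = w ((x,y),2)
      simp [w, gstep]; rfl
    · change w ((x, y) + gstep 0, 2) = w ((x,y),3)
      simp [w, gstep]
  · rintro ⟨⟨x, y⟩, i⟩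
    have : i = 0 ∨ i = 1 ∨ i = 2 ∨ i = 3 := by revert i; decide
    rcases this with rfl | rfl | rfl | rfl
    · change w ((x, y), 0) + w ((x,y) + gstep 0,2) = _
      rw [← hWx]
      simp [w, gstep]
    · change w ((x, y), 1) + w ((x,y) + gstep 1,3) = _
      rw [← hWy]
      simp [w, gstep, add_comm]
    · change w ((x, y), 2) + w ((x,y) + gstep 2,0) = _
      rw [hz2, ← hWx]
      change W (x-1) (y-1) + w ((x,y) + (-1,0),0) = _
      simp [w]; rw [add_comm]; rfl
    · change w ((x, y), 3) + w ((x,y) + gstep 3,1) = _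
      rw [hz3, ← hWy]
      change W x (y-1) + w ((x,y) + (0,-1),1) = _
      simp [w]; rfl

theorem grid_PMap (A : Set GD) (hfin : A.Finite) (hA : ∀ d ∈ A, gα d ∈ A) :
    ∃ M : PMap A Pt, (∀ a : A, (M.α a : GD) = gα a) ∧ ∀ a : A, M.lab a = (a : GD).1 := by
  refine restrict gσ gα (fun d => d.1) gαα gαne (fun d => rfl) ?_ ?_ A hfin hA ?_
  · intro f hf d d' h hd
    obtain ⟨p, i⟩ := d
    obtain ⟨p', j⟩ := d'
    obtain rfl : p = p' := h
    have hs : ∀ k, f (p, k) → f (p, k + 1) := fun k hk => hf _ hk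
    have h1 := hs _ hd
    have h2 := hs _ h1
    have h3 := hs _ h2
    have : ∀ i j : ZMod 4, j = i ∨ j = i + 1 ∨ j = i + 1 + 1 ∨ j = i + 1 + 1 + 1 := by decide
    replace this := this i j
    rcases this with rfl | rfl | rfl | rfl <;> assumption
  · rintro ⟨p, i⟩
    refine ⟨3, ?_⟩
    change (p, i + 1 + 1 + 1 + 1) = (p, i)
    congr 1
    revert i; decide
  · intro z c hz hz0 hc
    obtain ⟨w, h1, h2⟩ := grid_H z c hz hc
    refine ⟨w, w, h1, fun x _ => ⟨rfl, h2 x⟩, fun x hx => ?_⟩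
    have := h2 x
    rw [hz0 x hx] at this
    generalize w x = a at *
    generalize w (gα x) = b at *
    revert a b; decide

end BCL


namespace BCL

def GAdj (B : Set Pt) (a b : Pt) : Prop := a ∈ B ∧ b ∈ B ∧ ∃ i, b = a + gstep i
def GConn (B : Set Pt) (a b : Pt) : Prop := Relation.EqvGen (GAdj B) a b

lemma GAdj.symm {B : Set Pt} {a b : Pt} (h : GAdj B a b) : GAdj B b a := by
  obtain ⟨h1, h2, i, rfl⟩ := h
  exact ⟨h2, h1, i + 2, by rw [add_assoc, gstep_add, add_zero]⟩

lemma eqvGen_sub {X : Type*} {r r' : X → X → Prop} (h : ∀ a b, r a b → Relation.EqvGen r' a b) {a b : X}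
    (hab : Relation.EqvGen r a b) : Relation.EqvGen r' a b := by
  induction hab with
  | rel a b h' => exact h _ _ h'
  | refl a => exact .refl _
  | symm a b _ ih => exact .symm _ _ ih
  | trans a b c _ _ ih1 ih2 => exact .trans _ _ _ ih1 ih2

lemma eqvGen_split {X : Type*} {r : X → X → Prop} (hs : ∀ a b, r a b → r b a) (C : Set X) {a b : X}
    (hab : Relation.EqvGen r a b) : (a ∈ C ↔ b ∈ C) ∨ ∃ x y, r x y ∧ x ∈ C ∧ y ∉ C := by
  induction hab with
  | rel a b h' =>
    by_cases h1 : a ∈ C <;> by_cases h2 : b ∈ C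
    · left; tauto
    · right; exact ⟨a, b, h', h1, h2⟩
    · right; exact ⟨b, a, hs _ _ h', h2, h1⟩
    · left; tauto
  | refl a => left; rfl
  | symm a b _ ih => tauto
  | trans a b c _ _ ih1 ih2 =>
    rcases ih1 with h1 | h1
    · rcases ih2 with h2 | h2
      · left; exact h1.trans h2
      · right; exact h2
    · right; exact h1

open Classical in
theorem grid_minor {S P : Type} [Finite S] [Finite P] [Nonempty P] (st en : S → P)
    (hne : ∀ s, st s ≠ en s) (AP : P → Set Pt) (AS : S → Set Pt)
    (finP : ∀ p, (AP p).Finite) (finS : ∀ s, (AS s).Finite)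
    (conP : ∀ p, ∀ a ∈ AP p, ∀ b ∈ AP p, GConn (AP p) a b)
    (conS : ∀ s, ∀ a ∈ AS s, ∀ b ∈ AS s, GConn (AS s) a b)
    (hPP : ∀ p q g, g ∈ AP p → g ∈ AP q → p = q)
    (hSS : ∀ s s' g, g ∈ AS s → g ∈ AS s' → s = s')
    (hSP : ∀ s p g, g ∈ AS s → g ∈ AP p → p = st s ∨ p = en s)
    (hst : ∀ s, ∃ g, g ∈ AS s ∧ g ∈ AP (st s)) (hen : ∀ s, ∃ g, g ∈ AS s ∧ g ∈ AP (en s)) :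
    ∃ M : PMap (S × Bool) P, (∀ s b, M.α (s, b) = (s, !b)) ∧
      (∀ s, M.lab (s, false) = st s) ∧ (∀ s, M.lab (s, true) = en s) := by
  let C : S → Set Pt := fun s => {g | g ∈ AS s \ AP (en s) ∧
    ∃ h, h ∈ AP (st s) ∧ h ∈ AS s \ AP (en s) ∧ GConn (AS s \ AP (en s)) h g}
  let B : P → Set Pt := fun p => {g | g ∈ AP p ∨ ∃ s, st s = p ∧ g ∈ C s}
  have hB : ∀ p q g, g ∈ B p → g ∈ B q → p = q := by
    intro p q g hp hq
    have aux : ∀ p s g, g ∈ AP p → g ∈ C s → p = st s := by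
      intro p s g h1 h2
      rcases hSP s p g h2.1.1 h1 with h | h
      · exact h
      · subst h; exact absurd h1 h2.1.2
    rcases hp with h1 | ⟨s, rfl, h1⟩ <;> rcases hq with h2 | ⟨s', rfl, h2⟩
    · exact hPP _ _ _ h1 h2
    · exact aux _ _ _ h1 h2
    · exact (aux _ _ _ h2 h1).symm
    · rw [hSS _ _ _ h1.1.1 h2.1.1]
  let t : Pt → P := fun g => Classical.epsilon (fun p => g ∈ B p)
  have ht : ∀ p g, g ∈ B p → t g = p := by
    intro p g h
    have : g ∈ B (t g) := Classical.epsilon_spec (p := fun p => g ∈ B p) ⟨p, h⟩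
    exact hB _ _ _ this h
  -- marked edges
  have hmark : ∀ s, ∃ g i, g ∈ C s ∧ g + gstep i ∈ AS s ∧ g + gstep i ∈ AP (en s) := by
    intro s
    obtain ⟨a, ha1, ha2⟩ := hst s
    obtain ⟨b, hb1, hb2⟩ := hen s
    have ha3 : a ∉ AP (en s) := fun h => hne s (hPP _ _ _ ha2 h)
    have haC : a ∈ C s := ⟨⟨ha1, ha3⟩, a, ha2, ⟨ha1, ha3⟩, .refl _⟩
    rcases eqvGen_split (fun a b => GAdj.symm) (C s) (conS s a ha1 b hb1) with h | ⟨x, y, h, hx, hy⟩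
    · exact absurd hb2 (h.1 haC).1.2
    · obtain ⟨h1, h2, i, rfl⟩ := h
      refine ⟨x, i, hx, h2, ?_⟩
      by_contra hcon
      obtain ⟨hx1, k, hk1, hk2, hk3⟩ := hx
      exact hy ⟨⟨h2, hcon⟩, k, hk1, hk2, .trans _ _ _ hk3 (.rel _ _ ⟨hx1, ⟨h2, hcon⟩, i, rfl⟩)⟩
  choose mg mi hm1 hm2 hm3 using hmark
  let U : Set Pt := {g | ∃ p, g ∈ B p}
  have hU : U.Finite := by
    have : U ⊆ (⋃ p, AP p) ∪ (⋃ s, AS s) := by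
      rintro g ⟨p, h | ⟨s, _, h⟩⟩
      · left; exact Set.mem_iUnion.2 ⟨p, h⟩
      · right; exact Set.mem_iUnion.2 ⟨s, h.1.1⟩
    exact ((Set.finite_iUnion finP).union (Set.finite_iUnion finS)).subset this
  let A : Set GD := {d | d.1 ∈ U ∧ (gα d).1 ∈ U}
  have hAfin : A.Finite := by
    refine (hU.prod (Set.finite_univ (α := ZMod 4))).subset ?_
    rintro d ⟨h, _⟩
    exact ⟨h, trivial⟩
  have hAα : ∀ d ∈ A, gα d ∈ A := by
    rintro d ⟨h1, h2⟩
    exact ⟨h2, by rw [gαα]; exact h1⟩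
  obtain ⟨M, hM1, hM2⟩ := grid_PMap A hAfin hAα
  have : Finite A := hAfin
  have hmA : ∀ s, ((mg s, mi s) : GD) ∈ A := fun s =>
    ⟨⟨st s, .inr ⟨s, rfl, hm1 s⟩⟩, ⟨en s, .inl (hm3 s)⟩⟩
  let ι : S × Bool → A := fun x => bif x.2 then M.α ⟨_, hmA x.1⟩ else ⟨_, hmA x.1⟩
  have hι0 : ∀ s, ι (s, false) = ⟨_, hmA s⟩ := fun s => rfl
  have hι1 : ∀ s, ι (s, true) = M.α ⟨_, hmA s⟩ := fun s => rfl
  have hl0 : ∀ s, M.lab (ι (s, false)) = mg s := fun s => by rw [hι0, hM2]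
  have hl1 : ∀ s, M.lab (ι (s, true)) = mg s + gstep (mi s) := fun s => by
    rw [hι1, hM2, hM1]; rfl
  have ht0 : ∀ s, t (M.lab (ι (s, false))) = st s := fun s => by
    rw [hl0]; exact ht _ _ (.inr ⟨s, rfl, hm1 s⟩)
  have ht1 : ∀ s, t (M.lab (ι (s, true))) = en s := fun s => by
    rw [hl1]; exact ht _ _ (.inl (hm3 s))
  have hlS : ∀ s b, M.lab (ι (s, b)) ∈ AS s := by
    intro s b
    cases b
    · rw [hl0]; exact (hm1 s).1.1
    · rw [hl1]; exact hm2 s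
  have hlB : ∀ x, M.lab (ι x) ∈ B (t (M.lab (ι x))) := by
    rintro ⟨s, b⟩
    cases b
    · rw [ht0, hl0]; exact .inr ⟨s, rfl, hm1 s⟩
    · rw [ht1, hl1]; exact .inl (hm3 s)
  have hcl : ∀ x : S × Bool, ι (x.1, !x.2) = M.α (ι x) := by
    rintro ⟨s, b⟩
    cases b
    · rfl
    · simp only [Bool.not_true]; rw [hι1, M.αα, hι0]
  obtain ⟨M', h1, h2⟩ := PMap.minor t (fun x : S × Bool => (x.1, !x.2)) (by simp) (Nat.card A) A le_rfl M ι
    (by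
      rintro ⟨s, b⟩ ⟨s', b'⟩ h
      have e : s = s' := by
        have h1 := hlS s b
        rw [h] at h1
        exact hSS _ _ _ h1 (hlS s' b')
      subst e
      have h3 : t (M.lab (ι (s, b))) = t (M.lab (ι (s, b'))) := by rw [h]
      cases b <;> cases b'
      · rfl
      · rw [ht0, ht1] at h3; exact absurd h3 (hne s)
      · rw [ht0, ht1] at h3; exact absurd h3.symm (hne s)
      · rfl) hcl
    (by
      rintro ⟨s, b⟩
      rw [← hcl]
      cases b
      · simp only [Bool.not_false]; rw [ht0, ht1]; exact hne s
      · simp only [Bool.not_true]; rw [ht0, ht1]; exact (hne s).symm)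
    (by
      intro x x' hxx
      have hadj : ∀ p (B' : Set Pt), (∀ g ∈ B', g ∈ B p) → ∀ a b, GConn B' a b →
          Relation.EqvGen (fun a b => ∃ d, M.lab d = a ∧ M.lab (M.α d) = b ∧ t a = t b) a b := by
        intro p B' hB' a b hab
        refine eqvGen_sub ?_ hab
        rintro a b ⟨ha, hb, i, rfl⟩
        have hd : ((a, i) : GD) ∈ A := ⟨⟨p, hB' _ ha⟩, ⟨p, hB' _ hb⟩⟩
        refine .rel _ _ ⟨⟨_, hd⟩, by rw [hM2], by rw [hM2, hM1]; rfl, ?_⟩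
        rw [ht p _ (hB' _ ha), ht p _ (hB' _ hb)]
      have hto : ∀ p g, g ∈ B p → ∃ h ∈ AP p,
          Relation.EqvGen (fun a b => ∃ d, M.lab d = a ∧ M.lab (M.α d) = b ∧ t a = t b) h g := by
        rintro p g (h | ⟨s, rfl, hg, h, hh1, hh2, hh3⟩)
        · exact ⟨g, h, .refl _⟩
        · refine ⟨h, hh1, ?_⟩
          have hC : Relation.EqvGen (GAdj (C s)) h g := by
            have hh : h ∈ C s := ⟨hh2, h, hh1, hh2, .refl _⟩
            clear hg
            have key : ∀ a b, GConn (AS s \ AP (en s)) a b → (a ∈ C s ↔ b ∈ C s) ∧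
                (a ∈ C s → Relation.EqvGen (GAdj (C s)) a b) := by
              intro a b hab
              induction hab with
              | rel a b hr =>
                have hiff : a ∈ C s ↔ b ∈ C s := by
                  constructor
                  · rintro ⟨_, k, hk1, hk2, hk3⟩
                    exact ⟨hr.2.1, k, hk1, hk2, .trans _ _ _ hk3 (.rel _ _ hr)⟩
                  · rintro ⟨_, k, hk1, hk2, hk3⟩
                    exact ⟨hr.1, k, hk1, hk2, .trans _ _ _ hk3 (.rel _ _ hr.symm)⟩
                exact ⟨hiff, fun ha => .rel _ _ ⟨ha, hiff.1 ha, hr.2.2⟩⟩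
              | refl a => exact ⟨Iff.rfl, fun _ => .refl _⟩
              | symm a b _ ih => exact ⟨ih.1.symm, fun h => .symm _ _ (ih.2 (ih.1.2 h))⟩
              | trans a b c _ _ ih1 ih2 =>
                exact ⟨ih1.1.trans ih2.1, fun h => .trans _ _ _ (ih1.2 h) (ih2.2 (ih1.1.1 h))⟩
            exact (key _ _ hh3).2 hh
          exact hadj (st s) (C s) (fun g hg => .inr ⟨s, rfl, hg⟩) _ _ hC
      obtain ⟨a, ha1, ha2⟩ := hto _ _ (hlB x)
      obtain ⟨b, hb1, hb2⟩ := hto _ _ (hlB x')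
      rw [← hxx] at hb1
      have h3 := hadj _ (AP _) (fun g hg => .inl hg) _ _ (conP _ a ha1 b hb1)
      exact .trans _ _ _ (.symm _ _ ha2) (.trans _ _ _ h3 hb2))
  refine ⟨M', fun s b => h1 _, fun s => by rw [h2, ht0], fun s => by rw [h2, ht1]⟩

end BCL


namespace BCL
open Filter Topology

def NB (δ : ℝ) (x : ℝ × ℝ) : Set Pt := {g | |δ * g.1 - x.1| < δ ∧ |δ * g.2 - x.2| < δ}
def AK (δ : ℝ) (K : Set (ℝ × ℝ)) : Set Pt := {g | ∃ x ∈ K, g ∈ NB δ x}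

lemma floor_near {δ : ℝ} (hδ : 0 < δ) (x : ℝ) : |δ * ⌊x / δ⌋ - x| < δ := by
  have h1 := Int.floor_le (x / δ)
  have h2 := Int.lt_floor_add_one (x / δ)
  rw [le_div_iff₀ hδ] at h1
  rw [div_lt_iff₀ hδ] at h2
  rw [abs_lt]; constructor <;> nlinarith

lemma NB_nonempty {δ : ℝ} (hδ : 0 < δ) (x : ℝ × ℝ) : ∃ g, g ∈ NB δ x :=
  ⟨(⌊x.1 / δ⌋, ⌊x.2 / δ⌋), floor_near hδ _, floor_near hδ _⟩

lemma near_int {δ : ℝ} (hδ : 0 < δ) {x : ℝ} {m n : ℤ} (h1 : |δ * m - x| < δ) (h2 : |δ * n - x| < δ) :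
    m = n ∨ m = n + 1 ∨ m = n - 1 := by
  rw [abs_lt] at h1 h2
  have h3 : (m:ℝ) - n < 2 := by nlinarith
  have h4 : (n:ℝ) - m < 2 := by nlinarith
  have h5 : m - n < 2 := by exact_mod_cast h3
  have h6 : n - m < 2 := by exact_mod_cast h4
  omega

lemma NB_conn {δ : ℝ} (hδ : 0 < δ) {x : ℝ × ℝ} {B : Set Pt} (hB : ∀ g ∈ NB δ x, g ∈ B) {g h : Pt}
    (hg : g ∈ NB δ x) (hh : h ∈ NB δ x) : GConn B g h := by
  obtain ⟨a, b⟩ := g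
  obtain ⟨c, d⟩ := h
  have hm : (c, b) ∈ NB δ x := ⟨hh.1, hg.2⟩
  have h1 : GConn B (a, b) (c, b) := by
    rcases near_int hδ hg.1 hh.1 with h | h | h
    · simp only at h; rw [h]; exact .refl _
    · exact .rel _ _ ⟨hB _ hg, hB _ hm, 2, by simp only at h; ext <;> simp [gstep, h]⟩
    · exact .rel _ _ ⟨hB _ hg, hB _ hm, 0, by simp only at h; ext <;> simp [gstep, h]⟩
  have h2 : GConn B (c, b) (c, d) := by
    rcases near_int hδ hg.2 hh.2 with h | h | h
    · simp only at h; rw [h]; exact .refl _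
    · refine .rel _ _ ⟨hB _ hm, hB _ hh, 3, ?_⟩
      change (c, d) = (c, b) + (0, -1)
      simp only at h; ext <;> simp [h]
    · exact .rel _ _ ⟨hB _ hm, hB _ hh, 1, by simp only at h; ext <;> simp [gstep, h]⟩
  exact .trans _ _ _ h1 h2

lemma AK_conn {δ : ℝ} (hδ : 0 < δ) {K : Set (ℝ × ℝ)} (hK : IsPreconnected K) :
    ∀ a ∈ AK δ K, ∀ b ∈ AK δ K, GConn (AK δ K) a b := by
  rintro a ⟨x, hx, ha⟩ b ⟨y, hy, hb⟩
  have hB : ∀ x ∈ K, ∀ g ∈ NB δ x, g ∈ AK δ K := fun x hx g hg => ⟨x, hx, hg⟩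
  have := hK.induction₂ (fun x y => x ∈ K → y ∈ K → ∀ a ∈ NB δ x, ∀ b ∈ NB δ y, GConn (AK δ K) a b)
    ?_ ?_ ?_ hx hy
  · exact this hx hy a ha b hb
  · intro x hx
    obtain ⟨g, hg⟩ := NB_nonempty hδ x
    have hev : ∀ᶠ y in 𝓝[K] x, g ∈ NB δ y := by
      refine Filter.Eventually.filter_mono nhdsWithin_le_nhds ?_
      have h1 : ∀ᶠ y : ℝ × ℝ in 𝓝 x, |δ * g.1 - y.1| < δ :=
        ContinuousAt.eventually_lt (by fun_prop) (by fun_prop) hg.1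
      have h2 : ∀ᶠ y : ℝ × ℝ in 𝓝 x, |δ * g.2 - y.2| < δ :=
        ContinuousAt.eventually_lt (by fun_prop) (by fun_prop) hg.2
      exact h1.and h2
    filter_upwards [hev] with y hy hxK hyK a ha b hb
    exact .trans _ _ _ (NB_conn hδ (hB x hxK) ha hg) (NB_conn hδ (hB y hyK) hy hb)
  · intro x y z hx hy hz h1 h2 _ _ a ha b hb
    obtain ⟨g, hg⟩ := NB_nonempty hδ y
    exact .trans _ _ _ (h1 hx hy a ha g hg) (h2 hy hz g hg b hb)
  · intro x y hx hy h _ _ a ha b hb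
    exact .symm _ _ (h hx hy b hb a ha)

lemma AK_finite {δ : ℝ} (hδ : 0 < δ) {K : Set (ℝ × ℝ)} (hK : IsCompact K) : (AK δ K).Finite := by
  obtain ⟨R, hR⟩ := hK.isBounded.subset_closedBall (0 : ℝ × ℝ)
  have key : ∀ (u : ℝ) (m : ℤ), |u| ≤ R → |δ * m - u| < δ → m ∈ Set.Icc (-⌈R / δ + 1⌉) ⌈R / δ + 1⌉ := by
    intro u m hu hm
    have h1 : |(m:ℝ)| ≤ R / δ + 1 := by
      have : |δ * m| ≤ R + δ := by
        calc |δ * m| = |(δ * m - u) + u| := by ring_nf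
          _ ≤ |δ * m - u| + |u| := abs_add_le _ _
          _ ≤ R + δ := by linarith
      rw [abs_mul, abs_of_pos hδ] at this
      have h2 : |(m:ℝ)| ≤ (R + δ) / δ := by rw [le_div_iff₀ hδ]; linarith
      rwa [add_div, div_self hδ.ne'] at h2
    have h2 : |(m:ℝ)| ≤ (⌈R / δ + 1⌉ : ℤ) := h1.trans (Int.le_ceil _)
    rw [abs_le] at h2
    constructor
    · have := h2.1; exact_mod_cast this
    · have := h2.2; exact_mod_cast this
  refine ((Set.finite_Icc (-⌈R / δ + 1⌉) ⌈R / δ + 1⌉).prod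
    (Set.finite_Icc (-⌈R / δ + 1⌉) ⌈R / δ + 1⌉)).subset ?_
  rintro ⟨m, n⟩ ⟨x, hx, h1, h2⟩
  have hb := hR hx
  rw [Metric.mem_closedBall, dist_zero_right, Prod.norm_def, max_le_iff] at hb
  exact ⟨key _ _ hb.1 h1, key _ _ hb.2 h2⟩

lemma AK_inter {δ : ℝ} {K K' : Set (ℝ × ℝ)} {g : Pt} (h : g ∈ AK δ K) (h' : g ∈ AK δ K') :
    ∃ x ∈ K, ∃ y ∈ K', dist x y < 2 * δ := by
  obtain ⟨x, hx, h1, h2⟩ := h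
  obtain ⟨y, hy, h3, h4⟩ := h'
  refine ⟨x, hx, y, hy, ?_⟩
  rw [Prod.dist_eq, max_lt_iff, Real.dist_eq, Real.dist_eq]
  rw [abs_lt] at *
  rw [abs_lt]
  constructor <;> constructor <;> linarith

lemma AK_mem {δ : ℝ} (hδ : 0 < δ) {K K' : Set (ℝ × ℝ)} {x : ℝ × ℝ} (h : x ∈ K) (h' : x ∈ K') :
    ∃ g, g ∈ AK δ K ∧ g ∈ AK δ K' := by
  obtain ⟨g, hg⟩ := NB_nonempty hδ x
  exact ⟨g, ⟨x, h, hg⟩, ⟨x, h', hg⟩⟩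

lemma compact_sep {I : Type} [Finite I] (K : I → Set (ℝ × ℝ)) (hK : ∀ i, IsCompact (K i)) :
    ∃ δ > 0, ∀ i j, Disjoint (K i) (K j) → ∀ x ∈ K i, ∀ y ∈ K j, 2 * δ ≤ dist x y := by
  have h : ∀ i j, ∃ ε > 0, Disjoint (K i) (K j) → ∀ x ∈ K i, ∀ y ∈ K j, ε ≤ dist x y := by
    intro i j
    by_cases hd : Disjoint (K i) (K j)
    · obtain ⟨ε, h1, h2⟩ := hd.exists_thickenings (hK i) (hK j).isClosed
      refine ⟨ε, h1, fun _ x hx y hy => ?_⟩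
      by_contra hcon
      push Not at hcon
      refine (Set.disjoint_left.1 h2 : ∀ ⦃a⦄, _) ?_ (Metric.self_subset_thickening h1 _ hy)
      exact Metric.mem_thickening_iff.2 ⟨x, hx, by rwa [dist_comm]⟩
    · exact ⟨1, one_pos, fun h => absurd h hd⟩
  choose ε h1 h2 using h
  have hev : ∀ᶠ δ in 𝓝[>] (0:ℝ), ∀ i j, 2 * δ ≤ ε i j := by
    rw [Filter.eventually_all]; intro i
    rw [Filter.eventually_all]; intro j
    have : Set.Ioo (0:ℝ) (ε i j / 2) ∈ 𝓝[>] (0:ℝ) := Ioo_mem_nhdsGT (by linarith [h1 i j])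
    filter_upwards [this] with δ hδ
    linarith [hδ.2]
  obtain ⟨δ, h3, h4⟩ := (hev.and self_mem_nhdsWithin).exists
  exact ⟨δ, h4, fun i j hd x hx y hy => (h3 i j).trans (h2 i j hd x hx y hy)⟩

theorem topo {S : Type} [Finite S] (Q : Set (ℝ × ℝ)) (hQ : Q.Finite) (hQn : Q.Nonempty)
    (γ : S → ℝ → ℝ × ℝ)
    (hc : ∀ s, ContinuousOn (γ s) (Set.Icc 0 1)) (hi : ∀ s, Set.InjOn (γ s) (Set.Icc 0 1))
    (h0 : ∀ s, γ s 0 ∈ Q) (h1 : ∀ s, γ s 1 ∈ Q) (hinner : ∀ s, ∀ t ∈ Set.Ioo (0:ℝ) 1, γ s t ∉ Q)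
    (hdis : ∀ s s', s ≠ s' → ∀ t ∈ Set.Icc (0:ℝ) 1, ∀ t' ∈ Set.Icc (0:ℝ) 1, γ s t = γ s' t' → γ s t ∈ Q) :
    ∃ M : PMap (S × Bool) (ℝ × ℝ), (∀ s b, M.α (s, b) = (s, !b)) ∧
      (∀ s, M.lab (s, false) = γ s 0) ∧ (∀ s, M.lab (s, true) = γ s 1) := by
  have : Finite Q := hQ
  have : Nonempty Q := hQn.to_subtype
  have z0 : (0:ℝ) ∈ Set.Icc (0:ℝ) 1 := by simp
  have z1 : (1:ℝ) ∈ Set.Icc (0:ℝ) 1 := by simp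
  -- radius
  obtain ⟨r, hr, hrs⟩ := compact_sep (I := Q ⊕ S)
    (fun i => Sum.elim (fun q : Q => {(q : ℝ × ℝ)}) (fun s => γ s '' Set.Icc 0 1) i) (by
      rintro (q | s)
      · exact isCompact_singleton
      · exact isCompact_Icc.image_of_continuousOn (hc s))
  have hab : ∀ s, ∃ a b, a ∈ Set.Ioo (0:ℝ) 1 ∧ b ∈ Set.Ioo (0:ℝ) 1 ∧ a ≤ b ∧
      dist (γ s a) (γ s 0) ≤ r / 2 ∧ dist (γ s b) (γ s 1) ≤ r / 2 := by
    intro s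
    have e0 : ∀ᶠ t in 𝓝[Set.Icc 0 1] (0:ℝ), dist (γ s t) (γ s 0) < r / 2 :=
      Metric.tendsto_nhds.1 (hc s 0 z0) _ (by linarith)
    have e1 : ∀ᶠ t in 𝓝[Set.Icc 0 1] (1:ℝ), dist (γ s t) (γ s 1) < r / 2 :=
      Metric.tendsto_nhds.1 (hc s 1 z1) _ (by linarith)
    have m0 : 𝓝[>] (0:ℝ) ≤ 𝓝[Set.Icc 0 1] (0:ℝ) := by
      refine nhdsWithin_le_iff.2 ?_
      filter_upwards [Ioo_mem_nhdsGT (show (0:ℝ) < 1 by norm_num)] with t ht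
      exact ⟨ht.1.le, ht.2.le⟩
    have m1 : 𝓝[<] (1:ℝ) ≤ 𝓝[Set.Icc 0 1] (1:ℝ) := by
      refine nhdsWithin_le_iff.2 ?_
      filter_upwards [Ioo_mem_nhdsLT (show (0:ℝ) < 1 by norm_num)] with t ht
      exact ⟨ht.1.le, ht.2.le⟩
    obtain ⟨a, ha, ha1, ha2⟩ := ((Filter.Eventually.filter_mono m0 e0).and (Ioo_mem_nhdsGT (show (0:ℝ) < 1/2 by norm_num))).exists
    obtain ⟨b, hb, hb1, hb2⟩ := ((Filter.Eventually.filter_mono m1 e1).and (Ioo_mem_nhdsLT (show (1/2:ℝ) < 1 by norm_num))).exists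
    exact ⟨a, b, ⟨ha1, by linarith⟩, ⟨by linarith, hb2⟩, by linarith, ha.le, hb.le⟩
  choose a b ha hb hle hda hdb using hab
  have hsub : ∀ s, Set.Icc (a s) (b s) ⊆ Set.Ioo (0:ℝ) 1 := fun s t ht =>
    ⟨(ha s).1.trans_le ht.1, ht.2.trans_lt (hb s).2⟩
  have hsub' : ∀ s, Set.Icc (a s) (b s) ⊆ Set.Icc (0:ℝ) 1 := fun s =>
    (hsub s).trans Set.Ioo_subset_Icc_self
  let K : Q ⊕ S → Set (ℝ × ℝ) := Sum.elim (fun q : Q => Metric.closedBall (q : ℝ × ℝ) (r / 2))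
    (fun s => γ s '' Set.Icc (a s) (b s))
  have hK : ∀ i, IsCompact (K i) := by
    rintro (q | s)
    · exact isCompact_closedBall _ _
    · exact isCompact_Icc.image_of_continuousOn ((hc s).mono (hsub' s))
  have hKc : ∀ i, IsPreconnected (K i) := by
    rintro (q | s)
    · exact (convex_closedBall _ _).isPreconnected
    · exact isPreconnected_Icc.image _ ((hc s).mono (hsub' s))
  obtain ⟨δ, hδ, hδs⟩ := compact_sep K hK
  have hsep : ∀ i j g, Disjoint (K i) (K j) → g ∈ AK δ (K i) → g ∈ AK δ (K j) → False := by
    intro i j g hd h h'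
    obtain ⟨x, hx, y, hy, hxy⟩ := AK_inter h h'
    exact absurd (hδs i j hd x hx y hy) (not_le.2 hxy)
  obtain ⟨M, hM1, hM2, hM3⟩ := grid_minor (S := S) (P := Q) (fun s => ⟨γ s 0, h0 s⟩)
    (fun s => ⟨γ s 1, h1 s⟩)
    (fun s h => zero_ne_one (hi s z0 z1 (congrArg Subtype.val h)))
    (fun q => AK δ (K (.inl q))) (fun s => AK δ (K (.inr s)))
    (fun q => AK_finite hδ (hK _)) (fun s => AK_finite hδ (hK _))
    (fun q => AK_conn hδ (hKc _)) (fun s => AK_conn hδ (hKc _))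
    (by
      intro p q g hp hq
      by_contra hne
      refine hsep (.inl p) (.inl q) g ?_ hp hq
      have := hrs (.inl p) (.inl q) (by simpa using fun h => hne (Subtype.ext h)) p rfl q rfl
      exact Metric.closedBall_disjoint_closedBall (by linarith))
    (by
      intro s s' g hs hs'
      by_contra hne
      refine hsep (.inr s) (.inr s') g ?_ hs hs'
      rw [Set.disjoint_left]
      rintro x ⟨t, ht, rfl⟩ ⟨t', ht', he⟩
      exact hinner s t (hsub s ht) (hdis s s' hne t (hsub' s ht) t' (hsub' s' ht') he.symm))
    (by
      intro s p g hs hp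
      by_contra hne
      push Not at hne
      refine hsep (.inr s) (.inl p) g ?_ hs hp
      have hd : Disjoint ({(p : ℝ × ℝ)} : Set (ℝ × ℝ)) (γ s '' Set.Icc 0 1) := by
        rw [Set.disjoint_singleton_left]
        rintro ⟨t, ht, he⟩
        rcases eq_or_lt_of_le ht.1 with h | h
        · subst h; exact hne.1 (Subtype.ext he.symm)
        · rcases eq_or_lt_of_le ht.2 with h' | h'
          · subst h'; exact hne.2 (Subtype.ext he.symm)
          · exact hinner s t ⟨h, h'⟩ (he ▸ p.2)
      have := hrs (.inl p) (.inr s) hd p rfl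
      rw [Set.disjoint_left]
      rintro x ⟨t, ht, rfl⟩ hx
      have h2 := this (γ s t) ⟨t, hsub' s ht, rfl⟩
      change dist (γ s t) p ≤ r / 2 at hx
      rw [dist_comm] at hx
      linarith)
    (fun s => AK_mem hδ (x := γ s (a s)) ⟨a s, ⟨le_rfl, hle s⟩, rfl⟩ (hda s))
    (fun s => AK_mem hδ (x := γ s (b s)) ⟨b s, ⟨hle s, le_rfl⟩, rfl⟩ (hdb s))
  refine ⟨⟨M.σ, M.α, fun d => (M.lab d : ℝ × ℝ), M.αα, M.αne, fun d => by rw [M.labσ],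
    fun f hf d d' h => M.trans f hf d d' (Subtype.ext h), M.H⟩, hM1, fun s => congrArg Subtype.val (hM2 s),
    fun s => congrArg Subtype.val (hM3 s)⟩

end BCL


namespace BCL

lemma z2_eq_of (a b : ZMod 2) (h : a + b = 0) : b = a := by revert a b; decide

section euler
variable {D L : Type}

/-- next dart along the face -/
def PMap.ψ (M : PMap D L) : Equiv.Perm D where
  toFun d := M.σ.symm (M.α d)
  invFun d := M.α (M.σ d)
  left_inv d := by simp [M.αα]
  right_inv d := by simp [M.αα]

def PMap.N (M : PMap D L) (d : D) : D := M.ψ d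
def PMap.N' (M : PMap D L) (d : D) : D := M.ψ.symm d

theorem PMap.euler [Finite D] [Nonempty D] (M : PMap D L) :
    Nat.card D + 4 ≤ 2 * Nat.card (Quotient (Equiv.Perm.SameCycle.setoid M.ψ)) +
      2 * (Set.range M.lab).ncard := by
  classical
  have : Fintype D := Fintype.ofFinite D
  have : Fact (Nat.Prime 2) := ⟨Nat.prime_two⟩
  let β : (D → (ZMod 2)) →ₗ[(ZMod 2)] (D → (ZMod 2)) := LinearMap.id + LinearMap.funLeft (ZMod 2) (ZMod 2) M.α
  have hβ : ∀ f d, β f d = f d + f (M.α d) := fun f d => rfl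
  let δ : (D → (ZMod 2)) →ₗ[(ZMod 2)] (D → (ZMod 2)) := LinearMap.id + LinearMap.funLeft (ZMod 2) (ZMod 2) M.σ.symm
  have hδ : ∀ f d, δ f d = f d + f (M.σ.symm d) := fun f d => rfl
  let tot : (D → (ZMod 2)) →ₗ[(ZMod 2)] (ZMod 2) := ∑ d, LinearMap.proj d
  have htot : ∀ f, tot f = ∑ d, f d := fun f => by simp [tot]
  let A := LinearMap.ker β
  let B := LinearMap.range δ
  have hA : ∀ f, f ∈ A ↔ ∀ d, f (M.α d) = f d := by
    intro f
    rw [LinearMap.mem_ker]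
    constructor
    · intro h d
      have := congrFun h d
      rw [hβ] at this
      simp only [Pi.zero_apply] at this
      exact z2_eq_of _ _ this
    · intro h; funext d
      rw [hβ, h]; exact z2_add_self _
  have fr : Module.finrank (ZMod 2) (D → (ZMod 2)) = Nat.card D := by simp
  have dA : Nat.card D ≤ 2 * Module.finrank (ZMod 2) A := by
    have h1 := LinearMap.finrank_range_add_finrank_ker β
    have h2 : LinearMap.range β ≤ A := by
      rintro _ ⟨f, rfl⟩
      rw [hA]; intro d
      rw [hβ, hβ, M.αα, add_comm]
    have h3 := Submodule.finrank_mono h2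
    rw [fr] at h1
    change _ + Module.finrank (ZMod 2) A = _ at h1
    omega
  have dB : Nat.card D ≤ Module.finrank (ZMod 2) B + (Set.range M.lab).ncard := by
    have h1 := LinearMap.finrank_range_add_finrank_ker δ
    have h2 : LinearMap.ker δ ≤ LinearMap.range (LinearMap.funLeft (ZMod 2) (ZMod 2)
        (fun d => (⟨M.lab d, d, rfl⟩ : Set.range M.lab))) := by
      intro f hf
      rw [LinearMap.mem_ker] at hf
      have hf' : ∀ d, f (M.σ d) = f d := by
        intro d
        have := congrFun hf (M.σ d)
        rw [hδ] at this
        simp only [Pi.zero_apply, Equiv.symm_apply_apply] at this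
        exact (z2_eq_of _ _ this).symm
      refine ⟨fun l => f l.2.choose, ?_⟩
      funext d
      have hl : M.lab (Set.mem_range_self (f := M.lab) d).choose = M.lab d :=
        (Set.mem_range_self (f := M.lab) d).choose_spec
      change f (Set.mem_range_self (f := M.lab) d).choose = f d
      exact M.trans (fun x => f x = f d) (fun x hx => by rw [hf', hx]) _ _ hl.symm rfl
    have h3 := Submodule.finrank_mono h2
    have h4 := LinearMap.finrank_range_le (LinearMap.funLeft (ZMod 2) (ZMod 2)
        (fun d => (⟨M.lab d, d, rfl⟩ : Set.range M.lab)))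
    have : Fintype (Set.range M.lab) := Fintype.ofFinite _
    have h5 : Module.finrank (ZMod 2) (Set.range M.lab → (ZMod 2)) = (Set.range M.lab).ncard := by
      rw [Module.finrank_pi, ← Nat.card_eq_fintype_card]; rfl
    rw [h5] at h4
    rw [fr] at h1
    change Module.finrank (ZMod 2) B + _ = _ at h1
    omega
  have dAB : Module.finrank (ZMod 2) (A ⊔ B : Submodule (ZMod 2) (D → (ZMod 2))) + 1 ≤ Nat.card D := by
    have h1 := LinearMap.finrank_range_add_finrank_ker tot
    have h2 : A ⊔ B ≤ LinearMap.ker tot := by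
      refine sup_le ?_ ?_
      · intro f hf
        rw [hA] at hf
        rw [LinearMap.mem_ker, htot]
        refine Finset.sum_involution (fun d _ => M.α d) ?_ ?_ ?_ ?_
        · intro d _; rw [hf]; exact z2_add_self _
        · intro d _ _; exact M.αne d
        · intro d _; exact Finset.mem_univ _
        · intro d _; exact M.αα d
      · rintro _ ⟨f, rfl⟩
        rw [LinearMap.mem_ker, htot]
        simp only [hδ, Finset.sum_add_distrib]
        rw [Equiv.sum_comp M.σ.symm f]
        exact z2_add_self _
    have h3 := Submodule.finrank_mono h2
    have h4 : 1 ≤ Module.finrank (ZMod 2) (LinearMap.range tot) := by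
      rw [Nat.one_le_iff_ne_zero, Ne, Submodule.finrank_eq_zero, LinearMap.range_eq_bot]
      intro h
      obtain ⟨d⟩ := ‹Nonempty D›
      have := congrArg (fun g => g (Pi.single d 1)) h
      simp [htot] at this
    rw [fr] at h1
    omega
  have dI := Submodule.finrank_sup_add_finrank_inf_eq A B
  -- faces
  let W : Submodule (ZMod 2) (D → (ZMod 2)) :=
    { carrier := {w | ∀ d, w (M.α (M.σ d)) = w d}
      add_mem' := fun {a b} ha hb d => by simp only [Pi.add_apply]; rw [ha d, hb d]
      zero_mem' := fun d => rfl
      smul_mem' := fun c a ha d => by simp only [Pi.smul_apply]; rw [ha d] }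
  have hW : ∀ w, w ∈ W ↔ ∀ d, w (M.α (M.σ d)) = w d := fun w => Iff.rfl
  have dW : Module.finrank (ZMod 2) W ≤ Nat.card (Quotient (Equiv.Perm.SameCycle.setoid M.ψ)) := by
    have h2 : W ≤ LinearMap.range (LinearMap.funLeft (ZMod 2) (ZMod 2)
        (Quotient.mk (Equiv.Perm.SameCycle.setoid M.ψ))) := by
      intro w hw
      rw [hW] at hw
      have h3 : ∀ d, w (M.ψ d) = w d := by
        intro d
        have := hw (M.ψ d)
        change w (M.ψ.symm (M.ψ d)) = _ at this
        rw [Equiv.symm_apply_apply] at this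
        exact this.symm
      refine ⟨Quotient.lift w ?_, ?_⟩
      · rintro a b ⟨i, rfl⟩
        have h4 : ∀ (n : ℕ) x, w ((M.ψ ^ n) x) = w x := by
          intro n
          induction n with
          | zero => intro x; rfl
          | succ n ih => intro x; rw [pow_succ, Equiv.Perm.mul_apply, ih, h3]
        obtain ⟨n, rfl | rfl⟩ := i.eq_nat_or_neg
        · rw [zpow_natCast, h4]
        · rw [zpow_neg, zpow_natCast]
          have := h4 n ((M.ψ ^ n)⁻¹ a)
          rw [← Equiv.Perm.mul_apply, mul_inv_cancel] at this
          exact this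
      · funext d; rfl
    have h3 := Submodule.finrank_mono h2
    have h4 := LinearMap.finrank_range_le (LinearMap.funLeft (ZMod 2) (ZMod 2)
        (Quotient.mk (Equiv.Perm.SameCycle.setoid M.ψ)))
    have : Fintype (Quotient (Equiv.Perm.SameCycle.setoid M.ψ)) := Fintype.ofFinite _
    rw [Module.finrank_pi, ← Nat.card_eq_fintype_card] at h4
    omega
  have hIW : A ⊓ B ≤ LinearMap.range (β.domRestrict W) := by
    rintro z ⟨hz, c, rfl⟩
    have hz' := (hA _).1 hz
    obtain ⟨w, hw1, hw2⟩ := M.H (δ c) c hz' (fun d => by rw [hδ, Equiv.symm_apply_apply])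
    refine ⟨⟨w, hw1⟩, ?_⟩
    funext d
    exact hw2 d
  have h1 := Submodule.finrank_mono hIW
  have h2 := LinearMap.finrank_range_add_finrank_ker (β.domRestrict W)
  have h3 : 1 ≤ Module.finrank (ZMod 2) (LinearMap.ker (β.domRestrict W)) := by
    rw [Nat.one_le_iff_ne_zero, Ne, Submodule.finrank_eq_zero, Submodule.eq_bot_iff]
    push Not
    refine ⟨⟨fun _ => 1, fun d => rfl⟩, ?_, ?_⟩
    · rw [LinearMap.mem_ker]
      funext d
      exact z2_add_self 1
    · intro h
      obtain ⟨d⟩ := ‹Nonempty D›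
      have := congrFun (congrArg Subtype.val h) d
      exact absurd this (one_ne_zero (α := ZMod 2))
  omega

open Classical in
/-- discharging principle: if all face sums are at least `k` then the total is at least `k * F` -/
theorem PMap.face_sum [Fintype D] (M : PMap D L) (val : D → ℤ) (k : ℤ)
    (h : ∀ d, k ≤ ∑ x with M.ψ.SameCycle d x, val x) :
    k * Nat.card (Quotient (Equiv.Perm.SameCycle.setoid M.ψ)) ≤ ∑ d, val d := by
  classical
  let q : D → Quotient (Equiv.Perm.SameCycle.setoid M.ψ) := Quotient.mk _
  have : Fintype (Quotient (Equiv.Perm.SameCycle.setoid M.ψ)) := Fintype.ofFinite _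
  rw [← Finset.sum_fiberwise (s := Finset.univ) (g := q) (f := val)]
  rw [mul_comm, Nat.card_eq_fintype_card, ← nsmul_eq_mul, ← Finset.card_univ]
  refine Finset.card_nsmul_le_sum _ _ _ ?_
  intro x _
  induction x using Quotient.inductionOn with
  | h d =>
  refine (h d).trans (le_of_eq ?_)
  refine Finset.sum_congr ?_ (fun _ _ => rfl)
  ext y
  simp only [Finset.mem_filter, Finset.mem_univ, true_and, q]
  rw [eq_comm (a := Quotient.mk _ y), Quotient.eq]
  rfl

end euler

end BCL


namespace BCL

/-- Resolved crossing data: what is needed of a planarized drawing in the discharging argument. -/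
structure RD (D L E : Type) where
  s : Equiv.Perm D
  a : D → D
  lab : D → L
  ed : D → E
  X : D → Prop
  Ps : D → Prop
  col : D → Bool
  aa : ∀ d, a (a d) = d
  lab_s : ∀ d, lab (s d) = lab d
  X_lab : ∀ d d', lab d = lab d' → (X d ↔ X d')
  Ps_lab : ∀ d d', lab d = lab d' → (Ps d ↔ Ps d')
  col_lab : ∀ d d', lab d = lab d' → col d = col d'
  s4 : ∀ d, X d → s (s (s (s d))) = d
  ed_a : ∀ d, ed (a d) = ed d
  ed_ss : ∀ d, X d → ed (s (s d)) = ed d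
  ed_s : ∀ d, X d → ed (s d) ≠ ed d
  cc : ∀ d, X d → X (a d) → ¬ X (a (s (s d)))
  XPs : ∀ d, X d → ¬ Ps (a d)
  PsPs : ∀ d, Ps d → ¬ Ps (a d)
  XnPs : ∀ d, X d → ¬ Ps d
  col_a : ∀ d, ¬ X d → ¬ Ps d → ¬ X (a d) → ¬ Ps (a d) → col d ≠ col (a d)
  col_x : ∀ d, X d → ¬ X (a d) → ¬ X (a (s (s d))) → col (a d) ≠ col (a (s (s d)))
  col_cc : ∀ d, X d → X (a d) → col (a (s (s d))) ≠ col (a (s (s (a d))))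
  share : ∀ d e d' e', ed d = ed e → ed d' = ed e' → lab d = lab d' → lab e = lab e' →
    lab d ≠ lab e → ed d = ed d'
  two : ∀ d d', ed d = ed d' → lab d = lab d' → lab (a d) = lab (a d') → d = d'
  labne : ∀ d, lab (a d) ≠ lab d
  deg : ∀ d, ¬ X d → s d ≠ d

namespace RD
variable {D L E : Type} (R : RD D L E)

/-- mirror image -/
def m : RD D L E where
  s := R.s.symm
  a := R.a
  lab := R.lab
  ed := R.ed
  X := R.X
  Ps := R.Ps
  col := R.col
  aa := R.aa
  lab_s d := by rw [← R.lab_s (R.s.symm d), Equiv.apply_symm_apply]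
  X_lab := R.X_lab
  Ps_lab := R.Ps_lab
  col_lab := R.col_lab
  s4 d h := by
    simp only [Equiv.symm_apply_eq]; exact (R.s4 d h).symm
  ed_a := R.ed_a
  ed_ss d h := by
    have := R.s4 d h
    conv_lhs => rw [← this]
    simp only [Equiv.symm_apply_apply]
    exact R.ed_ss d h
  ed_s d h := by
    have hl : R.lab (R.s.symm d) = R.lab d := by
      rw [← R.lab_s (R.s.symm d), Equiv.apply_symm_apply]
    have := R.ed_s (R.s.symm d) ((R.X_lab _ _ hl).2 h)
    rw [Equiv.apply_symm_apply] at this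
    exact this.symm
  cc d h := by
    have e : R.s.symm (R.s.symm d) = R.s (R.s d) := by
      conv_lhs => rw [← R.s4 d h]
      simp only [Equiv.symm_apply_apply]
    rw [e]; exact R.cc d h
  XPs := R.XPs
  PsPs := R.PsPs
  XnPs := R.XnPs
  col_a := R.col_a
  col_x d h := by
    have e : R.s.symm (R.s.symm d) = R.s (R.s d) := by
      conv_lhs => rw [← R.s4 d h]
      simp only [Equiv.symm_apply_apply]
    rw [e]; exact R.col_x d h
  col_cc d h h' := by
    have e : ∀ d, R.X d → R.s.symm (R.s.symm d) = R.s (R.s d) := by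
      intro d h
      conv_lhs => rw [← R.s4 d h]
      simp only [Equiv.symm_apply_apply]
    rw [e d h, e _ h']; exact R.col_cc d h h'
  share := R.share
  two := R.two
  labne := R.labne
  deg d h h' := R.deg d h (by rw [Equiv.symm_apply_eq] at h'; exact h'.symm)

/-- inverse rotation -/
def t (d : D) : D := R.s.symm d
def N (d : D) : D := R.t (R.a d)
def P (d : D) : D := R.a (R.s d)

@[simp] lemma ts (d : D) : R.t (R.s d) = d := R.s.symm_apply_apply d
@[simp] lemma st (d : D) : R.s (R.t d) = d := R.s.apply_symm_apply d
@[simp] lemma NP (d : D) : R.N (R.P d) = d := by simp [N, P, R.aa]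
@[simp] lemma PN (d : D) : R.P (R.N d) = d := by simp [N, P, R.aa]
attribute [simp] RD.aa
@[simp] lemma lab_s' (d : D) : R.lab (R.s d) = R.lab d := R.lab_s d
@[simp] lemma lab_t (d : D) : R.lab (R.t d) = R.lab d := by
  rw [← R.lab_s (R.t d), st]
lemma lab_N (d : D) : R.lab (R.N d) = R.lab (R.a d) := by simp [N]
lemma lab_aP (d : D) : R.lab (R.a (R.P d)) = R.lab d := by simp [P]
@[simp] lemma X_s (d : D) : R.X (R.s d) ↔ R.X d := R.X_lab _ _ (R.lab_s d)
@[simp] lemma X_t (d : D) : R.X (R.t d) ↔ R.X d := R.X_lab _ _ (R.lab_t d)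
lemma X_N (d : D) : R.X (R.N d) ↔ R.X (R.a d) := R.X_lab _ _ (R.lab_N d)
lemma X_aP (d : D) : R.X (R.a (R.P d)) ↔ R.X d := R.X_lab _ _ (R.lab_aP d)
lemma tt (d : D) (h : R.X d) : R.t (R.t d) = R.s (R.s d) := by
  conv_lhs => rw [← R.s4 d h]
  simp
lemma sss (d : D) (h : R.X d) : R.s (R.s (R.s d)) = R.t d := by
  conv_rhs => rw [← R.s4 d h]
  simp
lemma N_inj {d d' : D} (h : R.N d = R.N d') : d = d' := by
  rw [← R.PN d, h, R.PN]

lemma m_s (d : D) : R.m.s d = R.t d := rfl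
lemma m_t (d : D) : R.m.t d = R.s d := rfl
@[simp] lemma m_a (d : D) : R.m.a d = R.a d := rfl
@[simp] lemma m_X (d : D) : R.m.X d = R.X d := rfl
@[simp] lemma m_Ps (d : D) : R.m.Ps d = R.Ps d := rfl
@[simp] lemma m_col (d : D) : R.m.col d = R.col d := rfl
@[simp] lemma m_lab (d : D) : R.m.lab d = R.lab d := rfl
@[simp] lemma m_N (d : D) : R.m.N d = R.a (R.P (R.a d)) := by simp [N, P, m_t]
@[simp] lemma m_P (d : D) : R.m.P d = R.a (R.N (R.a d)) := by simp [N, P, m_s]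

lemma mm : R.m.m = R := rfl

/-- triangle -/
def Tri (d : D) : Prop := R.N (R.N d) = R.P d

lemma Tri_m (d : D) : R.m.Tri d ↔ R.Tri (R.a d) := by
  unfold Tri
  simp only [m_N, m_P, R.aa]
  constructor
  · intro h
    have h' := congrArg (fun x => R.N (R.N (R.a x))) h
    simp only [R.aa, NP] at h'
    have h2 := congrArg R.P h'
    simp only [PN] at h2
    exact (R.N_inj (by rw [NP]; exact h'.symm))
  · intro h
    congr 1
    apply R.N_inj
    rw [NP]
    apply R.N_inj
    rw [h, NP]

def T1 (d : D) : Prop := R.X d ∧ R.X (R.a d) ∧ ¬ R.X (R.P d) ∧ R.Tri d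
def T0 (d : D) : Prop := R.X d ∧ R.X (R.a d) ∧ R.X (R.P d) ∧ R.Tri d
/-- triangle with one crossing, seen from its crossing-free side -/
def T2 (d : D) : Prop := ¬ R.X d ∧ ¬ R.X (R.a d) ∧ R.X (R.P d) ∧ R.Tri d

lemma Tri.P_lab {d : D} (h : R.Tri d) : R.lab (R.P d) = R.lab (R.a (R.N d)) := by
  rw [← h, lab_N]

lemma T1_m (d : D) : R.m.T1 d ↔ R.T1 (R.a d) := by
  unfold T1
  rw [Tri_m]
  simp only [m_X, m_a, m_P, R.aa]
  constructor
  · rintro ⟨h1, h2, h3, h4⟩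
    refine ⟨h2, h1, ?_, h4⟩
    rwa [R.X_lab _ _ (Tri.P_lab R h4)]
  · rintro ⟨h1, h2, h3, h4⟩
    refine ⟨h2, h1, ?_, h4⟩
    rwa [R.X_lab _ _ (Tri.P_lab R h4)] at h3

lemma T0_m (d : D) : R.m.T0 d ↔ R.T0 (R.a d) := by
  unfold T0
  rw [Tri_m]
  simp only [m_X, m_a, m_P, R.aa]
  constructor
  · rintro ⟨h1, h2, h3, h4⟩
    refine ⟨h2, h1, ?_, h4⟩
    rwa [R.X_lab _ _ (Tri.P_lab R h4)]
  · rintro ⟨h1, h2, h3, h4⟩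
    refine ⟨h2, h1, ?_, h4⟩
    rwa [R.X_lab _ _ (Tri.P_lab R h4)] at h3

lemma T2_m (d : D) : R.m.T2 d ↔ R.T2 (R.a d) := by
  unfold T2
  rw [Tri_m]
  simp only [m_X, m_a, m_P, R.aa]
  constructor
  · rintro ⟨h1, h2, h3, h4⟩
    refine ⟨h2, h1, ?_, h4⟩
    rwa [R.X_lab _ _ (Tri.P_lab R h4)]
  · rintro ⟨h1, h2, h3, h4⟩
    refine ⟨h2, h1, ?_, h4⟩
    rwa [R.X_lab _ _ (Tri.P_lab R h4)] at h3

/-- backward end has the colour of the apex -/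
def A (d : D) : Prop := R.col (R.a (R.s (R.s d))) = R.col (R.P d)

lemma bool3 {a b c : Bool} (h1 : a ≠ b) (h2 : b ≠ c) : a = c := by
  revert a b c; decide

lemma A_m (d : D) (h : R.T1 (R.a d)) : R.m.A d ↔ ¬ R.A (R.a d) := by
  unfold A
  obtain ⟨h1, h2, h3, h4⟩ := h
  have h5 : R.X d := by simpa using h2
  simp only [m_a, m_col, m_s, m_P]
  rw [R.tt d h5, R.col_lab _ _ (Tri.P_lab R h4)]
  have := R.col_cc d h5 h1
  generalize R.col _ = x at *
  generalize R.col _ = y at *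
  generalize R.col _ = z at *
  revert x y z; decide

end RD
end BCL


namespace BCL
namespace RD
open scoped Classical
variable {D L E : Type} (R : RD D L E)

lemma ed_t (d : D) (h : R.X d) : R.ed (R.t d) = R.ed (R.s d) := by
  have := R.ed_ss (R.t d) (by simpa using h)
  simpa using this.symm

lemma fg (d : D) (h : R.X d) : R.ed (R.s d) ≠ R.ed (R.s (R.a d)) := by
  intro e
  have := R.share (R.s d) (R.s (R.a d)) d (R.a d) e (R.ed_a d).symm (by simp) (by simp)
    (by simpa using (R.labne d).symm)
  exact R.ed_s d h this

lemma XPs' {d : D} (h : R.X (R.a d)) : ¬ R.Ps d := by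
  have := R.XPs _ h; simpa using this

lemma N1 (d : D) : R.N d ≠ d := by
  intro h
  have := R.lab_N d
  rw [h] at this
  exact R.labne d this.symm

lemma N2 (d : D) : R.N (R.N d) ≠ d := by
  intro h
  have h1 := R.lab_N d
  have h2 := R.lab_N (R.N d)
  rw [h] at h2
  have e := R.share d (R.a d) (R.a (R.N d)) (R.N d) (R.ed_a d).symm (R.ed_a _) h2 h1.symm
    (R.labne d).symm
  have e2 := R.two d (R.a (R.N d)) e h2 (by simpa using h1.symm)
  have e3 : R.N d = R.a d := by
    have := congrArg R.a e2
    simpa using this.symm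
  have e4 : R.s (R.a d) = R.a d := by
    conv_lhs => rw [← e3]
    simp [N]
  by_cases hX : R.X (R.a d)
  · exact R.ed_s _ hX (by rw [e4])
  · exact R.deg _ hX e4

def Q0 (d : D) : Prop := R.N (R.N (R.N (R.N d))) = d ∧ R.X d ∧ R.X (R.N d) ∧ R.X (R.N (R.N d)) ∧
  R.X (R.N (R.N (R.N d)))
def P0 (d : D) : Prop := R.N (R.N (R.N (R.N (R.N d)))) = d ∧ R.X d ∧ R.X (R.N d) ∧
  R.X (R.N (R.N d)) ∧ R.X (R.N (R.N (R.N d))) ∧ R.X (R.N (R.N (R.N (R.N d))))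
def Q1d (d : D) : Prop := R.N (R.N (R.N (R.N d))) = d ∧ ¬ R.X d ∧ R.X (R.N d) ∧
  R.X (R.N (R.N d)) ∧ R.X (R.N (R.N (R.N d))) ∧ R.T1 (R.a (R.N d)) ∧ R.T1 (R.a (R.N (R.N d)))

noncomputable def t2 (p q : Prop) : ℤ :=
  if p then (if q then 1 else 0) else (if q then 2 else 1)

def k1 (d : D) : Prop := R.T2 (R.a (R.s (R.a (R.t (R.a d))))) ∧ R.T1 (R.s (R.a d))
def k2 (d : D) : Prop := R.T2 (R.t (R.a (R.s d))) ∧ R.T1 (R.a (R.t d))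

noncomputable def k (d : D) : ℤ :=
  if R.A d then (if R.k1 d then 1 else 0) else (if R.k2 d then 1 else 0)

noncomputable def irX (d : D) : ℤ :=
  if R.T1 (R.N d) then (if R.A (R.N d) then 3 else 0)
  else if R.T2 (R.P d) then t2 (R.T1 (R.P (R.a d))) (R.T1 (R.N (R.a (R.P (R.P d)))))
  else if R.Q1d d then 2 else 0

noncomputable def iXr (d : D) : ℤ :=
  if R.T1 (R.P d) then (if R.A (R.P d) then 0 else 3)
  else if R.T2 (R.N d) then t2 (R.T1 (R.N (R.a d))) (R.T1 (R.P (R.a (R.N (R.N d)))))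
  else if R.Q1d (R.N d) then 2 else 0

noncomputable def icc (d : D) : ℤ :=
  if R.T1 d then 5 + R.k d else if R.T0 d then 5
  else if R.Q0 d ∧ R.T1 (R.a (R.N (R.N d))) then 6
  else if R.P0 d ∧ ¬ R.T1 (R.a d) then 8 else 0

noncomputable def inn (d : D) : ℤ :=
  if R.X d then (if R.X (R.a d) then R.icc d else R.iXr d)
  else (if R.X (R.a d) then R.irX d else 0)

noncomputable def h (d : D) : ℤ := if R.X d then 0 else if R.Ps d then 1 else 3

noncomputable def val (d : D) : ℤ := 14 + R.h d + R.h (R.a d) + R.inn d - R.inn (R.a d)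

/-! mirror invariance -/

lemma m_Nit (d : D) : R.m.N (R.m.N d) = R.a (R.P (R.P (R.a d))) := by simp

lemma N4P {d : D} (h : R.N (R.N (R.N (R.N d))) = d) :
    R.P d = R.N (R.N (R.N d)) ∧ R.P (R.P d) = R.N (R.N d) ∧ R.P (R.P (R.P d)) = R.N d ∧
    R.P (R.P (R.P (R.P d))) = d := by
  have h1 : R.P d = R.N (R.N (R.N d)) := by
    conv_lhs => rw [← h]
    simp
  refine ⟨h1, ?_, ?_, ?_⟩ <;> simp [h1]

lemma P4N {d : D} (h : R.P (R.P (R.P (R.P d))) = d) : R.N (R.N (R.N (R.N d))) = d := by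
  conv_lhs => rw [← h]
  simp

lemma X_aa (d : D) : R.X (R.a (R.P d)) ↔ R.X d := R.X_aP d

lemma Q0_m (d : D) : R.m.Q0 d ↔ R.Q0 (R.a d) := by
  unfold Q0
  simp only [m_N, R.aa, m_X, X_aP]
  constructor
  · rintro ⟨h1, h2, h3, h4, h5⟩
    have h6 : R.P (R.P (R.P (R.P (R.a d)))) = R.a d := by
      conv_rhs => rw [← h1]
      simp
    have h7 := R.P4N h6
    obtain ⟨e1, e2, e3, e4⟩ := R.N4P h7
    rw [e1] at h4
    rw [e2] at h5
    refine ⟨h7, h3, ?_, h5, h4⟩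
    rw [X_N]; simpa using h2
  · rintro ⟨h1, h2, h3, h4, h5⟩
    obtain ⟨e1, e2, e3, e4⟩ := R.N4P h1
    rw [e4, e2, e1]
    refine ⟨by simp, ?_, h2, h5, h4⟩
    rw [X_N] at h3; simpa using h3

lemma N5P {d : D} (h : R.N (R.N (R.N (R.N (R.N d)))) = d) :
    R.P d = R.N (R.N (R.N (R.N d))) ∧ R.P (R.P d) = R.N (R.N (R.N d)) ∧
    R.P (R.P (R.P d)) = R.N (R.N d) ∧ R.P (R.P (R.P (R.P d))) = R.N d ∧
    R.P (R.P (R.P (R.P (R.P d)))) = d := by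
  have h1 : R.P d = R.N (R.N (R.N (R.N d))) := by
    conv_lhs => rw [← h]
    simp
  refine ⟨h1, ?_, ?_, ?_, ?_⟩ <;> simp [h1]

lemma P5N {d : D} (h : R.P (R.P (R.P (R.P (R.P d)))) = d) :
    R.N (R.N (R.N (R.N (R.N d)))) = d := by
  conv_lhs => rw [← h]
  simp

lemma P0_m (d : D) : R.m.P0 d ↔ R.P0 (R.a d) := by
  unfold P0
  simp only [m_N, R.aa, m_X, X_aP]
  constructor
  · rintro ⟨h1, h2, h3, h4, h5, h6⟩
    have h7 : R.P (R.P (R.P (R.P (R.P (R.a d))))) = R.a d := by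
      conv_rhs => rw [← h1]
      simp
    have h8 := R.P5N h7
    obtain ⟨e1, e2, e3, e4, e5⟩ := R.N5P h8
    rw [e1] at h4
    rw [e2] at h5
    rw [e3] at h6
    refine ⟨h8, h3, ?_, h6, h5, h4⟩
    rw [X_N]; simpa using h2
  · rintro ⟨h1, h2, h3, h4, h5, h6⟩
    obtain ⟨e1, e2, e3, e4, e5⟩ := R.N5P h1
    rw [e5, e3, e2, e1]
    refine ⟨by simp, ?_, h2, h6, h5, h4⟩
    rw [X_N] at h3; simpa using h3

lemma Q1d_m (d : D) : R.m.Q1d (R.a (R.P d)) ↔ R.Q1d d := by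
  unfold Q1d
  simp only [m_N, R.aa, m_X, m_a, X_aP, T1_m]
  constructor
  · rintro ⟨h1, h2, h3, h4, h5, h6, h7⟩
    have h8 : R.P (R.P (R.P (R.P d))) = d := by
      have := congrArg (fun x => R.N (R.a x)) h1
      simpa using this
    have h7 := R.P4N h8
    obtain ⟨e1, e2, e3, e4⟩ := R.N4P h7
    simp_all
  · rintro ⟨h1, h2, h3, h4, h5, h6, h7⟩
    obtain ⟨e1, e2, e3, e4⟩ := R.N4P h1
    simp_all

lemma A_m' (d : D) (h : R.T1 d) : R.m.A (R.a d) ↔ ¬ R.A d := by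
  have := R.A_m (R.a d) (by simpa using h)
  simpa using this

lemma irX_m (d : D) : R.m.irX d = R.iXr (R.a d) := by
  unfold irX iXr
  have e1 : R.m.T1 (R.m.N d) ↔ R.T1 (R.P (R.a d)) := by rw [T1_m]; simp
  have e2 : R.m.T2 (R.m.P d) ↔ R.T2 (R.N (R.a d)) := by rw [T2_m]; simp
  have e3 : R.m.T1 (R.m.P (R.m.a d)) ↔ R.T1 (R.N (R.a (R.a d))) := by rw [T1_m]; simp
  have e4 : R.m.T1 (R.m.N (R.m.a (R.m.P (R.m.P d)))) ↔ R.T1 (R.P (R.a (R.N (R.N (R.a d))))) := by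
    rw [T1_m]; simp
  have e5 : R.m.Q1d d ↔ R.Q1d (R.N (R.a d)) := by
    have := R.Q1d_m (R.N (R.a d)); simpa using this
  rw [e3, e4]
  simp only [e1, e2, e5]
  by_cases h1 : R.T1 (R.P (R.a d))
  · have e6 : R.m.A (R.m.N d) ↔ ¬ R.A (R.P (R.a d)) := by
      have := R.A_m' (R.P (R.a d)) h1
      simpa using this
    simp only [h1, if_true, e6]
    split_ifs <;> simp_all
  · simp only [h1, if_false]

lemma iXr_m (d : D) : R.m.iXr d = R.irX (R.a d) := by
  have := R.m.irX_m (R.a d)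
  simp only [mm, m_a, R.aa] at this
  exact this.symm

lemma k_m (d : D) (h : R.T1 (R.a d)) : R.m.k d = R.k (R.a d) := by
  have e1 := R.A_m d h
  have e2 : R.m.k1 d ↔ R.k2 (R.a d) := by
    unfold k1 k2
    rw [T2_m, T1_m]
    simp [m_s, m_t]
  have e3 : R.m.k2 d ↔ R.k1 (R.a d) := by
    unfold k1 k2
    rw [T2_m, T1_m]
    simp [m_s, m_t]
  unfold k
  simp only [e1, e2, e3]
  split_ifs <;> simp_all

lemma icc_m (d : D) : R.m.icc d = R.icc (R.a d) := by
  unfold icc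
  have e1 := R.T1_m d
  have e2 := R.T0_m d
  have e3 : (R.m.Q0 d ∧ R.m.T1 (R.m.a (R.m.N (R.m.N d)))) ↔
      (R.Q0 (R.a d) ∧ R.T1 (R.a (R.N (R.N (R.a d))))) := by
    rw [Q0_m]
    apply and_congr_right
    intro h
    obtain ⟨_, e2, _, _⟩ := R.N4P h.1
    rw [T1_m, m_Nit, e2]; simp
  have e4 : (R.m.P0 d ∧ ¬ R.m.T1 (R.m.a d)) ↔ (R.P0 (R.a d) ∧ ¬ R.T1 (R.a (R.a d))) := by
    rw [P0_m, T1_m]; simp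
  simp only [e1, e2, e3, e4]
  by_cases h1 : R.T1 (R.a d)
  · simp only [h1, if_true, R.k_m d h1]
  · simp only [h1, if_false]

lemma inn_m (d : D) : R.m.inn d = R.inn (R.a d) := by
  unfold inn
  simp only [m_X, m_a, R.aa, irX_m, iXr_m, icc_m]
  split_ifs <;> rfl

lemma val_m (d : D) : R.m.val d = R.val (R.a d) := by
  unfold val
  rw [inn_m, inn_m]
  simp only [m_a, R.aa]
  have : ∀ d, R.m.h d = R.h d := fun d => rfl
  rw [this, this]; ring

end RD
end BCL


namespace BCL
namespace RD
open scoped Classical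
variable {D L E : Type} (R : RD D L E)

lemma inn_cc {d : D} (h1 : R.X d) (h2 : R.X (R.a d)) : R.inn d = R.icc d := by simp [inn, h1, h2]
lemma inn_Xr {d : D} (h1 : R.X d) (h2 : ¬ R.X (R.a d)) : R.inn d = R.iXr d := by simp [inn, h1, h2]
lemma inn_rX {d : D} (h1 : ¬ R.X d) (h2 : R.X (R.a d)) : R.inn d = R.irX d := by simp [inn, h1, h2]
lemma inn_rr {d : D} (h1 : ¬ R.X d) (h2 : ¬ R.X (R.a d)) : R.inn d = 0 := by simp [inn, h1, h2]

lemma t2_nn (p q : Prop) : 0 ≤ t2 p q := by unfold t2; split_ifs <;> norm_num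
lemma t2_le (p q : Prop) : t2 p q ≤ 2 := by unfold t2; split_ifs <;> norm_num
lemma t2_sum (p q : Prop) : t2 p q + t2 q p = 2 := by unfold t2; split_ifs <;> norm_num
lemma k_nn (d : D) : 0 ≤ R.k d := by unfold k; split_ifs <;> norm_num
lemma k_le (d : D) : R.k d ≤ 1 := by unfold k; split_ifs <;> norm_num
lemma irX_nn (d : D) : 0 ≤ R.irX d := by
  unfold irX
  have := t2_nn (R.T1 (R.P (R.a d))) (R.T1 (R.N (R.a (R.P (R.P d)))))
  split_ifs <;> linarith
lemma irX_le (d : D) : R.irX d ≤ 3 := by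
  unfold irX
  have := t2_le (R.T1 (R.P (R.a d))) (R.T1 (R.N (R.a (R.P (R.P d)))))
  split_ifs <;> linarith
lemma iXr_nn (d : D) : 0 ≤ R.iXr d := by
  unfold iXr
  have := t2_nn (R.T1 (R.N (R.a d))) (R.T1 (R.P (R.a (R.N (R.N d)))))
  split_ifs <;> linarith
lemma iXr_le (d : D) : R.iXr d ≤ 3 := by
  unfold iXr
  have := t2_le (R.T1 (R.N (R.a d))) (R.T1 (R.P (R.a (R.N (R.N d)))))
  split_ifs <;> linarith
lemma icc_nn (d : D) : 0 ≤ R.icc d := by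
  unfold icc
  have := R.k_nn d
  split_ifs <;> linarith
lemma icc_le (d : D) : R.icc d ≤ 8 := by
  unfold icc
  have := R.k_le d
  split_ifs <;> linarith
lemma inn_nn (d : D) : 0 ≤ R.inn d := by
  unfold inn
  have := R.icc_nn d
  have := R.iXr_nn d
  have := R.irX_nn d
  split_ifs <;> linarith

lemma h_es {d : D} (h1 : ¬ R.X d) (h2 : R.X (R.a d)) : R.h d = 3 := by
  simp [h, h1, R.XPs' h2]
lemma h_X {d : D} (h1 : R.X d) : R.h d = 0 := by simp [h, h1]

lemma val_cc {d : D} (h1 : R.X d) (h2 : R.X (R.a d)) : R.val d = 14 + R.inn d - R.inn (R.a d) := by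
  unfold val; rw [R.h_X h1, R.h_X h2]; ring
lemma val_rX {d : D} (h1 : ¬ R.X d) (h2 : R.X (R.a d)) :
    R.val d = 17 + R.inn d - R.inn (R.a d) := by
  unfold val; rw [R.h_es h1 h2, R.h_X h2]; ring
lemma val_Xr {d : D} (h1 : R.X d) (h2 : ¬ R.X (R.a d)) :
    R.val d = 17 + R.inn d - R.inn (R.a d) := by
  unfold val; rw [R.h_es h2 (by simpa using h1), R.h_X h1]; ring
lemma val_rr {d : D} (h1 : ¬ R.X d) (h2 : ¬ R.X (R.a d)) : 18 ≤ R.val d := by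
  unfold val
  rw [R.inn_rr h1 h2, R.inn_rr h2 (by simpa using h1)]
  have := R.PsPs d
  unfold h
  split_ifs <;> simp_all
lemma val_rr' {d : D} (h1 : ¬ R.X d) (h2 : ¬ R.X (R.a d)) (h3 : R.X (R.P d))
    (h4 : R.X (R.a (R.N d))) : R.val d = 20 := by
  unfold val
  rw [R.inn_rr h1 h2, R.inn_rr h2 (by simpa using h1)]
  have e1 : ¬ R.Ps d := by
    have := R.XPs _ h3
    rwa [R.Ps_lab _ _ (R.lab_aP d)] at this
  have e2 : ¬ R.Ps (R.a d) := by
    have := R.XPs' h4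
    rwa [R.Ps_lab _ _ (R.lab_N d)] at this
  simp [h, h1, h2, e1, e2]

/-- opposite end of crossing edge -/
lemma opp_s {d : D} (h1 : R.X d) (h2 : R.X (R.a (R.s d))) : ¬ R.X (R.a (R.t d)) := by
  have := R.cc (R.s d) (by simpa using h1) h2
  rwa [R.sss d h1] at this
lemma opp_t {d : D} (h1 : R.X d) (h2 : R.X (R.a (R.t d))) : ¬ R.X (R.a (R.s d)) := by
  have := R.cc (R.t d) (by simpa using h1) h2
  simpa using this

/-- (3) -/
lemma L3a {d : D} (h1 : R.X d) (h2 : R.X (R.a d)) (h3 : R.X (R.P d)) (h4 : ¬ R.T1 (R.a d)) :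
    R.inn (R.a d) = 0 := by
  have h5 : ¬ R.X (R.a (R.t d)) := R.opp_s h1 h3
  have e : R.N (R.a d) = R.t d := by simp [N]
  rw [R.inn_cc h2 (by simpa using h1)]
  unfold icc
  have e1 : ¬ R.T0 (R.a d) := by
    rintro ⟨_, _, a3, a4⟩
    rw [R.X_lab _ _ (Tri.P_lab R a4), e] at a3
    exact h5 a3
  have e2 : ¬ R.Q0 (R.a d) := by
    rintro ⟨_, _, _, a3, _⟩
    rw [X_N, e] at a3
    exact h5 a3
  have e3 : ¬ R.P0 (R.a d) := by
    rintro ⟨_, _, _, a3, _⟩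
    rw [X_N, e] at a3
    exact h5 a3
  simp [h4, e1, e2, e3]

lemma L3b {d : D} (h1 : R.X d) (h2 : R.X (R.a d)) (h3 : R.X (R.a (R.N d))) (h4 : ¬ R.T1 (R.a d)) :
    R.inn (R.a d) = 0 := by
  have := R.m.L3a (d := R.a d) h2 (by simpa using h1) (by simpa using h3)
    (by rw [T1_m]; simpa using h4)
  rw [inn_m] at this
  simpa using this

lemma ask_cc {d : D} (h1 : R.X d) (h2 : R.X (R.a d)) (h3 : R.X (R.P d) ∨ R.X (R.a (R.N d))) :
    R.inn (R.a d) = if R.T1 (R.a d) then 5 + R.k (R.a d) else 0 := by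
  split_ifs with h4
  · rw [R.inn_cc h2 (by simpa using h1)]; unfold icc; simp [h4]
  · rcases h3 with h3 | h3
    · exact R.L3a h1 h2 h3 h4
    · exact R.L3b h1 h2 h3 h4

/-- geometry of T1 -/
lemma T1_geo {d : D} (h : R.T1 d) : ¬ R.X (R.a (R.s d)) ∧ ¬ R.X (R.a (R.t (R.a d))) ∧
    R.lab (R.a (R.s d)) = R.lab (R.a (R.t (R.a d))) ∧ ¬ R.X (R.a (R.s (R.s d))) ∧
    ¬ R.X (R.a (R.s (R.s (R.a d)))) := by
  obtain ⟨h1, h2, h3, h4⟩ := h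
  have h5 := Tri.P_lab R h4
  refine ⟨h3, ?_, h5, R.cc d h1 h2, R.cc _ h2 (by simpa using h1)⟩
  have h6 := h3
  rw [R.X_lab _ _ h5] at h6
  exact h6

lemma T1_ad_T1 {d : D} (h : R.T1 d) : ¬ (R.Tri (R.a d)) := by
  obtain ⟨h1, h2, h3, h4⟩ := h
  intro h5
  have l1 := Tri.P_lab R h4
  have l2 := Tri.P_lab R h5
  simp only [N, P, R.aa] at l1 l2
  -- f darts: a s d, a t d; g darts : a t a d, a s a d
  have hne : R.lab (R.a (R.s d)) ≠ R.lab (R.a (R.t d)) := by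
    intro e
    by_cases hx : R.X (R.a (R.t d))
    · exact h3 ((R.X_lab _ _ e).2 hx)
    · have := R.col_x (R.s d) (by simpa using h1) h3 (by rw [R.sss d h1]; exact hx)
      rw [R.sss d h1] at this
      exact this (R.col_lab _ _ e)
  have := R.share (R.a (R.s d)) (R.a (R.t d)) (R.a (R.t (R.a d))) (R.a (R.s (R.a d)))
    (by simp only [R.ed_a, R.ed_t d h1]) (by simp only [R.ed_a, R.ed_t _ h2]) l1 l2.symm hne
  simp only [R.ed_a, R.ed_t _ h2] at this
  exact R.fg d h1 this

/-- (4) -/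
lemma L4 {d : D} (h : R.T1 d) : R.inn (R.a d) = 0 := by
  have ht := R.T1_ad_T1 h
  have h0 := h
  obtain ⟨h1, h2, h3, h4⟩ := h
  rw [R.inn_cc h2 (by simpa using h1)]
  have e1 : ¬ R.T1 (R.a d) := fun h => ht h.2.2.2
  have e2 : ¬ R.T0 (R.a d) := fun h => ht h.2.2.2
  have e3 : ¬ (R.Q0 (R.a d) ∧ R.T1 (R.a (R.N (R.N (R.a d))))) := by
    rintro ⟨⟨a1, a2, a3, a4, a5⟩, b⟩
    have l1 := Tri.P_lab R h4
    have hN : R.N (R.a d) = R.t d := by simp [N]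
    rw [hN] at a1 a3 a4 a5 b
    set q1 := R.t d with hq1
    set q2 := R.N q1 with hq2
    have hP : R.P (R.a d) = R.N q2 := by
      conv_lhs => rw [← a1]
      simp
    have b4 := b.2.2.2
    have l2 := Tri.P_lab R b4
    have hs : R.s (R.s q1) = R.s d := by simp [hq1]
    have hN2 : R.N (R.a q2) = R.s (R.s (R.a q1)) := by
      have : R.N (R.a q2) = R.t (R.t (R.a q1)) := by simp [N, hq2]
      rw [this, R.tt]
      rw [← X_N]; exact a4
    have c := R.col_cc q1 a3 (by rw [← X_N]; exact a4)
    rw [hs, ← hN2] at c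
    -- f: a s d  and a N (a q2); g : a t a d, P (a q2)
    have hne : R.lab (R.a (R.s d)) ≠ R.lab (R.a (R.N (R.a q2))) := fun e => c (R.col_lab _ _ e)
    have x1 : R.X (R.a q1) := by rw [← X_N]; exact a4
    have x2 : R.X (R.a q2) := b.1
    have edf : R.ed (R.a (R.N (R.a q2))) = R.ed (R.s d) := by
      rw [R.ed_a, hN2, R.ed_ss _ x1, R.ed_a, hq1, R.ed_t d h1]
    have edg : R.ed (R.P (R.a q2)) = R.ed (R.s (R.a d)) := by
      have : R.ed (R.N q2) = R.ed (R.s (R.a q2)) := by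
        simp only [N]; rw [R.ed_t _ x2]
      simp only [P, R.ed_a] at hP ⊢
      rw [← this, ← hP, R.ed_a]
    have := R.share (R.a (R.s d)) (R.a (R.N (R.a q2))) (R.a (R.N d)) (R.P (R.a q2))
      (by rw [edf, R.ed_a]) (by rw [edg, R.ed_a]; simp only [N]; rw [R.ed_t _ h2])
      (by exact l1) l2.symm hne
    simp only [R.ed_a, N, R.ed_t _ h2] at this
    exact R.fg d h1 this
  unfold icc
  simp [e1, e2, e3, h0]

/-- k lemma -/
lemma Lk {d : D} (h : R.T1 d) (hA : R.A d) : R.inn (R.a (R.N d)) = R.k d := by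
  obtain ⟨g1, g2, g3, g4, g5⟩ := R.T1_geo h
  have h0 := h
  obtain ⟨h1, h2, h3, h4⟩ := h
  rw [R.inn_rX (d := R.a (R.N d)) g2 (by simpa [N] using h2)]
  have e1 : R.N (R.a (R.N d)) = R.s (R.s (R.a d)) := by
    simp only [N, R.aa]; exact R.tt _ h2
  have n1 : ¬ R.T1 (R.N (R.a (R.N d))) := by
    rw [e1]; exact fun h => g5 h.2.1
  have n2 : ¬ R.Q1d (R.a (R.N d)) := by
    rintro ⟨_, _, _, a4, _⟩
    rw [e1, X_N] at a4
    exact g5 a4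
  have e2 : R.P (R.a (R.N d)) = R.a (R.s (R.a (R.t (R.a d)))) := rfl
  unfold irX k k1
  simp only [n1, n2, if_false, hA, if_true, e2]
  by_cases hT : R.T2 (R.a (R.s (R.a (R.t (R.a d)))))
  · have e3 : R.P (R.a (R.s (R.a (R.t (R.a d))))) = R.s (R.s (R.a d)) := by
      have := hT.2.2.2
      rw [← this, ← e2]; simp [e1]
    have e4 : R.P (R.a (R.a (R.N d))) = d := by simp
    have e5 : R.N (R.a (R.s (R.s (R.a d)))) = R.s (R.a d) := by simp [N]
    rw [e4, e3, e5]
    simp [hT, t2, h0]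
  · simp [hT]

lemma col_contra {x y z : Bool} (h1 : x ≠ y) (h2 : y ≠ z) (h3 : x ≠ z) : False := by
  revert x y z; decide

/-- geometry of T2 -/
lemma T2_geo {d : D} (h : R.T2 d) : R.a (R.N d) = R.s (R.P d) ∧
    R.col (R.a (R.P d)) ≠ R.col (R.a (R.s (R.P d))) ∧ ¬ R.X (R.a (R.P d)) ∧
    ¬ R.X (R.a (R.s (R.P d))) := by
  obtain ⟨h1, h2, h3, h4⟩ := h
  have e : R.a (R.N d) = R.s (R.P d) := by
    rw [← h4]
    show _ = R.s (R.t (R.a (R.N d)))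
    rw [st]
  have x1 : ¬ R.X (R.a (R.P d)) := by rwa [X_aP]
  have x2 : ¬ R.X (R.a (R.s (R.P d))) := by rw [← e, R.aa, X_N]; exact h2
  refine ⟨e, ?_, x1, x2⟩
  have p1 : ¬ R.Ps d := by
    have := R.XPs _ h3
    rwa [R.Ps_lab _ _ (R.lab_aP d)] at this
  have p2 : ¬ R.Ps (R.a d) := by
    have : R.X (R.s (R.P d)) := by simpa using h3
    have := R.XPs _ this
    rw [← e, R.aa, R.Ps_lab _ _ (R.lab_N d)] at this
    exact this
  have := R.col_a d h1 p1 h2 p2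
  rw [R.col_lab _ _ (R.lab_aP d), ← e, R.aa, R.col_lab _ _ (R.lab_N d)]
  exact this

/-- two triangles T2 at consecutive sectors are impossible -/
lemma T2_T2 {q : D} (h : R.T2 (R.N q)) (h' : R.T2 (R.N (R.s q))) : False := by
  obtain ⟨e1, c1, x1, x2⟩ := R.T2_geo h
  obtain ⟨e2, c2, x3, x4⟩ := R.T2_geo h'
  have hX := h.2.2.1
  simp only [PN] at *
  exact col_contra c1 c2 (R.col_x q hX x1 x4)

end RD
end BCL


namespace BCL
namespace RD
open scoped Classical
variable {D L E : Type} (R : RD D L E)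

lemma Q1d_P {q : D} (h : R.Q1d (R.N q)) : R.X (R.P q) ∧ R.T1 (R.a (R.P q)) ∧
    R.T1 (R.a (R.P (R.P q))) := by
  obtain ⟨a1, a2, a3, a4, a5, a6, a7⟩ := h
  obtain ⟨e1, e2, e3, e4⟩ := R.N4P a1
  simp only [PN] at e1 e2 e3
  rw [e3, e2]
  exact ⟨a4, a7, a6⟩

lemma iXr_zero {d : D} (h1 : ¬ R.X (R.P d)) (h2 : ¬ R.T2 (R.N d)) : R.iXr d = 0 := by
  have n1 : ¬ R.T1 (R.P d) := fun h => h1 h.1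
  have n2 : ¬ R.Q1d (R.N d) := fun h => h1 (R.Q1d_P h).1
  unfold iXr
  simp [n1, n2, h2]

/-- (5) -/
lemma T1_sum_A {d : D} (h : R.T1 d) (hA : R.A d) : 56 ≤ R.val d + R.val (R.N d) + R.val (R.P d) := by
  obtain ⟨g1, g2, g3, g4, g5⟩ := R.T1_geo h
  have l4 := R.L4 h
  have lk := R.Lk h hA
  have h0 := h
  obtain ⟨h1, h2, h3, h4⟩ := h
  have e1 : R.a (R.P d) = R.s d := by simp [P]
  have z : R.inn (R.a (R.P d)) = 0 := by
    rw [e1, R.inn_Xr (by simpa using h1) g1]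
    apply R.iXr_zero g4
    intro hT
    have := (R.T2_geo hT).2.1
    simp only [PN] at this
    exact this hA.symm
  have v1 := R.val_cc h1 h2
  have v2 := R.val_Xr (d := R.N d) (by simpa [N] using h2) g2
  have v3 := R.val_rX (d := R.P d) h3 (by simpa [P] using h1)
  have i1 : R.inn d = 5 + R.k d := by
    rw [R.inn_cc h1 h2]; simp [icc, h0]
  have i2 := R.inn_nn (R.N d)
  have i3 : R.inn (R.P d) = 3 := by
    rw [R.inn_rX h3 (by simpa [P] using h1)]; simp [irX, h0, hA]
  linarith

lemma T1_sum {d : D} (h : R.T1 d) : 56 ≤ R.val d + R.val (R.N d) + R.val (R.P d) := by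
  by_cases hA : R.A d
  · exact R.T1_sum_A h hA
  · have := R.m.T1_sum_A (d := R.a d) (by rw [T1_m]; simpa using h) (by rw [R.A_m' d h]; exact hA)
    rw [val_m, val_m, val_m] at this
    simp at this
    linarith

/-- (6) -/
lemma T2_ask {q : D} (h : R.T2 (R.N q)) : R.inn (R.s q) = 0 := by
  obtain ⟨e1, c1, x1, x2⟩ := R.T2_geo h
  have hX := h.2.2.1
  simp only [PN] at *
  rw [R.inn_Xr (by simpa using hX) x2]
  have n1 : R.T1 (R.P (R.s q)) → R.A (R.P (R.s q)) := by
    intro hT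
    obtain ⟨g1, g2, g3, g4, g5⟩ := R.T1_geo hT
    have hT1 := hT.1
    have hT2 := hT.2.1
    have c := R.col_cc _ hT1 hT2
    unfold A
    set b := R.P (R.s q) with hb
    have ab : R.a b = R.s (R.s q) := by simp [hb, P]
    have e3 : R.s (R.s (R.a b)) = q := by rw [ab]; exact R.s4 q hX
    have e4 : R.t (R.a b) = R.s q := by rw [ab]; simp
    rw [e3] at c
    rw [e4] at g3
    show _ = R.col (R.a (R.s b))
    rw [R.col_lab _ _ g3]
    exact bool3 c c1
  have n2 : ¬ R.T2 (R.N (R.s q)) := fun h' => R.T2_T2 h h'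
  have n3 : ¬ R.Q1d (R.N (R.s q)) := by
    intro hQ
    have hQ' := hQ
    obtain ⟨b1, b2, b3⟩ := R.Q1d_P hQ
    set p := R.s (R.s q) with hp
    have e1 : R.a (R.P (R.s q)) = p := by simp [P, hp]
    rw [e1] at b2
    have e2 : R.a (R.P (R.P (R.s q))) = R.s (R.a p) := by
      show R.a (R.a (R.s (R.a p))) = _
      simp
    rw [e2] at b3
    set g := R.s (R.a p) with hg
    -- N s q = a s a g
    have e3 : R.a (R.s (R.a g)) = R.N (R.s q) := by
      obtain ⟨f1, f2, f3, f4⟩ := R.N4P hQ.1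
      rw [← f4, PN]; simp [P, hg, hp]
    have xag := b3.2.1
    obtain ⟨k1, k2, k3, k4, k5⟩ := R.T1_geo b2
    obtain ⟨m1, m2, m3, m4, m5⟩ := R.T1_geo b3
    -- col w ≠ col z2
    have c2 := R.col_x (R.s (R.a g)) (by simpa using xag) (by rw [e3]; exact hQ.2.1)
      (by rw [R.sss _ xag]; exact m2)
    rw [R.sss _ xag, e3, R.col_lab _ _ (R.lab_N _), ← R.col_lab _ _ m3] at c2
    have c3 := R.col_cc p b2.1 b2.2.1
    have e5 : R.s (R.s p) = q := R.s4 q hX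
    rw [e5] at c3
    exact col_contra c1 c2 c3
  unfold iXr
  simp only [n2, n3, if_false]
  split_ifs <;> tauto

lemma T2_sum {d : D} (h : R.T2 d) : 56 ≤ R.val d + R.val (R.N d) + R.val (R.P d) := by
  have h0 := h
  obtain ⟨e1, c1, x1, x2⟩ := R.T2_geo h
  have z1 : R.inn (R.a (R.N d)) = 0 := by
    rw [e1]; apply R.T2_ask; simpa using h
  have z2 : R.inn (R.a (R.P d)) = 0 := by
    have hm : R.m.T2 (R.a d) := by rw [T2_m]; simpa using h
    obtain ⟨e2, _⟩ := R.m.T2_geo hm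
    have := R.m.T2_ask (q := R.m.P (R.a d)) (by rw [NP]; exact hm)
    rw [← e2, inn_m] at this
    simpa using this
  obtain ⟨h1, h2, h3, h4⟩ := h
  have xN : ¬ R.X (R.N d) := by rwa [X_N]
  have xaN : R.X (R.a (R.N d)) := by rw [e1]; simpa using h3
  have v1 := R.val_rr' h1 h2 h3 xaN
  have v2 := R.val_rX xN xaN
  have v3 := R.val_Xr h3 x1
  have i2 : R.inn (R.N d) = t2 (R.T1 (R.P (R.a (R.N d)))) (R.T1 (R.N (R.a (R.P d)))) := by
    rw [R.inn_rX xN xaN]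
    unfold irX
    have : ¬ R.T1 (R.N (R.N d)) := by rw [h4]; exact fun h => x1 h.2.1
    simp only [this, if_false, PN, h0, if_true]
  have i3 : R.inn (R.P d) = t2 (R.T1 (R.N (R.a (R.P d)))) (R.T1 (R.P (R.a (R.N d)))) := by
    rw [R.inn_Xr h3 x1]
    unfold iXr
    have : ¬ R.T1 (R.P (R.P d)) := fun h => by
      have := h.2.1
      rw [X_aP] at this
      have h5 := h.1
      rw [← h4] at h5
      have e6 : R.P (R.P d) = R.N d := by rw [← h4]; simp
      rw [e6] at h
      exact xN h.1
    simp only [this, if_false, NP, h0, if_true]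
  have := t2_sum (R.T1 (R.P (R.a (R.N d)))) (R.T1 (R.N (R.a (R.P d))))
  linarith

/-- (7) -/
lemma T0_aux {d : D} (h : R.T0 d) : 19 ≤ R.val d := by
  have h0 := h
  obtain ⟨h1, h2, h3, h4⟩ := h
  have n1 : ¬ R.T1 d := fun h => h.2.2.1 h3
  have i : R.inn d = 5 := by rw [R.inn_cc h1 h2]; simp [icc, n1, h0]
  have : R.inn (R.a d) = 0 := by
    rw [R.ask_cc h1 h2 (Or.inl h3)]
    split_ifs with hT
    · have := R.L4 hT
      rw [R.aa] at this
      omega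
    · rfl
  rw [R.val_cc h1 h2]; omega

lemma T0_N {d : D} (h : R.T0 d) : R.T0 (R.N d) := by
  obtain ⟨h1, h2, h3, h4⟩ := h
  have e : R.P d = R.N (R.N d) := h4.symm
  refine ⟨by rwa [X_N], ?_, by simpa using h1, ?_⟩
  · rw [← X_N, ← e]; exact h3
  · unfold Tri at *; rw [h4]; simp

lemma T0_sum {d : D} (h : R.T0 d) : 56 ≤ R.val d + R.val (R.N d) + R.val (R.P d) := by
  have a1 := R.T0_aux h
  have a2 := R.T0_aux (R.T0_N h)
  have a3 := R.T0_aux (R.T0_N (R.T0_N h))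
  rw [h.2.2.2] at a3
  linarith

/-- (1) -/
lemma L1X {d : D} (h1 : R.X (R.a d)) (h2 : R.X (R.a (R.N d))) : ¬ R.X (R.P (R.a d)) :=
  R.opp_t h1 h2

lemma es_le {d : D} (h0 : ¬ R.X d) (h1 : R.X (R.a d)) : R.inn (R.a d) ≤ 3 := by
  rw [R.inn_Xr h1 (by simpa using h0)]; exact R.iXr_le _

lemma es_ask {d : D} (h0 : ¬ R.X d) (h1 : R.X (R.a d)) (h2 : R.X (R.a (R.N d))) :
    R.inn (R.a d) ≤ 2 ∧ (R.T1 (R.a (R.N d)) → R.inn (R.a d) ≤ 1) ∧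
    (¬ R.T2 (R.N (R.a d)) → R.inn (R.a d) = 0) := by
  have x := R.L1X h1 h2
  rw [R.inn_Xr h1 (by simpa using h0)]
  by_cases hT : R.T2 (R.N (R.a d))
  · have n1 : ¬ R.T1 (R.P (R.a d)) := fun h => x h.1
    have e : R.iXr (R.a d) = t2 (R.T1 (R.N d)) (R.T1 (R.P (R.a (R.N (R.N (R.a d)))))) := by
      unfold iXr
      simp only [n1, if_false, hT, if_true, R.aa]
    rw [e]
    refine ⟨t2_le _ _, ?_, fun h => absurd hT h⟩
    intro h3
    have n2 : ¬ R.T1 (R.P (R.a (R.N (R.N (R.a d))))) := by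
      intro h4
      have e2 : R.N (R.N (R.a d)) = R.a (R.s (R.a d)) := by
        have := (R.T2_geo hT).1
        simp only [PN] at this
        rw [← this, R.aa]
      rw [e2, R.aa] at h4
      have := (R.T1_geo h3).2.1
      simp only [R.aa, N] at this
      rw [R.tt _ h1] at this
      exact this h4.1
    unfold t2
    split_ifs <;> norm_num
  · have := R.iXr_zero x hT
    rw [this]; norm_num

end RD
end BCL


namespace BCL
namespace RD
open scoped Classical
variable {D L E : Type} (R : RD D L E)

/-- colour of the forward end -/
def fe (d : D) : Bool := R.col (R.a (R.s (R.s (R.a d))))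

lemma fe_P {d : D} (h : R.X d) : R.fe (R.P d) = R.col (R.a (R.t d)) := by
  unfold fe
  have : R.a (R.P d) = R.s d := by simp [P]
  rw [this, R.sss d h]

lemma T1_fe {d : D} (h : R.T1 (R.a d)) (h2 : R.X (R.a (R.N d))) : R.fe (R.P d) ≠ R.fe (R.N d) := by
  obtain ⟨g1, g2, g3, g4, g5⟩ := R.T1_geo h
  simp only [R.aa] at *
  have hd : R.X d := by simpa using h.2.1
  rw [R.fe_P hd, ← R.col_lab _ _ g3]
  have hX : R.X (R.N d) := by rw [X_N]; exact h.1
  have := R.col_cc (R.N d) hX h2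
  have e : R.s (R.s (R.N d)) = R.s (R.a d) := by simp [N]
  rw [e] at this
  exact this

lemma A_fe {d : D} (h : R.T1 (R.a d)) : R.A (R.a d) ↔ R.fe d = R.fe (R.P d) := by
  obtain ⟨g1, g2, g3, g4, g5⟩ := R.T1_geo h
  have hd : R.X d := by simpa using h.2.1
  rw [R.fe_P hd]
  simp only [R.aa] at *
  rw [← R.col_lab _ _ g3]
  rfl

lemma k_a1 {d : D} (h : R.A (R.a d)) (h' : ¬ R.T1 (R.a (R.P d))) : R.k (R.a d) = 0 := by
  unfold k k1
  have : R.a (R.P d) = R.s d := by simp [P]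
  rw [this] at h'
  simp [h, h']

lemma k_a2 {d : D} (h : ¬ R.A (R.a d)) (h' : ¬ R.T1 (R.a (R.N d))) : R.k (R.a d) = 0 := by
  unfold k k2
  simp only [N] at h'
  simp [h, h']

lemma not_T1_of_X {d : D} (h : R.X (R.P d)) : ¬ R.T1 d := fun h' => h'.2.2.1 h

lemma val_ccX {d : D} (h1 : R.X d) (h2 : R.X (R.N d)) (h3 : R.X (R.P d)) :
    R.val d = 14 + R.icc d - if R.T1 (R.a d) then 5 + R.k (R.a d) else 0 := by
  have h2' : R.X (R.a d) := by rwa [← X_N]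
  rw [R.val_cc h1 h2', R.inn_cc h1 h2', R.ask_cc h1 h2' (Or.inl h3)]

lemma val_ccX' {d : D} (h1 : R.X d) (h2 : R.X (R.N d)) (h3 : R.X (R.N (R.N d))) :
    R.val d = 14 + R.icc d - if R.T1 (R.a d) then 5 + R.k (R.a d) else 0 := by
  have h2' : R.X (R.a d) := by rwa [← X_N]
  rw [R.val_cc h1 h2', R.inn_cc h1 h2', R.ask_cc h1 h2' (Or.inr (by rwa [← X_N]))]

lemma Tri4 {d : D} (h : R.N (R.N (R.N (R.N d))) = d) : ¬ R.Tri d := by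
  intro h'
  unfold Tri at h'
  rw [h', NP] at h
  exact R.N1 d h

/-- (8) -/
lemma Q0_icc {d : D} (h : R.Q0 d) : R.icc d = if R.T1 (R.a (R.N (R.N d))) then 6 else 0 := by
  have h0 := h
  obtain ⟨a1, a2, a3, a4, a5⟩ := h
  have n1 : ¬ R.T1 d := fun h => R.Tri4 a1 h.2.2.2
  have n2 : ¬ R.T0 d := fun h => R.Tri4 a1 h.2.2.2
  have n3 : ¬ R.P0 d := by
    intro h
    have := h.1
    rw [a1] at this
    exact R.N1 _ this
  unfold icc
  simp [n1, n2, n3, h0]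

lemma Q0_N {d : D} (h : R.Q0 d) : R.Q0 (R.N d) := by
  obtain ⟨a1, a2, a3, a4, a5⟩ := h
  refine ⟨by rw [a1], a3, a4, a5, by rwa [a1]⟩

lemma Q0_val {d : D} (h : R.Q0 d) : 14 + (if R.T1 (R.a (R.N (R.N d))) then 6 else 0) -
    (if R.T1 (R.a d) then 6 else 0) ≤ R.val d := by
  rw [R.val_ccX' h.2.1 h.2.2.1 h.2.2.2.1, R.Q0_icc h]
  have := R.k_le (R.a d)
  split_ifs <;> linarith

lemma Q0_sum {d : D} (h : R.Q0 d) :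
    56 ≤ R.val d + R.val (R.N d) + R.val (R.N (R.N d)) + R.val (R.N (R.N (R.N d))) := by
  have a0 := R.Q0_val h
  have a1 := R.Q0_val (R.Q0_N h)
  have a2 := R.Q0_val (R.Q0_N (R.Q0_N h))
  have a3 := R.Q0_val (R.Q0_N (R.Q0_N (R.Q0_N h)))
  simp only [h.1] at *
  linarith

/-- (9) -/
lemma P0_N {d : D} (h : R.P0 d) : R.P0 (R.N d) := by
  obtain ⟨a1, a2, a3, a4, a5, a6⟩ := h
  refine ⟨by rw [a1], a3, a4, a5, a6, by rwa [a1]⟩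

lemma P0_icc {d : D} (h : R.P0 d) : R.icc d = if R.T1 (R.a d) then 0 else 8 := by
  have h0 := h
  obtain ⟨a1, a2, a3, a4, a5, a6⟩ := h
  have n0 : ¬ R.Tri d := by
    intro h'
    unfold Tri at h'
    rw [h', NP] at a1
    exact R.N2 d a1
  have n1 : ¬ R.T1 d := fun h => n0 h.2.2.2
  have n2 : ¬ R.T0 d := fun h => n0 h.2.2.2
  have n3 : ¬ R.Q0 d := by
    intro h
    rw [h.1] at a1
    exact R.N1 _ a1
  unfold icc
  simp [n1, n2, n3, h0]

/-- bound of the claim on `a d` in terms of the neighbours, `x,y,z` : T1 of previous, current, next;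
`u v` : colours of previous and current forward ends -/
lemma P0_val {d p : D} (h : R.P0 d) (hp : R.N p = d) : (R.T1 (R.a d) → R.fe p ≠ R.fe (R.N d)) ∧
    (R.T1 (R.a d) → 8 ≤ R.val d) ∧ (¬ R.T1 (R.a d) → R.val d = 22) ∧
    (R.T1 (R.a d) → R.fe d = R.fe p → ¬ R.T1 (R.a p) → R.val d = 9) ∧
    (R.T1 (R.a d) → R.fe d ≠ R.fe p → ¬ R.T1 (R.a (R.N d)) → R.val d = 9) := by
  have hp' : p = R.P d := by rw [← hp]; simp
  subst hp'
  have e := R.val_ccX' h.2.1 h.2.2.1 h.2.2.2.1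
  have i := R.P0_icc h
  refine ⟨fun h1 => R.T1_fe h1 (by rw [← X_N]; exact h.2.2.2.1), ?_, ?_, ?_, ?_⟩
  · intro h1
    have := R.k_le (R.a d)
    simp only [h1, if_true] at *; linarith
  · intro h1
    simp only [h1, if_false] at *; linarith
  · intro h1 h2 h3
    have := R.k_a1 ((R.A_fe h1).2 h2) h3
    simp only [h1, if_true] at *; linarith
  · intro h1 h2 h3
    have := R.k_a2 (fun h => h2 ((R.A_fe h1).1 h)) h3
    simp only [h1, if_true] at *; linarith

lemma P0_sum {d : D} (h : R.P0 d) : 56 ≤ R.val d + R.val (R.N d) + R.val (R.N (R.N d)) +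
    R.val (R.N (R.N (R.N d))) + R.val (R.N (R.N (R.N (R.N d)))) := by
  have a0 := R.P0_val h h.1
  have a1 := R.P0_val (R.P0_N h) rfl
  have a2 := R.P0_val (R.P0_N (R.P0_N h)) rfl
  have a3 := R.P0_val (R.P0_N (R.P0_N (R.P0_N h))) rfl
  have a4 := R.P0_val (R.P0_N (R.P0_N (R.P0_N (R.P0_N h)))) rfl
  rw [h.1] at a4
  generalize R.N (R.N (R.N (R.N d))) = d4 at *
  generalize R.N (R.N (R.N d)) = d3 at *
  generalize R.N (R.N d) = d2 at *
  generalize R.N d = d1 at *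
  clear h
  generalize R.val _ = v0 at *
  generalize R.val _ = v1 at *
  generalize R.val _ = v2 at *
  generalize R.val _ = v3 at *
  generalize R.val _ = v4 at *
  generalize R.fe d = c0 at *
  generalize R.fe d1 = c1 at *
  generalize R.fe d2 = c2 at *
  generalize R.fe d3 = c3 at *
  generalize R.fe d4 = c4 at *
  generalize R.T1 (R.a d) = t0 at *
  generalize R.T1 (R.a d1) = t1 at *
  generalize R.T1 (R.a d2) = t2 at *
  generalize R.T1 (R.a d3) = t3 at *
  generalize R.T1 (R.a d4) = t4 at *
  obtain ⟨a01, a02, a03, a04, a05⟩ := a0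
  obtain ⟨a11, a12, a13, a14, a15⟩ := a1
  obtain ⟨a21, a22, a23, a24, a25⟩ := a2
  obtain ⟨a31, a32, a33, a34, a35⟩ := a3
  obtain ⟨a41, a42, a43, a44, a45⟩ := a4
  by_cases ht0 : t0 <;> by_cases ht1 : t1 <;> by_cases ht2 : t2 <;> by_cases ht3 : t3 <;>
    by_cases ht4 : t4 <;> simp only [ht0, ht1, ht2, ht3, ht4, forall_true_left, not_true_eq_false, not_false_eq_true,
      false_imp_iff, true_imp_iff, imp_true_iff] at * <;> first | omega | skip
  all_goals
    cases c0 <;> cases c1 <;> cases c2 <;> cases c3 <;> cases c4 <;> simp at * <;> omega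

/-- (10) -/
lemma H0_val {d : D} (p : D) (hp : R.N p = d) (h1 : R.X d) (h2 : R.X (R.N d)) (h3 : R.X (R.N (R.N d))) :
    8 ≤ R.val d ∧ (¬ R.T1 (R.a d) → 14 ≤ R.val d) ∧ (R.T1 (R.a d) → R.fe p ≠ R.fe (R.N d)) := by
  have hp' : p = R.P d := by rw [← hp]; simp
  subst hp'
  have e := R.val_ccX' h1 h2 h3
  have := R.k_le (R.a d)
  have := R.icc_nn d
  refine ⟨?_, ?_, fun h1 => R.T1_fe h1 (by rw [← X_N]; exact h3)⟩
  · split_ifs at e <;> omega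
  · intro h; simp only [h, if_false] at e; omega

lemma H0_sum {d : D} (h : R.N (R.N (R.N (R.N (R.N (R.N d))))) = d) (h0 : R.X d) (h1 : R.X (R.N d))
    (h2 : R.X (R.N (R.N d))) (h3 : R.X (R.N (R.N (R.N d)))) (h4 : R.X (R.N (R.N (R.N (R.N d)))))
    (h5 : R.X (R.N (R.N (R.N (R.N (R.N d)))))) :
    56 ≤ R.val d + R.val (R.N d) + R.val (R.N (R.N d)) +
    R.val (R.N (R.N (R.N d))) + R.val (R.N (R.N (R.N (R.N d)))) +
    R.val (R.N (R.N (R.N (R.N (R.N d))))) := by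
  have a0 := R.H0_val _ h h0 h1 h2
  have a1 := R.H0_val _ rfl h1 h2 h3
  have a2 := R.H0_val _ rfl h2 h3 h4
  have a3 := R.H0_val _ rfl h3 h4 h5
  have a4 := R.H0_val _ rfl h4 h5 (by rwa [h])
  have a5 := R.H0_val _ rfl h5 (by rwa [h]) (by rwa [h])
  rw [h] at a5
  have key : ∀ x y z : Bool, ∀ p q r : Prop, (p → x ≠ y) → (q → y ≠ z) → (r → z ≠ x) →
      ¬ p ∨ ¬ q ∨ ¬ r := by
    intro x y z p q r h1 h2 h3
    by_contra hh
    push Not at hh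
    exact col_contra (h1 hh.1) (h2 hh.2.1) (h3 hh.2.2).symm
  have k1 := key _ _ _ _ _ _ a1.2.2 a3.2.2 a5.2.2
  have k2 := key _ _ _ _ _ _ a2.2.2 a4.2.2 a0.2.2
  rcases k1 with k1 | k1 | k1 <;> rcases k2 with k2 | k2 | k2 <;>
    first
    | linarith [a0.1, a1.1, a2.1, a3.1, a4.1, a5.1, a1.2.1 k1, a2.2.1 k2]
    | linarith [a0.1, a1.1, a2.1, a3.1, a4.1, a5.1, a1.2.1 k1, a4.2.1 k2]
    | linarith [a0.1, a1.1, a2.1, a3.1, a4.1, a5.1, a1.2.1 k1, a0.2.1 k2]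
    | linarith [a0.1, a1.1, a2.1, a3.1, a4.1, a5.1, a3.2.1 k1, a2.2.1 k2]
    | linarith [a0.1, a1.1, a2.1, a3.1, a4.1, a5.1, a3.2.1 k1, a4.2.1 k2]
    | linarith [a0.1, a1.1, a2.1, a3.1, a4.1, a5.1, a3.2.1 k1, a0.2.1 k2]
    | linarith [a0.1, a1.1, a2.1, a3.1, a4.1, a5.1, a5.2.1 k1, a2.2.1 k2]
    | linarith [a0.1, a1.1, a2.1, a3.1, a4.1, a5.1, a5.2.1 k1, a4.2.1 k2]
    | linarith [a0.1, a1.1, a2.1, a3.1, a4.1, a5.1, a5.2.1 k1, a0.2.1 k2]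

/-- es followed by cc -/
lemma es_cc {d : D} (h0 : ¬ R.X d) (h1 : R.X (R.N d)) (h2 : R.X (R.N (R.N d)))
    (h3 : R.X (R.N (R.N (R.N d)))) : 24 ≤ R.val d + R.val (R.N d) := by
  have x1 : R.X (R.a d) := by rwa [← X_N]
  have x2 : R.X (R.a (R.N d)) := by rwa [← X_N]
  have v1 := R.val_rX h0 x1
  have v2 := R.val_ccX' h1 h2 h3
  obtain ⟨b1, b2, b3⟩ := R.es_ask h0 x1 x2
  have := R.inn_nn d
  have := R.icc_nn (R.N d)
  have := R.k_le (R.a (R.N d))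
  split_ifs at v2 with hT
  · have := b2 hT; linarith
  · linarith

lemma cc_es {d : D} (h1 : R.X d) (h2 : ¬ R.X (R.a d)) (h3 : R.X (R.P d))
    (h4 : R.X (R.P (R.P d))) : 24 ≤ R.val d + R.val (R.P d) := by
  have := R.m.es_cc (d := R.a d) h2 (by simpa [X_aP] using h1) (by simpa [X_aP] using h3)
    (by simpa [X_aP] using h4)
  rw [val_m, val_m] at this
  simpa using this

/-- (11) -/
lemma P1_sum {d : D} (h : R.N (R.N (R.N (R.N (R.N d)))) = d) (h0 : ¬ R.X d) (h1 : R.X (R.N d))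
    (h2 : R.X (R.N (R.N d))) (h3 : R.X (R.N (R.N (R.N d)))) (h4 : R.X (R.N (R.N (R.N (R.N d))))) :
    56 ≤ R.val d + R.val (R.N d) + R.val (R.N (R.N d)) +
    R.val (R.N (R.N (R.N d))) + R.val (R.N (R.N (R.N (R.N d)))) := by
  have a := R.es_cc h0 h1 h2 h3
  have b := R.cc_es h4 (by rw [← X_N, h]; exact h0) (by simpa using h3) (by simpa using h2)
  have c := (R.H0_val _ rfl h2 h3 h4).1
  simp only [PN] at b
  linarith

end RD
end BCL


namespace BCL

open scoped Classical in
lemma sum_orbit {D : Type} [Fintype D] (ψ : Equiv.Perm D) (f : D → ℤ) (d : D) :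
    ∑ x with ψ.SameCycle d x, f x =
      ∑ i ∈ Finset.range (Function.minimalPeriod ψ d), f (ψ^[i] d) := by
  symm
  have hpos : 0 < Function.minimalPeriod ψ d := by
    apply Function.IsPeriodicPt.minimalPeriod_pos (n := orderOf ψ) (orderOf_pos ψ)
    show ψ^[orderOf ψ] d = d
    rw [Equiv.Perm.iterate_eq_pow, pow_orderOf_eq_one]; rfl
  apply Finset.sum_nbij (fun i => ψ^[i] d)
  · intro i _
    simp only [Finset.mem_filter, Finset.mem_univ, true_and]
    exact ⟨i, by rw [zpow_natCast, Equiv.Perm.iterate_eq_pow]⟩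
  · intro i hi j hj h
    exact Function.iterate_injOn_Iio_minimalPeriod (f := ψ) (x := d) (by simpa using hi)
      (by simpa using hj) h
  · intro x hx
    simp only [Finset.coe_filter, Finset.mem_univ, true_and, Set.mem_ofPred_eq] at hx
    obtain ⟨n, hn⟩ := hx.exists_nat_pow_eq
    refine ⟨n % Function.minimalPeriod ψ d, by simpa using Nat.mod_lt _ hpos, ?_⟩
    show ψ^[_] d = x
    rw [Function.iterate_mod_minimalPeriod_eq, Equiv.Perm.iterate_eq_pow, hn]
  · intro i _; rfl

lemma minPer_pos {D : Type} [Fintype D] (ψ : Equiv.Perm D) (d : D) :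
    0 < Function.minimalPeriod ψ d := by
  apply Function.IsPeriodicPt.minimalPeriod_pos (n := orderOf ψ) (orderOf_pos ψ)
  show ψ^[orderOf ψ] d = d
  rw [Equiv.Perm.iterate_eq_pow, pow_orderOf_eq_one]; rfl

namespace RD
open scoped Classical
variable {D L E : Type} (R : RD D L E)

lemma es_ask_m {d : D} (h0 : R.X d) (h1 : ¬ R.X (R.a d)) (h2 : R.X (R.P d)) :
    R.inn (R.a d) ≤ 2 ∧ (R.T1 (R.a (R.P d)) → R.inn (R.a d) ≤ 1) ∧
    (¬ R.T2 (R.P (R.a d)) → R.inn (R.a d) = 0) := by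
  have := R.m.es_ask (d := R.a d) h1 (by simpa using h0) (by simpa using h2)
  rw [inn_m, T1_m, T2_m] at this
  simpa using this

/-- (12) -/
lemma Q1_T1 {d : D} (h : R.N (R.N (R.N (R.N d))) = d) (h0 : ¬ R.X d) (h1 : R.X (R.N d))
    (h2 : R.X (R.N (R.N d))) (h3 : R.X (R.N (R.N (R.N d)))) (hT : R.T1 (R.a (R.N d))) :
    R.inn (R.a (R.N (R.N (R.N d)))) = 0 ∧ R.k (R.a (R.N d)) = 0 := by
  have xa0 : R.X (R.a d) := by rwa [← X_N]
  have xa3 : ¬ R.X (R.a (R.N (R.N (R.N d)))) := by rw [← X_N, h]; exact h0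
  obtain ⟨g1, g2, g3, g4, g5⟩ := R.T1_geo hT
  have e0 : R.s (R.s (R.a d)) = R.t (R.N d) := by
    rw [← R.tt _ xa0]; rfl
  have c0 : R.col d ≠ R.fe d := by
    have := R.col_x (R.a d) xa0 (by simpa using h0) (by rw [e0]; simpa using g2)
    simpa [fe] using this
  have c1 := R.T1_fe hT (by rwa [← X_N])
  rw [PN] at c1
  have cd : R.col (R.a (R.N (R.N (R.N d)))) = R.col d := by
    rw [← R.col_lab _ _ (R.lab_N _), h]
  constructor
  · apply (R.es_ask_m h3 xa3 (by simpa using h2)).2.2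
    intro hT2
    obtain ⟨b1, b2, b3, b4⟩ := R.T2_geo hT2
    have b5 := hT2.2.2.2
    unfold Tri at b5
    rw [NP] at b5
    have e3 : R.N (R.a (R.N (R.N (R.N d)))) = R.t (R.N (R.N (R.N d))) := by
      simp [N]
    rw [← b1, R.aa, NP, ← b5, e3, ← R.fe_P h3, PN, cd] at b2
    exact col_contra c0 c1 b2.symm
  · by_cases hA : R.A (R.a (R.N d))
    · apply R.k_a1 hA
      rw [PN]
      intro h'
      have := h'.2.1
      rw [R.aa] at this
      exact h0 this
    · apply R.k_a2 hA
      intro h'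
      apply hA
      rw [R.A_fe hT, PN]
      obtain ⟨g1', g2', g3', g4', g5'⟩ := R.T1_geo h'
      have e4 : R.s (R.s (R.N (R.N (R.N d)))) = R.s (R.a (R.N (R.N d))) := by
        show R.s (R.s (R.t _)) = _
        rw [st]
      have := R.col_x _ h3 xa3 (by rw [e4]; exact g1')
      rw [e4, cd, R.col_lab _ _ g3', R.aa, ← R.fe_P h2, PN] at this
      exact bool3 this.symm c0

lemma Q1_sum {d : D} (h : R.N (R.N (R.N (R.N d))) = d) (h0 : ¬ R.X d) (h1 : R.X (R.N d))
    (h2 : R.X (R.N (R.N d))) (h3 : R.X (R.N (R.N (R.N d)))) :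
    56 ≤ R.val d + R.val (R.N d) + R.val (R.N (R.N d)) + R.val (R.N (R.N (R.N d))) := by
  have xa0 : R.X (R.a d) := by rwa [← X_N]
  have xa3 : ¬ R.X (R.a (R.N (R.N (R.N d)))) := by rw [← X_N, h]; exact h0
  have f1 := R.Q1_T1 h h0 h1 h2 h3
  have f2 := R.m.Q1_T1 (d := R.a (R.N (R.N (R.N d)))) (by
      obtain ⟨e1, e2, e3, e4⟩ := R.N4P h
      simp [e1]) xa3
    (by simpa [X_aP, ← X_N] using h3) (by simpa [X_aP, ← X_N] using h2)
    (by simpa [X_aP, ← X_N] using h1)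
  have f3 : R.T1 (R.a (R.N (R.N d))) → R.inn (R.a d) = 0 ∧ R.k (R.a (R.N (R.N d))) = 0 := by
    intro hT
    have := f2 (by rw [T1_m]; simpa using hT)
    rw [inn_m, k_m _ _ (by simpa using hT)] at this
    simpa using this
  obtain ⟨a1, a2, a3⟩ := R.es_ask h0 xa0 (by rwa [← X_N])
  obtain ⟨b1, b2, b3⟩ := R.es_ask_m h3 xa3 (by simpa using h2)
  rw [PN] at b2
  have v0 := R.val_rX h0 xa0
  have v1 := R.val_ccX' h1 h2 h3
  have v2 := R.val_ccX h2 h3 (by simpa using h1)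
  have v3 := R.val_Xr h3 xa3
  have i0 := R.inn_nn d
  have i1 := R.icc_nn (R.N d)
  have i2 := R.icc_nn (R.N (R.N d))
  have i3 := R.inn_nn (R.N (R.N (R.N d)))
  by_cases t1 : R.T1 (R.a (R.N d)) <;> by_cases t2 : R.T1 (R.a (R.N (R.N d)))
  · have hQ : R.Q1d d := ⟨h, h0, h1, h2, h3, t1, t2⟩
    obtain ⟨e1, e2, e3, e4⟩ := R.N4P h
    have j0 : R.inn d = 2 := by
      rw [R.inn_rX h0 xa0]
      have n1 : ¬ R.T1 (R.N d) := fun h' => R.Tri4 (by rw [h]) h'.2.2.2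
      have n2 : ¬ R.T2 (R.P d) := fun h' => h'.1 (by rw [e1]; exact h3)
      simp [irX, n1, n2, hQ]
    have j3 : R.inn (R.N (R.N (R.N d))) = 2 := by
      rw [R.inn_Xr h3 xa3]
      have n1 : ¬ R.T1 (R.N (R.N d)) := fun h' => R.Tri4 (by rw [h]) h'.2.2.2
      have n2 : ¬ R.T2 d := fun h' => h'.2.1 xa0
      simp [iXr, n1, n2, hQ, h]
    obtain ⟨p1, p2⟩ := f1 t1
    obtain ⟨q1, q2⟩ := f3 t2
    simp only [t1, t2, if_true] at v1 v2
    linarith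
  · obtain ⟨p1, p2⟩ := f1 t1
    have := a2 t1
    simp only [t1, t2, if_true, if_false] at v1 v2
    linarith
  · obtain ⟨q1, q2⟩ := f3 t2
    have := b2 t2
    simp only [t1, t2, if_true, if_false] at v1 v2
    linarith
  · simp only [t1, t2, if_false] at v1 v2
    linarith

/-! generic case -/
noncomputable def r1 (d : D) : ℤ := if ¬ R.X d ∧ R.X (R.N d) ∧ R.X (R.N (R.N d)) then 1 else 0
noncomputable def r2 (d : D) : ℤ := if R.X d ∧ ¬ R.X (R.N d) ∧ R.X (R.P d) then 1 else 0
noncomputable def val' (d : D) : ℤ := R.val d - R.r1 d - R.r2 d + R.r1 (R.P d) + R.r2 (R.N d)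

lemma r1_nn (d : D) : 0 ≤ R.r1 d := by unfold r1; split_ifs <;> norm_num
lemma r2_nn (d : D) : 0 ≤ R.r2 d := by unfold r2; split_ifs <;> norm_num

lemma g_cc {d : D} (h1 : R.X d) (h2 : R.X (R.N d)) : 8 ≤ R.val' d := by
  have x2 : R.X (R.a d) := by rwa [← X_N]
  have e1 : R.r1 d = 0 := by simp [r1, h1]
  have e2 : R.r2 d = 0 := by simp [r2, h2]
  have := R.r1_nn (R.P d)
  have := R.r2_nn (R.N d)
  have := R.icc_nn d
  unfold val'
  rw [e1, e2]
  by_cases hc : R.X (R.P d) ∨ R.X (R.a (R.N d))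
  · have v := R.val_cc h1 x2
    rw [R.ask_cc h1 x2 hc, R.inn_cc h1 x2] at v
    have := R.k_le (R.a d)
    split_ifs at v <;> linarith
  · push Not at hc
    have e3 : R.r1 (R.P d) = 1 := by simp [r1, h1, h2, hc.1]
    have e4 : R.r2 (R.N d) = 1 := by
      have : ¬ R.X (R.N (R.N d)) := by rw [X_N]; exact hc.2
      simp [r2, h1, h2, this]
    have v := R.val_cc h1 x2
    rw [R.inn_cc h1 x2, R.inn_cc x2 (by simpa using h1)] at v
    have := R.icc_le (R.a d)
    linarith

lemma g_rX {d : D} (h1 : ¬ R.X d) (h2 : R.X (R.N d)) : 14 ≤ R.val' d := by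
  have x2 : R.X (R.a d) := by rwa [← X_N]
  have e2 : R.r2 d = 0 := by simp [r2, h1]
  have := R.r1_nn (R.P d)
  have := R.r2_nn (R.N d)
  have v := R.val_rX h1 x2
  have := R.inn_nn d
  unfold val'
  by_cases hc : R.X (R.a (R.N d))
  · have := (R.es_ask h1 x2 hc).1
    have e1 : R.r1 d ≤ 1 := by unfold r1; split_ifs <;> norm_num
    linarith
  · have := R.es_le h1 x2
    have e1 : R.r1 d = 0 := by simp [r1, h1, X_N _ (R.N d), hc]
    linarith

lemma g_Xr {d : D} (h1 : R.X d) (h2 : ¬ R.X (R.N d)) : 14 ≤ R.val' d := by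
  have x2 : ¬ R.X (R.a d) := by rwa [← X_N]
  have e2 : R.r1 d = 0 := by simp [r1, h1]
  have := R.r1_nn (R.P d)
  have := R.r2_nn (R.N d)
  have v := R.val_Xr h1 x2
  have := R.inn_nn d
  unfold val'
  by_cases hc : R.X (R.P d)
  · have := (R.es_ask_m h1 x2 hc).1
    have e1 : R.r2 d ≤ 1 := by unfold r2; split_ifs <;> norm_num
    linarith
  · have : R.inn (R.a d) ≤ 3 := by
      rw [R.inn_rX x2 (by simpa using h1)]; exact R.irX_le _
    have e1 : R.r2 d = 0 := by simp [r2, hc]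
    linarith

lemma g_rr_eq {d : D} (h1 : ¬ R.X d) (h2 : ¬ R.X (R.N d)) : R.val d ≤ R.val' d := by
  have e1 : R.r1 d = 0 := by simp [r1, h2]
  have e2 : R.r2 d = 0 := by simp [r2, h1]
  have := R.r1_nn (R.P d)
  have := R.r2_nn (R.N d)
  unfold val'; linarith

lemma g_rr {d : D} (h1 : ¬ R.X d) (h2 : ¬ R.X (R.N d)) : 18 ≤ R.val' d :=
  (R.val_rr h1 (by rwa [← X_N])).trans (R.g_rr_eq h1 h2)

lemma g_rr' {d : D} (h1 : ¬ R.X d) (h2 : ¬ R.X (R.N d)) (h3 : R.X (R.P d))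
    (h4 : R.X (R.N (R.N d))) : 20 ≤ R.val' d :=
  (R.val_rr' h1 (by rwa [← X_N]) h3 (by rwa [← X_N])).symm.le.trans (R.g_rr_eq h1 h2)

lemma g_all (d : D) : 8 ≤ R.val' d := by
  by_cases h1 : R.X d <;> by_cases h2 : R.X (R.N d)
  · exact R.g_cc h1 h2
  · linarith [R.g_Xr h1 h2]
  · linarith [R.g_rX h1 h2]
  · linarith [R.g_rr h1 h2]

/-- all real triangle -/
lemma RRR_sum {d : D} (h : R.N (R.N (R.N d)) = d) (h0 : ¬ R.X d) (h1 : ¬ R.X (R.N d))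
    (h2 : ¬ R.X (R.N (R.N d))) : 56 ≤ R.val d + R.val (R.N d) + R.val (R.N (R.N d)) := by
  have key : ∀ x, ¬ R.X x → ¬ R.X (R.N x) → R.val x = 14 + R.h x + R.h (R.N x) ∧
      (¬ R.Ps x → ¬ R.Ps (R.N x) → R.col x ≠ R.col (R.N x)) ∧ (R.Ps x → ¬ R.Ps (R.N x)) := by
    intro x hx hx'
    have hx2 : ¬ R.X (R.a x) := by rwa [← X_N]
    refine ⟨?_, ?_, ?_⟩
    · unfold val
      rw [R.inn_rr hx hx2, R.inn_rr hx2 (by simpa using hx)]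
      have : R.h (R.a x) = R.h (R.N x) := by
        unfold RD.h; simp only [R.X_N, R.Ps_lab _ _ (R.lab_N x)]
      rw [this]; ring
    · rw [R.Ps_lab _ _ (R.lab_N x), R.col_lab _ _ (R.lab_N x)]
      intro a b
      exact R.col_a x hx a hx2 b
    · rw [R.Ps_lab _ _ (R.lab_N x)]; exact R.PsPs x
  obtain ⟨a1, a2, a3⟩ := key d h0 h1
  obtain ⟨b1, b2, b3⟩ := key _ h1 h2
  obtain ⟨c1, c2, c3⟩ := key _ h2 (by rwa [h])
  rw [h] at c1 c2 c3
  rw [a1, b1, c1]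
  unfold RD.h
  simp only [h0, h1, h2, if_false]
  by_cases p0 : R.Ps d <;> by_cases p1 : R.Ps (R.N d) <;> by_cases p2 : R.Ps (R.N (R.N d)) <;>
    simp only [p0, p1, p2, if_true, if_false] <;>
    first
    | exact (col_contra (a2 p0 p1) (b2 p1 p2) (c2 p2 p0).symm).elim
    | exact absurd p1 (a3 p0)
    | exact absurd p2 (b3 p1)
    | exact absurd p0 (c3 p2)
    | norm_num

lemma iter_val' {d : D} (hP : R.N (R.N (R.N d)) = d) :
    R.val' d + R.val' (R.N d) + R.val' (R.N (R.N d)) =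
    R.val d + R.val (R.N d) + R.val (R.N (R.N d)) := by
  have : R.P d = R.N (R.N d) := by conv_lhs => rw [← hP]; simp
  simp only [val', PN, this, hP]; ring

lemma sum3 {d : D} (h : R.N (R.N (R.N d)) = d) :
    56 ≤ R.val' d + R.val' (R.N d) + R.val' (R.N (R.N d)) := by
  rw [R.iter_val' h]
  have key : ∀ x, R.N (R.N (R.N x)) = x → R.Tri x ∧ R.P x = R.N (R.N x) := by
    intro x hx
    have : R.P x = R.N (R.N x) := by conv_lhs => rw [← hx]; simp
    exact ⟨this.symm, this⟩
  have k0 := key d h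
  have k1 := key (R.N d) (by rw [h])
  have k2 := key (R.N (R.N d)) (by rw [h])
  rw [h] at k1 k2
  have s0 : R.T0 d ∨ R.T1 d ∨ R.T2 d → 56 ≤ R.val d + R.val (R.N d) + R.val (R.N (R.N d)) := by
    rw [← k0.2]
    rintro (h | h | h)
    exacts [R.T0_sum h, R.T1_sum h, R.T2_sum h]
  have s1 : R.T0 (R.N d) ∨ R.T1 (R.N d) ∨ R.T2 (R.N d) →
      56 ≤ R.val d + R.val (R.N d) + R.val (R.N (R.N d)) := by
    intro hh
    have : 56 ≤ R.val (R.N d) + R.val (R.N (R.N d)) + R.val (R.P (R.N d)) := by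
      rcases hh with (h | h | h)
      exacts [R.T0_sum h, R.T1_sum h, R.T2_sum h]
    rw [PN] at this; linarith
  have s2 : R.T0 (R.N (R.N d)) ∨ R.T1 (R.N (R.N d)) ∨ R.T2 (R.N (R.N d)) →
      56 ≤ R.val d + R.val (R.N d) + R.val (R.N (R.N d)) := by
    intro hh
    have : 56 ≤ R.val (R.N (R.N d)) + R.val (R.N (R.N (R.N d))) + R.val (R.P (R.N (R.N d))) := by
      rcases hh with (h | h | h)
      exacts [R.T0_sum h, R.T1_sum h, R.T2_sum h]
    rw [PN, h] at this; linarith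
  have s3 := R.RRR_sum h
  simp only [T0, T1, T2, ← X_N, k0.1, k1.1, k2.1, k0.2, PN, h, and_true] at s0 s1 s2
  by_cases x0 : R.X d <;> by_cases x1 : R.X (R.N d) <;> by_cases x2 : R.X (R.N (R.N d)) <;>
    simp_all

lemma sum4 {d : D} (h : R.N (R.N (R.N (R.N d))) = d) :
    56 ≤ R.val' d + R.val' (R.N d) + R.val' (R.N (R.N d)) + R.val' (R.N (R.N (R.N d))) := by
  obtain ⟨e1, -⟩ := R.N4P h
  have hv : R.val' d + R.val' (R.N d) + R.val' (R.N (R.N d)) + R.val' (R.N (R.N (R.N d))) =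
      R.val d + R.val (R.N d) + R.val (R.N (R.N d)) + R.val (R.N (R.N (R.N d))) := by
    simp only [val', PN, e1, h]; ring
  have q0 := R.Q0_sum (d := d)
  have q1 := R.Q1_sum h
  have q2 := R.Q1_sum (d := R.N d) (by rw [h])
  have q3 := R.Q1_sum (d := R.N (R.N d)) (by rw [h])
  have q4 := R.Q1_sum (d := R.N (R.N (R.N d))) (by rw [h])
  have g0 := fun h1 h2 => R.g_Xr (d := d) h1 h2
  have g1 := fun h1 h2 => R.g_Xr (d := R.N d) h1 h2
  have g2 := fun h1 h2 => R.g_Xr (d := R.N (R.N d)) h1 h2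
  have g3 := fun h1 h2 => R.g_Xr (d := R.N (R.N (R.N d))) h1 h2
  have f0 := fun h1 h2 => R.g_rX (d := d) h1 h2
  have f1 := fun h1 h2 => R.g_rX (d := R.N d) h1 h2
  have f2 := fun h1 h2 => R.g_rX (d := R.N (R.N d)) h1 h2
  have f3 := fun h1 h2 => R.g_rX (d := R.N (R.N (R.N d))) h1 h2
  have a0 := fun h1 h2 => R.g_rr (d := d) h1 h2
  have a1 := fun h1 h2 => R.g_rr (d := R.N d) h1 h2
  have a2 := fun h1 h2 => R.g_rr (d := R.N (R.N d)) h1 h2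
  have a3 := fun h1 h2 => R.g_rr (d := R.N (R.N (R.N d))) h1 h2
  have b0 := fun h1 h2 => R.g_rr' (d := d) h1 h2
  have b1 := fun h1 h2 => R.g_rr' (d := R.N d) h1 h2
  have b2 := fun h1 h2 => R.g_rr' (d := R.N (R.N d)) h1 h2
  have b3 := fun h1 h2 => R.g_rr' (d := R.N (R.N (R.N d))) h1 h2
  have c0 := R.g_all d
  have c1 := R.g_all (R.N d)
  have c2 := R.g_all (R.N (R.N d))
  have c3 := R.g_all (R.N (R.N (R.N d)))
  simp only [Q0, h, PN, e1] at *
  by_cases x0 : R.X d <;> by_cases x1 : R.X (R.N d) <;> by_cases x2 : R.X (R.N (R.N d)) <;>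
    by_cases x3 : R.X (R.N (R.N (R.N d))) <;>
    simp only [x0, x1, x2, x3, not_true_eq_false, not_false_eq_true, forall_true_left,
      false_imp_iff, imp_true_iff, true_and, forall_const, and_self] at * <;> linarith

lemma sum5 {d : D} (h : R.N (R.N (R.N (R.N (R.N d)))) = d) :
    56 ≤ R.val' d + R.val' (R.N d) + R.val' (R.N (R.N d)) + R.val' (R.N (R.N (R.N d))) +
      R.val' (R.N (R.N (R.N (R.N d)))) := by
  obtain ⟨e1, -⟩ := R.N5P h
  have hv : R.val' d + R.val' (R.N d) + R.val' (R.N (R.N d)) + R.val' (R.N (R.N (R.N d))) +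
      R.val' (R.N (R.N (R.N (R.N d)))) =
      R.val d + R.val (R.N d) + R.val (R.N (R.N d)) + R.val (R.N (R.N (R.N d))) +
      R.val (R.N (R.N (R.N (R.N d)))) := by
    simp only [val', PN, e1, h]; ring
  have q0 := R.P0_sum (d := d)
  have q1 := R.P1_sum h
  have q2 := R.P1_sum (d := R.N d) (by rw [h])
  have q3 := R.P1_sum (d := R.N (R.N d)) (by rw [h])
  have q4 := R.P1_sum (d := R.N (R.N (R.N d))) (by rw [h])
  have q5 := R.P1_sum (d := R.N (R.N (R.N (R.N d)))) (by rw [h])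
  have g0 := fun h1 h2 => R.g_Xr (d := d) h1 h2
  have g1 := fun h1 h2 => R.g_Xr (d := R.N d) h1 h2
  have g2 := fun h1 h2 => R.g_Xr (d := R.N (R.N d)) h1 h2
  have g3 := fun h1 h2 => R.g_Xr (d := R.N (R.N (R.N d))) h1 h2
  have g4 := fun h1 h2 => R.g_Xr (d := R.N (R.N (R.N (R.N d)))) h1 h2
  have f0 := fun h1 h2 => R.g_rX (d := d) h1 h2
  have f1 := fun h1 h2 => R.g_rX (d := R.N d) h1 h2
  have f2 := fun h1 h2 => R.g_rX (d := R.N (R.N d)) h1 h2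
  have f3 := fun h1 h2 => R.g_rX (d := R.N (R.N (R.N d))) h1 h2
  have f4 := fun h1 h2 => R.g_rX (d := R.N (R.N (R.N (R.N d)))) h1 h2
  have a0 := fun h1 h2 => R.g_rr (d := d) h1 h2
  have a1 := fun h1 h2 => R.g_rr (d := R.N d) h1 h2
  have a2 := fun h1 h2 => R.g_rr (d := R.N (R.N d)) h1 h2
  have a3 := fun h1 h2 => R.g_rr (d := R.N (R.N (R.N d))) h1 h2
  have a4 := fun h1 h2 => R.g_rr (d := R.N (R.N (R.N (R.N d)))) h1 h2
  have c0 := R.g_all d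
  have c1 := R.g_all (R.N d)
  have c2 := R.g_all (R.N (R.N d))
  have c3 := R.g_all (R.N (R.N (R.N d)))
  have c4 := R.g_all (R.N (R.N (R.N (R.N d))))
  simp only [P0, h, PN, e1] at *
  by_cases x0 : R.X d <;> by_cases x1 : R.X (R.N d) <;> by_cases x2 : R.X (R.N (R.N d)) <;>
    by_cases x3 : R.X (R.N (R.N (R.N d))) <;> by_cases x4 : R.X (R.N (R.N (R.N (R.N d)))) <;>
    simp only [x0, x1, x2, x3, x4, not_true_eq_false, not_false_eq_true, forall_true_left,
      false_imp_iff, imp_true_iff, true_and, forall_const, and_self] at * <;> linarith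

lemma sum6_aux {d e : D} (he : R.N e = d) (h0 : ¬ R.X d) : 22 ≤ R.val' d + R.val' e ∧
    (R.X (R.N d) ∧ R.X e → 28 ≤ R.val' d + R.val' e) ∧ (¬ R.X (R.N d) → 18 ≤ R.val' d) ∧
    (¬ R.X e → 18 ≤ R.val' e) ∧ (R.X (R.N d) → 14 ≤ R.val' d) ∧ (R.X e → 14 ≤ R.val' e) := by
  have a := R.g_all e
  have b := R.g_all d
  have c := fun h1 => R.g_Xr (d := e) h1 (by rwa [he])
  have c' := fun h1 => R.g_rr (d := e) h1 (by rwa [he])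
  have c1 := R.g_rX (d := d) h0
  have c2 := R.g_rr (d := d) h0
  refine ⟨?_, ?_, c2, c', c1, c⟩
  · by_cases h : R.X e
    · linarith [c h]
    · linarith [c' h]
  · rintro ⟨h1, h2⟩; linarith [c h2, c1 h1]

lemma sum6_aux' {d e : D} (he : R.N e = d) (h0 : ¬ R.X d) : 28 ≤ R.val' d + R.val' e := by
  obtain ⟨-, -, a, b, c, e⟩ := R.sum6_aux he h0
  by_cases h1 : R.X (R.N d) <;> by_cases h2 : R.X ‹D› <;> simp_all <;> linarith

lemma sum6 {d : D} (h : R.N (R.N (R.N (R.N (R.N (R.N d))))) = d) :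
    56 ≤ R.val' d + R.val' (R.N d) + R.val' (R.N (R.N d)) + R.val' (R.N (R.N (R.N d))) +
      R.val' (R.N (R.N (R.N (R.N d)))) + R.val' (R.N (R.N (R.N (R.N (R.N d))))) := by
  have e1 : R.P d = R.N (R.N (R.N (R.N (R.N d)))) := by conv_lhs => rw [← h]; simp
  have hv : R.val' d + R.val' (R.N d) + R.val' (R.N (R.N d)) + R.val' (R.N (R.N (R.N d))) +
      R.val' (R.N (R.N (R.N (R.N d)))) + R.val' (R.N (R.N (R.N (R.N (R.N d))))) =
      R.val d + R.val (R.N d) + R.val (R.N (R.N d)) + R.val (R.N (R.N (R.N d))) +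
      R.val (R.N (R.N (R.N (R.N d)))) + R.val (R.N (R.N (R.N (R.N (R.N d))))) := by
    simp only [val', PN, e1, h]; ring
  have q0 := R.H0_sum h
  have q1 := R.sum6_aux' h
  have q2 := R.sum6_aux' (e := d) rfl
  have q3 := R.sum6_aux' (e := R.N d) rfl
  have q4 := R.sum6_aux' (e := R.N (R.N d)) rfl
  have q5 := R.sum6_aux' (e := R.N (R.N (R.N d))) rfl
  have q6 := R.sum6_aux' (e := R.N (R.N (R.N (R.N d)))) rfl
  have c0 := R.g_all d
  have c1 := R.g_all (R.N d)
  have c2 := R.g_all (R.N (R.N d))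
  have c3 := R.g_all (R.N (R.N (R.N d)))
  have c4 := R.g_all (R.N (R.N (R.N (R.N d))))
  have c5 := R.g_all (R.N (R.N (R.N (R.N (R.N d)))))
  by_cases x0 : R.X d
  swap; · linarith [q1 x0]
  by_cases x1 : R.X (R.N d)
  swap; · linarith [q2 x1]
  by_cases x2 : R.X (R.N (R.N d))
  swap; · linarith [q3 x2]
  by_cases x3 : R.X (R.N (R.N (R.N d)))
  swap; · linarith [q4 x3]
  by_cases x4 : R.X (R.N (R.N (R.N (R.N d))))
  swap; · linarith [q5 x4]
  by_cases x5 : R.X (R.N (R.N (R.N (R.N (R.N d)))))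
  swap; · linarith [q6 x5]
  rw [hv]; exact q0 x0 x1 x2 x3 x4 x5

theorem face56 [Fintype D] (ψ : Equiv.Perm D) (hψ : ∀ d, ψ d = R.N d) (d : D) :
    56 ≤ ∑ x with ψ.SameCycle d x, R.val' x := by
  rw [sum_orbit]
  have hpos := minPer_pos ψ d
  have hper := Function.iterate_minimalPeriod (f := ψ) (x := d)
  by_cases hk : 7 ≤ Function.minimalPeriod ψ d
  · calc (56 : ℤ) ≤ ∑ i ∈ Finset.range (Function.minimalPeriod ψ d), 8 := by
          simp; omega
      _ ≤ _ := Finset.sum_le_sum fun i _ => R.g_all _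
  · push Not at hk
    generalize Function.minimalPeriod ψ d = n at *
    interval_cases n
    · simp [hψ] at hper
      exact absurd hper (R.N1 d)
    · simp [hψ] at hper
      exact absurd hper (R.N2 d)
    · simp [hψ] at hper
      simpa [Finset.sum_range_succ, hψ] using R.sum3 hper
    · simp [hψ] at hper
      simpa [Finset.sum_range_succ, hψ] using R.sum4 hper
    · simp [hψ] at hper
      simpa [Finset.sum_range_succ, hψ] using R.sum5 hper
    · simp [hψ] at hper
      simpa [Finset.sum_range_succ, hψ] using R.sum6 hper

end RD
end BCL


namespace BCL
namespace RD
open scoped Classical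
variable {D L E : Type} (R : RD D L E)

/-! one crossing per edge -/
noncomputable def inn1 (d : D) : ℤ :=
  if (¬ R.X d ∧ R.X (R.a d) ∧ R.T2 (R.P d)) ∨ (R.X d ∧ ¬ R.X (R.a d) ∧ R.T2 (R.N d)) then 1 else 0
noncomputable def h1 (d : D) : ℤ := if R.X d then 0 else 1
noncomputable def val1 (d : D) : ℤ := 6 + R.h1 d + R.h1 (R.a d) + R.inn1 d - R.inn1 (R.a d)

lemma inn1_nn (d : D) : 0 ≤ R.inn1 d := by unfold inn1; split_ifs <;> norm_num
lemma inn1_le (d : D) : R.inn1 d ≤ 1 := by unfold inn1; split_ifs <;> norm_num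

lemma val1_ge (hc : ∀ d, R.X d → ¬ R.X (R.a d)) (d : D) : 6 ≤ R.val1 d := by
  have a := R.inn1_nn d
  have b := R.inn1_le (R.a d)
  have c := hc d
  unfold val1 h1
  split_ifs <;> first | linarith | (exfalso; tauto)

lemma T2_sum1 {d : D} (h : R.T2 d) : 24 ≤ R.val1 d + R.val1 (R.N d) + R.val1 (R.P d) := by
  have hh := h
  obtain ⟨x1, x2, x3, x4⟩ := h
  obtain ⟨g1, -, g3, g4⟩ := R.T2_geo hh
  have y1 : R.X (R.a (R.N d)) := by rw [g1]; simpa using x3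
  have y2 : ¬ R.X (R.N d) := by rwa [X_N]
  have a1 : R.inn1 d = 0 := by simp [inn1, x1, x2]
  have a2 : R.inn1 (R.a d) = 0 := by simp [inn1, x1, x2, R.aa]
  have b1 : R.inn1 (R.N d) = 1 := by simp [inn1, y1, y2, hh]
  have c1 : R.inn1 (R.P d) = 1 := by simp [inn1, x3, g3, hh]
  have b2 : R.inn1 (R.a (R.N d)) = 0 := by
    have : ¬ R.T2 (R.N (R.a (R.N d))) := by
      intro k
      rw [g1] at k
      exact R.T2_T2 (q := R.P d) (by simpa using hh) k
    simp [inn1, y1, this]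
  have c2 : R.inn1 (R.a (R.P d)) = 0 := by
    have : ¬ R.T2 (R.P (R.a (R.P d))) := by
      intro k
      have e : R.m.s (R.a (R.N d)) = R.P d := by rw [m_s, g1, ts]
      refine R.m.T2_T2 (q := R.a (R.N d)) ?_ ?_
      · rw [T2_m, m_N, R.aa, R.aa, PN]; exact hh
      · rw [e, T2_m, m_N, R.aa]; exact k
    have k3 : R.X (R.a (R.a (R.P d))) := by rwa [R.aa]
    simp [inn1, g3, this]
  unfold val1
  rw [a1, a2, b1, b2, c1, c2]
  simp only [h1, x1, x2, x3, y1, y2, g3, if_true, if_false]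
  norm_num

lemma no_RRR (hp : ∀ d, ¬ R.Ps d) {d : D} (h : R.N (R.N (R.N d)) = d) (h0 : ¬ R.X d)
    (h1 : ¬ R.X (R.N d)) (h2 : ¬ R.X (R.N (R.N d))) : False := by
  have key : ∀ x, ¬ R.X x → ¬ R.X (R.N x) → R.col x ≠ R.col (R.N x) := by
    intro x hx hx'
    have hx2 : ¬ R.X (R.a x) := by rwa [← X_N]
    rw [R.col_lab _ _ (R.lab_N x)]
    exact R.col_a x hx (hp _) hx2 (hp _)
  have := key _ h2 (by rwa [h])
  rw [h] at this
  exact col_contra (key d h0 h1) (key _ h1 h2) this.symm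

lemma sum3_1 (hp : ∀ d, ¬ R.Ps d) (hc : ∀ d, R.X d → ¬ R.X (R.a d)) {d : D}
    (h : R.N (R.N (R.N d)) = d) :
    24 ≤ R.val1 d + R.val1 (R.N d) + R.val1 (R.N (R.N d)) := by
  have key : ∀ x, R.N (R.N (R.N x)) = x → R.Tri x ∧ R.P x = R.N (R.N x) := by
    intro x hx
    have : R.P x = R.N (R.N x) := by conv_lhs => rw [← hx]; simp
    exact ⟨this.symm, this⟩
  have k0 := key d h
  have k1 := key (R.N d) (by rw [h])
  have k2 := key (R.N (R.N d)) (by rw [h])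
  rw [h] at k1 k2
  have s0 : R.T2 d → 24 ≤ R.val1 d + R.val1 (R.N d) + R.val1 (R.N (R.N d)) := by
    rw [← k0.2]; exact fun h => R.T2_sum1 h
  have s1 : R.T2 (R.N d) → 24 ≤ R.val1 d + R.val1 (R.N d) + R.val1 (R.N (R.N d)) := by
    intro hh
    have := R.T2_sum1 hh
    rw [PN] at this; linarith
  have s2 : R.T2 (R.N (R.N d)) → 24 ≤ R.val1 d + R.val1 (R.N d) + R.val1 (R.N (R.N d)) := by
    intro hh
    have := R.T2_sum1 hh
    rw [PN, h] at this; linarith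
  have s3 := R.no_RRR hp h
  have c0 := hc d
  have c1 := hc (R.N d)
  have c2 := hc (R.N (R.N d))
  simp only [T2, ← X_N, k0.1, k1.1, k2.1, k0.2, PN, h, and_true] at s0 s1 s2 c0 c1 c2
  by_cases x0 : R.X d <;> by_cases x1 : R.X (R.N d) <;> by_cases x2 : R.X (R.N (R.N d)) <;>
    simp_all

theorem face24 (hp : ∀ d, ¬ R.Ps d) (hc : ∀ d, R.X d → ¬ R.X (R.a d)) [Fintype D]
    (ψ : Equiv.Perm D) (hψ : ∀ d, ψ d = R.N d) (d : D) :
    24 ≤ ∑ x with ψ.SameCycle d x, R.val1 x := by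
  rw [sum_orbit]
  have hpos := minPer_pos ψ d
  have hper := Function.iterate_minimalPeriod (f := ψ) (x := d)
  by_cases hk : 4 ≤ Function.minimalPeriod ψ d
  · calc (24 : ℤ) ≤ ∑ i ∈ Finset.range (Function.minimalPeriod ψ d), 6 := by
          simp; omega
      _ ≤ _ := Finset.sum_le_sum fun i _ => R.val1_ge hc _
  · push Not at hk
    generalize Function.minimalPeriod ψ d = n at *
    interval_cases n
    · simp [hψ] at hper
      exact absurd hper (R.N1 d)
    · simp [hψ] at hper
      exact absurd hper (R.N2 d)
    · simp [hψ] at hper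
      simpa [Finset.sum_range_succ, hψ] using R.sum3_1 hp hc hper

theorem face4 (hp : ∀ d, ¬ R.Ps d) (hc : ∀ d, ¬ R.X d) [Fintype D]
    (ψ : Equiv.Perm D) (hψ : ∀ d, ψ d = R.N d) (d : D) :
    4 ≤ ∑ x with ψ.SameCycle d x, (1 : ℤ) := by
  rw [sum_orbit]
  have hpos := minPer_pos ψ d
  have hper := Function.iterate_minimalPeriod (f := ψ) (x := d)
  by_cases hk : 4 ≤ Function.minimalPeriod ψ d
  · simpa using hk
  · push Not at hk
    generalize Function.minimalPeriod ψ d = n at *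
    interval_cases n
    · simp [hψ] at hper
      exact absurd hper (R.N1 d)
    · simp [hψ] at hper
      exact absurd hper (R.N2 d)
    · simp [hψ] at hper
      exact (R.no_RRR hp hper (hc _) (hc _) (hc _)).elim

/-! counting -/

lemma sum_a [Fintype D] (f : D → ℤ) : ∑ d, f (R.a d) = ∑ d, f d :=
  Equiv.sum_comp (⟨R.a, R.a, R.aa, R.aa⟩ : Equiv.Perm D) f
lemma sum_N [Fintype D] (f : D → ℤ) : ∑ d, f (R.N d) = ∑ d, f d :=
  Equiv.sum_comp (⟨R.N, R.P, R.PN, R.NP⟩ : Equiv.Perm D) f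
lemma sum_P [Fintype D] (f : D → ℤ) : ∑ d, f (R.P d) = ∑ d, f d :=
  Equiv.sum_comp (⟨R.P, R.N, R.NP, R.PN⟩ : Equiv.Perm D) f

lemma sum_val' [Fintype D] : ∑ d, R.val' d = 14 * Fintype.card D + 2 * ∑ d, R.h d := by
  simp only [val', val, Finset.sum_add_distrib, Finset.sum_sub_distrib]
  rw [R.sum_a R.h, R.sum_a R.inn, R.sum_P R.r1, R.sum_N R.r2]
  simp; ring
lemma sum_val1 [Fintype D] : ∑ d, R.val1 d = 6 * Fintype.card D + 2 * ∑ d, R.h1 d := by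
  simp only [val1, Finset.sum_add_distrib, Finset.sum_sub_distrib]
  rw [R.sum_a R.h1, R.sum_a R.inn1]
  simp; ring

end RD

lemma card_lab {D L : Type} [Finite D] (lab : D → L) (S : Set D) (k : ℕ)
    (h : ∀ d ∈ S, k ≤ {d' | d' ∈ S ∧ lab d' = lab d}.ncard) :
    k * (lab '' S).ncard ≤ S.ncard := by
  classical
  have : Fintype D := Fintype.ofFinite D
  have e1 : (lab '' S).ncard = (S.toFinset.image lab).card := by
    rw [← Set.ncard_coe_finset]; simp
  have e2 : S.ncard = S.toFinset.card := by rw [← Set.ncard_coe_finset]; simp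
  rw [e1, e2, Finset.card_eq_sum_card_image lab S.toFinset, mul_comm, ← smul_eq_mul]
  refine Finset.card_nsmul_le_sum _ _ _ ?_
  intro x hx
  simp only [Finset.mem_image, Set.mem_toFinset] at hx
  obtain ⟨d, hd, rfl⟩ := hx
  refine (h d hd).trans (le_of_eq ?_)
  rw [← Set.ncard_coe_finset]; congr 1; ext; simp

namespace RD
variable {D L E : Type} (R : RD D L E)
open scoped Classical

lemma card3 [Fintype D] : Fintype.card D = {d | ¬ R.X d ∧ ¬ R.Ps d}.ncard + {d | R.Ps d}.ncard +
    {d | R.X d}.ncard := by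
  have e : ∀ p : D → Prop, {d | p d}.ncard = ∑ d, if p d then 1 else 0 := by
    intro p
    rw [← Finset.card_filter, ← Set.ncard_coe_finset]; congr 1; ext; simp
  rw [e, e, e, ← Finset.sum_add_distrib, ← Finset.sum_add_distrib, Fintype.card_eq_sum_ones]
  refine Finset.sum_congr rfl fun d _ => ?_
  have := R.XnPs d
  by_cases h1 : R.X d <;> by_cases h2 : R.Ps d <;> simp_all

lemma sum_h [Fintype D] : ∑ d, R.h d = 3 * ({d | ¬ R.X d ∧ ¬ R.Ps d}.ncard : ℤ) +
    {d | R.Ps d}.ncard := by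
  have e : ∀ p : D → Prop, ({d | p d}.ncard : ℤ) = ∑ d, if p d then 1 else 0 := by
    intro p
    rw [Finset.sum_boole, ← Set.ncard_coe_finset]; congr 2; ext; simp
  rw [e, e, Finset.mul_sum, ← Finset.sum_add_distrib]
  refine Finset.sum_congr rfl fun d _ => ?_
  have := R.XnPs d
  unfold RD.h
  by_cases h1 : R.X d <;> by_cases h2 : R.Ps d <;> simp_all

lemma sum_h1 [Fintype D] (hp : ∀ d, ¬ R.Ps d) :
    ∑ d, R.h1 d = ({d | ¬ R.X d ∧ ¬ R.Ps d}.ncard : ℤ) := by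
  have e : ∀ p : D → Prop, ({d | p d}.ncard : ℤ) = ∑ d, if p d then 1 else 0 := by
    intro p
    rw [Finset.sum_boole, ← Set.ncard_coe_finset]; congr 2; ext; simp
  rw [e]
  refine Finset.sum_congr rfl fun d _ => ?_
  unfold RD.h1
  by_cases h1 : R.X d <;> simp_all

lemma labs [Finite D] : (Set.range R.lab).ncard ≤ (R.lab '' {d | ¬ R.X d ∧ ¬ R.Ps d}).ncard +
    (R.lab '' {d | R.Ps d}).ncard + (R.lab '' {d | R.X d}).ncard := by
  have : Set.range R.lab ⊆ (R.lab '' {d | ¬ R.X d ∧ ¬ R.Ps d}) ∪ (R.lab '' {d | R.Ps d}) ∪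
      (R.lab '' {d | R.X d}) := by
    rintro _ ⟨d, rfl⟩
    by_cases h1 : R.X d
    · exact Or.inr ⟨d, h1, rfl⟩
    · by_cases h2 : R.Ps d
      · exact Or.inl (Or.inr ⟨d, h2, rfl⟩)
      · exact Or.inl (Or.inl ⟨d, ⟨h1, h2⟩, rfl⟩)
  refine (Set.ncard_le_ncard this (Set.toFinite _)).trans ?_
  refine (Set.ncard_union_le _ _).trans ?_
  gcongr
  exact Set.ncard_union_le _ _

/-- main counting conclusions -/
theorem count [Finite D] (M : PMap D L) (hs : M.σ = R.s) (ha : M.α = R.a) (hl : M.lab = R.lab)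
    (h4 : ∀ d, R.X d → 4 ≤ {d' | R.lab d' = R.lab d}.ncard)
    (h6 : ∀ d, R.Ps d → 6 ≤ {d' | R.lab d' = R.lab d}.ncard) :
    {d | ¬ R.X d ∧ ¬ R.Ps d}.ncard ≤ 7 * (R.lab '' {d | ¬ R.X d ∧ ¬ R.Ps d}).ncard ∧
    ((∀ d, ¬ R.Ps d) → (∀ d, R.X d → ¬ R.X (R.a d)) →
      {d | ¬ R.X d ∧ ¬ R.Ps d}.ncard ≤ 6 * (R.lab '' {d | ¬ R.X d ∧ ¬ R.Ps d}).ncard) ∧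
    ((∀ d, ¬ R.Ps d) → (∀ d, ¬ R.X d) →
      {d | ¬ R.X d ∧ ¬ R.Ps d}.ncard ≤ 4 * (R.lab '' {d | ¬ R.X d ∧ ¬ R.Ps d}).ncard) := by
  have : Fintype D := Fintype.ofFinite D
  rcases isEmpty_or_nonempty D with hD | hD
  · have : {d | ¬ R.X d ∧ ¬ R.Ps d} = ∅ := Set.eq_empty_of_isEmpty _
    rw [this]; simp
  have hψ : ∀ d, M.ψ d = R.N d := by
    intro d
    show M.σ.symm (M.α d) = _
    rw [hs, ha]; rfl
  have k4 : 4 * (R.lab '' {d | R.X d}).ncard ≤ {d | R.X d}.ncard := by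
    refine card_lab _ _ _ fun d hd => (h4 d hd).trans ?_
    refine Set.ncard_le_ncard (fun x hx => ⟨?_, hx⟩) (Set.toFinite _)
    exact (R.X_lab _ _ hx).2 hd
  have k6 : 6 * (R.lab '' {d | R.Ps d}).ncard ≤ {d | R.Ps d}.ncard := by
    refine card_lab _ _ _ fun d hd => (h6 d hd).trans ?_
    refine Set.ncard_le_ncard (fun x hx => ⟨?_, hx⟩) (Set.toFinite _)
    exact (R.Ps_lab _ _ hx).2 hd
  have eu := M.euler
  rw [hl] at eu
  have c3 := R.card3
  rw [Nat.card_eq_fintype_card] at eu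
  have lb := R.labs
  refine ⟨?_, ?_, ?_⟩
  · have f := M.face_sum R.val' 56 (R.face56 M.ψ hψ)
    rw [R.sum_val', R.sum_h] at f
    omega
  · intro hp hc
    have f := M.face_sum R.val1 24 (R.face24 hp hc M.ψ hψ)
    rw [R.sum_val1, R.sum_h1 hp] at f
    omega
  · intro hp hc
    have f := M.face_sum (fun _ => (1:ℤ)) 4 (R.face4 hp hc M.ψ hψ)
    simp only [Finset.sum_const, Finset.card_univ, nsmul_eq_mul, mul_one] at f
    omega

end RD
end BCL


namespace BCL
open scoped Classical in
/-- resolve a touching point -/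
theorem PMap.resolve {D L : Type} (M : PMap D L) (p : L) (o : D → D)
    (hlab : ∀ q, M.lab q = p → M.lab (o q) = p) (oo : ∀ q, M.lab q = p → o (o q) = q)
    (one : ∀ q, M.lab q = p → o q ≠ q) (hne : ∀ q, M.lab q = p → M.lab (M.α q) ≠ p)
    (q0 q1 q2 q3 : D) (h0 : M.lab q0 = p) (e1 : M.σ q0 = q1) (e2 : M.σ q1 = q2) (e3 : M.σ q2 = q3)
    (e0 : M.σ q3 = q0) (n1 : q0 ≠ q1) (n2 : q0 ≠ q2) (n3 : q0 ≠ q3) (n4 : q1 ≠ q2) (n5 : q1 ≠ q3)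
    (n6 : q2 ≠ q3) (hex : ∀ q, M.lab q = p → q = q0 ∨ q = q1 ∨ q = q2 ∨ q = q3)
    (o0 : o q0 = q1) (o2 : o q2 = q3) :
    ∃ M' : PMap {d // M.lab d ≠ p} L, (∀ d, M'.lab d = M.lab d.1) ∧ (∀ d, (M'.σ d).1 = M.σ d.1) ∧
      ∀ d, (M'.α d).1 = if M.lab (M.α d.1) = p then M.α (o (M.α d.1)) else M.α d.1 := by
  have l1 : M.lab q1 = p := by rw [← e1, M.labσ, h0]
  have l2 : M.lab q2 = p := by rw [← e2, M.labσ, l1]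
  have l3 : M.lab q3 = p := by rw [← e3, M.labσ, l2]
  have o1 : o q1 = q0 := by rw [← o0, oo _ h0]
  have o3 : o q3 = q2 := by rw [← o2, oo _ l2]
  let al : {d // M.lab d ≠ p} → {d // M.lab d ≠ p} := fun d =>
    if h : M.lab (M.α d.1) = p then ⟨M.α (o (M.α d.1)), hne _ (hlab _ h)⟩ else ⟨M.α d.1, h⟩
  have al1 : ∀ d, M.lab (M.α d.1) = p → (al d).1 = M.α (o (M.α d.1)) := fun d h => by simp [al, h]
  have al2 : ∀ d, M.lab (M.α d.1) ≠ p → (al d).1 = M.α d.1 := fun d h => by simp [al, h]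
  refine ⟨{
    σ := M.σ.subtypePerm (fun d => by simp [M.labσ])
    α := al
    lab := fun d => M.lab d.1
    αα := ?_
    αne := ?_
    labσ := fun d => by simp [M.labσ]
    trans := ?_
    H := ?_ }, fun d => rfl, fun d => rfl, ?_⟩
  · intro d
    apply Subtype.ext
    by_cases h : M.lab (M.α d.1) = p
    · have k := al1 d h
      have : M.lab (M.α (al d).1) = p := by rw [k, M.αα]; exact hlab _ h
      rw [al1 _ this, k, M.αα, oo _ h, M.αα]
    · have k := al2 d h
      rw [al2, k, M.αα]
      rw [k, M.αα]; exact d.2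
  · intro d hd
    by_cases h : M.lab (M.α d.1) = p
    · have k := al1 d h
      rw [hd] at k
      have := congrArg M.α k
      rw [M.αα] at this
      exact one _ h this.symm
    · have k := al2 d h
      rw [hd] at k
      exact M.αne _ k.symm
  · intro f hf d d' hl hd
    have := M.trans (fun x => ∀ h : M.lab x ≠ p, f ⟨x, h⟩) ?_ d.1 d'.1 hl (fun _ => hd)
    · exact this d'.2
    · intro x hx h
      have h' : M.lab x ≠ p := by rwa [M.labσ] at h
      exact hf _ (hx h')
  · intro z' c' hz hc
    let z : D → ZMod 2 := fun d => if h : M.lab d ≠ p then z' ⟨d, h⟩ else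
      if h' : M.lab (M.α d) ≠ p then z' ⟨M.α d, h'⟩ else 0
    have z1 : ∀ d (h : M.lab d ≠ p), z d = z' ⟨d, h⟩ := fun d h => by simp [z, h]
    have z2 : ∀ d (h : M.lab d = p), z d = z' ⟨M.α d, hne d h⟩ := fun d h => by
      simp [z, h, hne d h]
    let c : D → ZMod 2 := fun d => if h : M.lab d ≠ p then c' ⟨d, h⟩ else
      if d = q0 then 0 else if d = q1 then z q0 else if d = q2 then z q0 + z q2 else z q0
    have hza : ∀ d, z (M.α d) = z d := by
      intro d
      by_cases h : M.lab d = p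
      · rw [z2 d h, z1 _ (hne d h)]
      · by_cases h' : M.lab (M.α d) = p
        · rw [z1 d h, z2 _ h']; congr 2; rw [M.αα]
        · rw [z1 d h, z1 _ h']
          have := hz ⟨d, h⟩
          rw [← this]; congr 1; apply Subtype.ext; rw [al2 _ h']
    have hzo : ∀ q, M.lab q = p → z (o q) = z q := by
      intro q h
      rw [z2 q h, z2 _ (hlab q h), ← hz ⟨M.α q, hne q h⟩]
      congr 1; apply Subtype.ext
      rw [al1 _ (by simpa [M.αα] using h)]
      simp [M.αα]
    have hz1 : z q1 = z q0 := by rw [← o0]; exact hzo _ h0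
    have hz3 : z q3 = z q2 := by rw [← o2]; exact hzo _ l2
    have hcs : ∀ d, z (M.σ d) = c (M.σ d) + c d := by
      intro d
      by_cases h : M.lab d = p
      · have c0 : c q0 = 0 := by simp [c, h0]
        have c1 : c q1 = z q0 := by simp [c, l1, n1.symm]
        have c2 : c q2 = z q0 + z q2 := by simp [c, l2, n2.symm, n4.symm]
        have c3 : c q3 = z q0 := by simp [c, l3, n3.symm, n5.symm, n6.symm]
        rcases hex d h with rfl | rfl | rfl | rfl
        · rw [e1, c0, c1, hz1]; simp
        · rw [e2, c1, c2]; generalize z q0 = x; generalize z q2 = y; revert x y; decide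
        · rw [e3, c2, c3, hz3]; generalize z q0 = x; generalize z d = y; revert x y; decide
        · rw [e0, c3, c0]; simp
      · have h' : M.lab (M.σ d) ≠ p := by rwa [M.labσ]
        rw [z1 _ h']
        have : c d = c' ⟨d, h⟩ := by simp [c, h]
        rw [this]
        have : c (M.σ d) = c' ⟨M.σ d, h'⟩ := by simp [c, h']
        rw [this]
        exact hc ⟨d, h⟩
    obtain ⟨w, w1, w2⟩ := M.H z c hza hcs
    have key1 : ∀ q, M.lab q = p → o q = M.σ q → w (M.α (o q)) = w q := by
      intro q h e; rw [e, w1]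
    have key2 : ∀ q, M.lab q = p → q = M.σ (o q) → w (M.α (o q)) = w q := by
      intro q h e
      have a := w1 (o q)
      rw [← e] at a
      have b := w2 (o q)
      have c := w2 q
      have d := hzo q h
      rw [d, ← c, ← a] at b
      revert b
      generalize w (M.α q) = x; generalize w q = y; generalize w (M.α (o q)) = v
      revert x y v; decide
    have key : ∀ q, M.lab q = p → w (M.α (o q)) = w q := by
      intro q h
      rcases hex q h with rfl | rfl | rfl | rfl
      · exact key1 _ h (by rw [o0, e1])
      · exact key2 _ h (by rw [o1, e1])
      · exact key1 _ h (by rw [o2, e3])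
      · exact key2 _ h (by rw [o3, e3])
    refine ⟨fun d => w d.1, ?_, ?_⟩
    · intro d
      show w (al _).1 = _
      by_cases h : M.lab (M.α (M.σ d.1)) = p
      · rw [al1 _ (by simpa using h)]
        simp only [Equiv.Perm.subtypePerm_apply]
        rw [key _ h, w1]
      · rw [al2 _ (by simpa using h)]
        simp only [Equiv.Perm.subtypePerm_apply]
        rw [w1]
    · intro d
      show w d.1 + w (al d).1 = _
      rw [← z1 d.1 d.2, ← w2 d.1]
      congr 1
      by_cases h : M.lab (M.α d.1) = p
      · rw [al1 _ h, key _ h]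
      · rw [al2 _ h]
  · intro d
    show (al d).1 = _
    split_ifs with h
    · exact al1 _ h
    · exact al2 _ h
end BCL


namespace BCL

/-- Crossing data of a drawing with few crossings per edge (touchings allowed). -/
structure CD (D L E : Type) where
  M : PMap D L
  X : L → Prop
  Ps : L → Prop
  col : L → Bool
  ed : D → E
  par : E → L → ℝ
  opp : D → D
  ed_α : ∀ d, ed (M.α d) = ed d
  par_ne : ∀ d, par (ed d) (M.lab d) ≠ par (ed d) (M.lab (M.α d))
  fw_uniq : ∀ d d', ed d = ed d' → M.lab d = M.lab d' →
    (par (ed d) (M.lab d) < par (ed d) (M.lab (M.α d)) ↔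
      par (ed d') (M.lab d') < par (ed d') (M.lab (M.α d'))) → d = d'
  opp_lab : ∀ d, X (M.lab d) → M.lab (opp d) = M.lab d
  opp_ed : ∀ d, X (M.lab d) → ed (opp d) = ed d
  opp_ne : ∀ d, X (M.lab d) → opp d ≠ d
  Xtwo : ∀ d, X (M.lab d) → ∃ d', M.lab d' = M.lab d ∧ ed d' ≠ ed d ∧
    ∀ d'', M.lab d'' = M.lab d → ed d'' = ed d ∨ ed d'' = ed d'
  share : ∀ d e d' e', ed d = ed e → ed d' = ed e' → M.lab d = M.lab d' → M.lab e = M.lab e' →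
    M.lab d ≠ M.lab e → ed d = ed d'
  no3 : ∀ d e f, X (M.lab d) → X (M.lab e) → X (M.lab f) → ed d = ed e → ed d = ed f →
    M.lab d ≠ M.lab e → M.lab d ≠ M.lab f → M.lab e ≠ M.lab f → False
  XPs : ∀ d d', ed d = ed d' → X (M.lab d) → ¬ Ps (M.lab d')
  PsPs : ∀ d d', ed d = ed d' → Ps (M.lab d) → Ps (M.lab d') → M.lab d = M.lab d'
  Ps6 : ∀ d, Ps (M.lab d) → 6 ≤ {d' | M.lab d' = M.lab d}.ncard
  real_uniq : ∀ d d', ¬ X (M.lab d) → ¬ Ps (M.lab d) → ed d = ed d' → M.lab d = M.lab d' → d = d'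
  real_col : ∀ d d', ¬ X (M.lab d) → ¬ Ps (M.lab d) → ¬ X (M.lab d') → ¬ Ps (M.lab d') →
    ed d = ed d' → d ≠ d' → col (M.lab d) ≠ col (M.lab d')
  deg : ∀ d, ¬ X (M.lab d) → M.σ d ≠ d

namespace CD
variable {D L E : Type} (C : CD D L E)

abbrev lab (d : D) : L := C.M.lab d
abbrev α (d : D) : D := C.M.α d
/-- forward dart -/
def fw (d : D) : Prop := C.par (C.ed d) (C.lab d) < C.par (C.ed d) (C.lab (C.α d))

lemma uniq {d d' : D} (h1 : C.ed d = C.ed d') (h2 : C.lab d = C.lab d') (h3 : C.fw d ↔ C.fw d') :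
    d = d' := C.fw_uniq d d' h1 h2 h3

lemma fw_α (d : D) : C.fw (C.α d) ↔ ¬ C.fw d := by
  have := C.par_ne d
  simp only [fw, α, lab, C.ed_α, C.M.αα]
  constructor
  · intro h; exact h.not_gt
  · intro h; exact lt_of_le_of_ne (not_lt.1 h) this.symm

lemma fw_opp {d : D} (h : C.X (C.lab d)) : C.fw (C.opp d) ↔ ¬ C.fw d := by
  by_contra hh
  have : C.fw (C.opp d) ↔ C.fw d := by tauto
  exact C.opp_ne d h (C.uniq (C.opp_ed d h) (C.opp_lab d h) this)

lemma of_same {d d' : D} (h : C.X (C.lab d)) (h1 : C.ed d' = C.ed d) (h2 : C.lab d' = C.lab d) :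
    d' = d ∨ d' = C.opp d := by
  by_cases k : C.fw d' ↔ C.fw d
  · exact Or.inl (C.uniq h1 h2 k)
  · refine Or.inr (C.uniq (h1.trans (C.opp_ed d h).symm) (h2.trans (C.opp_lab d h).symm) ?_)
    rw [C.fw_opp h]; tauto

lemma opp_opp {d : D} (h : C.X (C.lab d)) : C.opp (C.opp d) = d := by
  have h' : C.X (C.lab (C.opp d)) := by rw [lab, C.opp_lab d h]; exact h
  refine C.uniq ((C.opp_ed _ h').trans (C.opp_ed _ h)) ((C.opp_lab _ h').trans (C.opp_lab _ h)) ?_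
  rw [C.fw_opp h', C.fw_opp h]; tauto

lemma labne (d : D) : C.lab (C.α d) ≠ C.lab d := by
  intro h; exact C.par_ne d (by rw [show C.M.lab (C.M.α d) = _ from h])

lemma four {d : D} (h : C.X (C.lab d)) : {d' | C.lab d' = C.lab d}.ncard = 4 := by
  obtain ⟨d', h1, h2, h3⟩ := C.Xtwo d h
  have h' : C.X (C.lab d') := by rw [lab, h1]; exact h
  have : {x | C.lab x = C.lab d} = {d, C.opp d, d', C.opp d'} := by
    ext x
    simp only [Set.mem_ofPred_eq, Set.mem_insert_iff, Set.mem_singleton_iff]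
    constructor
    · intro hx
      rcases h3 x hx with k | k
      · rcases C.of_same h k hx with k | k <;> simp [k]
      · rcases C.of_same h' k (hx.trans h1.symm) with k | k <;> simp [k]
    · rintro (rfl | rfl | rfl | rfl)
      · rfl
      · exact C.opp_lab _ h
      · exact h1
      · exact (C.opp_lab _ h').trans h1
  rw [this]
  have a1 := C.opp_ne d h
  have a2 := C.opp_ne d' h'
  have a3 := C.opp_ed d h
  have a4 := C.opp_ed d' h'
  rw [Set.ncard_insert_of_notMem, Set.ncard_insert_of_notMem, Set.ncard_pair a2.symm]
  · simp only [Set.mem_insert_iff, Set.mem_singleton_iff, not_or]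
    refine ⟨fun e => h2 ?_, fun e => h2 ?_⟩
    · rw [← a3, e]
    · rw [← a3, e, a4]
  · simp only [Set.mem_insert_iff, Set.mem_singleton_iff, not_or]
    refine ⟨a1.symm, fun e => h2 ?_, fun e => h2 ?_⟩
    · rw [e]
    · rw [← a4, ← e]

lemma cyc [Finite D] {d : D} (h : C.X (C.lab d)) : Function.minimalPeriod C.M.σ d = 4 := by
  have : Fintype D := Fintype.ofFinite D
  rw [← C.four h]
  have : {d' | C.lab d' = C.lab d} = (fun i => C.M.σ^[i] d) '' (Set.Iio (Function.minimalPeriod C.M.σ d)) := by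
    ext x
    constructor
    · intro hx
      refine C.M.trans (fun x => x ∈ (fun i => C.M.σ^[i] d) '' (Set.Iio (Function.minimalPeriod C.M.σ d)))
        ?_ d x hx.symm ⟨0, minPer_pos _ _, rfl⟩
      rintro _ ⟨i, hi, rfl⟩
      refine ⟨(i+1) % Function.minimalPeriod C.M.σ d, Nat.mod_lt _ (minPer_pos _ _), ?_⟩
      show C.M.σ^[_] d = _
      rw [Function.iterate_mod_minimalPeriod_eq, Function.iterate_succ_apply']
    · rintro ⟨i, -, rfl⟩
      show C.M.lab (C.M.σ^[i] d) = _
      induction i with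
      | zero => rfl
      | succ n ih => rw [Function.iterate_succ_apply', C.M.labσ, ih]
  rw [this, Set.InjOn.ncard_image Function.iterate_injOn_Iio_minimalPeriod]
  simp

lemma cyc' [Finite D] {d : D} (h : C.X (C.lab d)) : C.M.σ (C.M.σ (C.M.σ (C.M.σ d))) = d ∧
    C.M.σ d ≠ d ∧ C.M.σ (C.M.σ d) ≠ d ∧ C.M.σ (C.M.σ (C.M.σ d)) ≠ d ∧
    ∀ x, C.lab x = C.lab d → x = d ∨ x = C.M.σ d ∨ x = C.M.σ (C.M.σ d) ∨
      x = C.M.σ (C.M.σ (C.M.σ d)) := by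
  have hm := C.cyc h
  have h4 := Function.iterate_minimalPeriod (f := C.M.σ) (x := d)
  rw [hm] at h4
  have nn : ∀ i, i < 4 → i ≠ 0 → C.M.σ^[i] d ≠ d := by
    intro i hi hi0 k
    have := Function.IsPeriodicPt.minimalPeriod_le (Nat.pos_of_ne_zero hi0) k
    omega
  have h4' : C.M.σ (C.M.σ (C.M.σ (C.M.σ d))) = d := h4
  refine ⟨h4, nn 1 (by norm_num) (by norm_num), nn 2 (by norm_num) (by norm_num),
    nn 3 (by norm_num) (by norm_num), ?_⟩
  intro x hx
  refine C.M.trans (fun x => x = d ∨ x = C.M.σ d ∨ x = C.M.σ (C.M.σ d) ∨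
      x = C.M.σ (C.M.σ (C.M.σ d))) ?_ d x hx.symm (Or.inl rfl)
  rintro x (rfl | rfl | rfl | rfl) <;> simp [h4']

/-- a point is either crossing or touching -/
lemma touch [Finite D] (hn : ¬ ∀ d, C.X (C.lab d) → C.opp d = C.M.σ (C.M.σ d)) :
    ∃ q, C.X (C.lab q) ∧ C.opp q = C.M.σ q ∧
      C.opp (C.M.σ (C.M.σ q)) = C.M.σ (C.M.σ (C.M.σ q)) := by
  push Not at hn
  obtain ⟨d, hd, hne⟩ := hn
  have main : ∀ q, C.X (C.lab q) → C.opp q = C.M.σ q →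
      C.opp (C.M.σ (C.M.σ q)) = C.M.σ (C.M.σ (C.M.σ q)) := by
    intro q hq ho
    obtain ⟨c4, c1, c2, c3, ex⟩ := C.cyc' hq
    have l2 : C.lab (C.M.σ (C.M.σ q)) = C.lab q := by simp [lab, C.M.labσ]
    have x2 : C.X (C.lab (C.M.σ (C.M.σ q))) := by rwa [l2]
    rcases ex _ ((C.opp_lab _ x2).trans l2) with k | k | k | k
    · have := C.opp_opp x2
      rw [k, ho] at this
      exact absurd (C.M.σ.injective this) c1.symm
    · have := C.opp_opp x2
      rw [k, ← ho, C.opp_opp hq, ho] at this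
      exact absurd this.symm c2
    · exact absurd k (C.opp_ne _ x2)
    · exact k
  obtain ⟨c4, c1, c2, c3, ex⟩ := C.cyc' hd
  rcases ex _ (C.opp_lab _ hd) with k | k | k | k
  · exact absurd k (C.opp_ne _ hd)
  · exact ⟨d, hd, k, main d hd k⟩
  · exact absurd k hne
  · have l : C.lab (C.M.σ (C.M.σ (C.M.σ d))) = C.lab d := by simp [lab, C.M.labσ]
    have x : C.X (C.lab (C.M.σ (C.M.σ (C.M.σ d)))) := by rwa [l]
    have o : C.opp (C.M.σ (C.M.σ (C.M.σ d))) = C.M.σ (C.M.σ (C.M.σ (C.M.σ d))) := by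
      rw [c4, ← k, C.opp_opp hd]
    exact ⟨_, x, o, main _ x o⟩

/-- four labels in order -/
lemma side {d : D} (h : C.X (C.lab d)) (hf : C.fw d) :
    C.par (C.ed d) (C.lab (C.α (C.opp d))) < C.par (C.ed d) (C.lab d) ∧
    C.par (C.ed d) (C.lab d) < C.par (C.ed d) (C.lab (C.α d)) := by
  refine ⟨?_, hf⟩
  have k := (C.fw_opp h)
  have hb : ¬ C.fw (C.opp d) := by tauto
  have := (C.fw_α (C.opp d)).2 hb
  simp only [fw, α, lab, C.ed_α, C.M.αα, C.opp_ed d h, C.opp_lab d h] at this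
  exact this
lemma side' {d : D} (h : C.X (C.lab d)) (hf : ¬ C.fw d) :
    C.par (C.ed d) (C.lab (C.α d)) < C.par (C.ed d) (C.lab d) ∧
    C.par (C.ed d) (C.lab d) < C.par (C.ed d) (C.lab (C.α (C.opp d))) := by
  have k := (C.fw_opp h).2 hf
  have l := C.opp_lab d h
  have e := C.opp_ed d h
  have h' : C.X (C.lab (C.opp d)) := by rwa [lab, l]
  have := C.side h' k
  rw [C.opp_opp h, e, lab, lab, l] at this
  exact this

lemma side_ne {d : D} (h : C.X (C.lab d)) : C.lab (C.α (C.opp d)) ≠ C.lab (C.α d) := by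
  intro k
  by_cases hf : C.fw d
  · have := C.side h hf; rw [k] at this; exact lt_asymm this.1 this.2
  · have := C.side' h hf; rw [k] at this; exact lt_asymm this.1 this.2

lemma X_opp {d : D} (h : C.X (C.lab d)) (h' : C.X (C.lab (C.α d))) :
    ¬ C.X (C.lab (C.α (C.opp d))) := by
  intro k
  refine C.no3 d (C.α d) (C.α (C.opp d)) h h' k (C.ed_α d).symm ?_ (C.labne d).symm ?_ (C.side_ne h).symm
  · rw [C.ed_α, C.opp_ed d h]
  · rw [← C.opp_lab d h]; exact (C.labne _).symm

/-- resolved data -/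
def toRD [Finite D] (hr : ∀ d, C.X (C.lab d) → C.opp d = C.M.σ (C.M.σ d)) : RD D L E where
  s := C.M.σ
  a := C.M.α
  lab := C.M.lab
  ed := C.ed
  X d := C.X (C.lab d)
  Ps d := C.Ps (C.lab d)
  col d := C.col (C.lab d)
  aa := C.M.αα
  lab_s := C.M.labσ
  X_lab d d' h := by rw [lab, h]
  Ps_lab d d' h := by rw [lab, h]
  col_lab d d' h := by rw [lab, h]
  s4 d h := (C.cyc' h).1
  ed_a := C.ed_α
  ed_ss d h := by rw [← hr d h, C.opp_ed d h]
  ed_s d h := by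
    intro k
    obtain ⟨c4, c1, c2, c3, ex⟩ := C.cyc' h
    rcases C.of_same h k (C.M.labσ d) with k | k
    · exact c1 k
    · rw [hr d h] at k
      exact c1 (C.M.σ.injective k).symm
  cc d h h' := by rw [← hr d h]; exact C.X_opp h h'
  XPs d h := C.XPs d _ (C.ed_α d).symm h
  PsPs d h h' := C.labne d (C.PsPs _ _ (C.ed_α d) h' h)
  XnPs d h := C.XPs d d rfl h
  col_a d h1 h2 h3 h4 := C.real_col d _ h1 h2 h3 h4 (C.ed_α d).symm (C.M.αne d).symm
  col_x d h h1 h2 := by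
    rw [← hr d h] at h2 ⊢
    have e : C.ed (C.α (C.opp d)) = C.ed d := (C.ed_α _).trans (C.opp_ed d h)
    refine C.real_col _ _ h1 (C.XPs d _ (C.ed_α d).symm h) h2 (C.XPs d _ e.symm h) ?_ ?_
    · exact (C.ed_α d).trans e.symm
    · intro k; exact C.side_ne h (congrArg C.lab k).symm
  col_cc d h h' := by
    rw [← hr d h, ← hr _ h']
    have l1 : C.M.α (C.M.α d) = d := C.M.αα d
    have e1 : C.ed (C.M.α (C.opp d)) = C.ed d := (C.ed_α _).trans (C.opp_ed d h)
    have e2 : C.ed (C.M.α (C.opp (C.M.α d))) = C.ed d :=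
      ((C.ed_α _).trans (C.opp_ed _ h')).trans (C.ed_α d)
    refine C.real_col _ _ (C.X_opp h h') (C.XPs d _ e1.symm h)
      (C.X_opp h' (by rw [α, l1]; exact h)) (C.XPs d _ e2.symm h) (e1.trans e2.symm) ?_
    intro k
    have f := C.fw_α d
    have e := C.ed_α d
    by_cases hf : C.fw d
    · have a := C.side h hf
      have b := C.side' h' (by tauto)
      rw [α, k] at a
      have b2 := b.2
      rw [e] at b2
      exact lt_irrefl _ (a.1.trans (a.2.trans b2))
    · have a := C.side' h hf
      have b := C.side h' (by tauto)
      rw [α, α, k] at a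
      have b2 := b.1
      rw [e] at b2
      exact lt_irrefl _ (a.2.trans (b2.trans a.1))
  share := C.share
  two d d' h1 h2 h3 := by
    refine C.uniq h1 h2 ?_
    simp only [fw, h1, lab, α, h2, h3]
  labne := C.labne
  deg := C.deg

open scoped Classical in
/-- resolving a touching point -/
theorem resolve [Finite D] {q : D} (h : C.X (C.lab q)) (h1 : C.opp q = C.M.σ q)
    (h2 : C.opp (C.M.σ (C.M.σ q)) = C.M.σ (C.M.σ (C.M.σ q))) :
    ∃ C' : CD {d // C.lab d ≠ C.lab q} L E, (∀ d, C'.lab d = C.lab d.1) ∧ C'.X = C.X ∧ C'.Ps = C.Ps ∧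
      ∀ d, C'.ed d = C.ed d.1 := by
  obtain ⟨c4, c1, c2, c3, ex⟩ := C.cyc' h
  have hX : ∀ x, C.M.lab x = C.lab q → C.X (C.lab x) := fun x hx => by rw [lab, hx]; exact h
  obtain ⟨M', ml, ms, ma⟩ := C.M.resolve (C.lab q) C.opp
    (fun x hx => (C.opp_lab x (hX x hx)).trans hx)
    (fun x hx => C.opp_opp (hX x hx)) (fun x hx => C.opp_ne x (hX x hx))
    (fun x hx => hx ▸ C.labne x) q _ _ _ rfl rfl rfl rfl c4 c1.symm c2.symm c3.symm
    (fun k => c1 (C.M.σ.injective k).symm)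
    (fun k => c2 (C.M.σ.injective k).symm)
    (fun k => c1 (C.M.σ.injective (C.M.σ.injective k)).symm) ex h1 h2
  have hed : ∀ d, C.ed (M'.α d).1 = C.ed d.1 := by
    intro d
    rw [ma]
    split_ifs with k
    · rw [C.ed_α, C.opp_ed _ (hX _ k), C.ed_α]
    · rw [C.ed_α]
  have hfw : ∀ d, (C.par (C.ed d.1) (C.lab d.1) < C.par (C.ed d.1) (M'.lab (M'.α d)) ↔ C.fw d.1) ∧
      C.par (C.ed d.1) (C.lab d.1) ≠ C.par (C.ed d.1) (M'.lab (M'.α d)) := by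
    intro d
    rw [ml, ma]
    split_ifs with k
    · have f := C.fw_α d.1
      have e := C.ed_α d.1
      have aa := C.M.αα d.1
      by_cases hf : C.fw d.1
      · have b := C.side' (hX _ k) (by tauto)
        rw [e, α, aa] at b
        have := b.1.trans b.2
        exact ⟨⟨fun _ => hf, fun _ => this⟩, this.ne⟩
      · have b := C.side (hX _ k) (f.2 hf)
        rw [e, α, α, aa] at b
        have := b.1.trans b.2
        exact ⟨⟨fun h => absurd h this.not_gt, fun h => absurd h hf⟩, this.ne'⟩
    · exact ⟨Iff.rfl, C.par_ne d.1⟩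
  refine ⟨{
    M := M'
    X := C.X
    Ps := C.Ps
    col := C.col
    ed := fun d => C.ed d.1
    par := C.par
    opp := fun d => if k : C.lab (C.opp d.1) ≠ C.lab q then ⟨C.opp d.1, k⟩ else d
    ed_α := hed
    par_ne := fun d => by rw [ml]; exact (hfw d).2
    fw_uniq := ?_
    opp_lab := ?_
    opp_ed := ?_
    opp_ne := ?_
    Xtwo := ?_
    share := ?_
    no3 := ?_
    XPs := ?_
    PsPs := ?_
    Ps6 := ?_
    real_uniq := ?_
    real_col := ?_
    deg := ?_ }, ml, rfl, rfl, fun d => rfl⟩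
  · intro d d' h1 h2 h3
    rw [ml d, ml d'] at h2 h3
    rw [(hfw d).1, (hfw d').1] at h3
    exact Subtype.ext (C.uniq h1 h2 h3)
  · intro d hd
    rw [ml] at hd
    have l := C.opp_lab _ hd
    have : C.lab (C.opp d.1) ≠ C.lab q := by rw [lab, l]; exact d.2
    rw [dif_pos this, ml, ml]; exact l
  · intro d hd
    rw [ml] at hd
    have l := C.opp_lab _ hd
    have : C.lab (C.opp d.1) ≠ C.lab q := by rw [lab, l]; exact d.2
    simp only [this, ne_eq, not_false_eq_true, dite_true]
    exact C.opp_ed _ hd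
  · intro d hd
    rw [ml] at hd
    have l := C.opp_lab _ hd
    have : C.lab (C.opp d.1) ≠ C.lab q := by rw [lab, l]; exact d.2
    simp only [this, ne_eq, not_false_eq_true, dite_true]
    intro k; exact C.opp_ne _ hd (congrArg Subtype.val k)
  · intro d hd
    rw [ml] at hd
    obtain ⟨d', a1, a2, a3⟩ := C.Xtwo d.1 hd
    refine ⟨⟨d', by rw [lab, a1]; exact d.2⟩, by rw [ml, ml]; exact a1, a2, ?_⟩
    intro x hx
    rw [ml, ml] at hx
    exact a3 _ hx
  · intro d e d' e'
    rw [ml, ml, ml, ml]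
    exact C.share _ _ _ _
  · intro d e f
    rw [ml, ml, ml]
    exact C.no3 _ _ _
  · intro d e
    rw [ml, ml]
    exact C.XPs _ _
  · intro d e
    rw [ml, ml]
    exact C.PsPs _ _
  · intro d hd
    rw [ml] at hd
    refine (C.Ps6 _ hd).trans (le_of_eq ?_)
    rw [← Set.ncard_image_of_injective {d' | M'.lab d' = M'.lab d} Subtype.val_injective]
    congr 1
    ext x
    constructor
    · intro hx
      refine ⟨⟨x, ?_⟩, ?_, rfl⟩
      · rw [lab, hx]; exact d.2
      · show M'.lab _ = M'.lab _
        rw [ml, ml]; exact hx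
    · rintro ⟨y, hy, rfl⟩
      have hy' : M'.lab y = M'.lab d := hy
      rw [ml, ml] at hy'
      exact hy'
  · intro d e
    rw [ml, ml]
    intro a1 a2 a3 a4
    exact Subtype.ext (C.real_uniq _ _ a1 a2 a3 a4)
  · intro d e
    rw [ml, ml]
    intro a1 a2 a3 a4 a5 a6
    exact C.real_col _ _ a1 a2 a3 a4 a5 (fun k => a6 (Subtype.ext k))
  · intro d
    rw [ml]
    intro a1 a2
    have := congrArg Subtype.val a2
    rw [ms] at this
    exact C.deg _ a1 this

def Concl : Prop :=
    {d | ¬ C.X (C.lab d) ∧ ¬ C.Ps (C.lab d)}.ncard ≤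
      7 * (C.lab '' {d | ¬ C.X (C.lab d) ∧ ¬ C.Ps (C.lab d)}).ncard ∧
    ((∀ d, ¬ C.Ps (C.lab d)) → (∀ d d', C.ed d = C.ed d' → C.X (C.lab d) → C.X (C.lab d') →
        C.lab d = C.lab d') →
      {d | ¬ C.X (C.lab d) ∧ ¬ C.Ps (C.lab d)}.ncard ≤
        6 * (C.lab '' {d | ¬ C.X (C.lab d) ∧ ¬ C.Ps (C.lab d)}).ncard) ∧
    ((∀ d, ¬ C.Ps (C.lab d)) → (∀ d, ¬ C.X (C.lab d)) →
      {d | ¬ C.X (C.lab d) ∧ ¬ C.Ps (C.lab d)}.ncard ≤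
        4 * (C.lab '' {d | ¬ C.X (C.lab d) ∧ ¬ C.Ps (C.lab d)}).ncard)

theorem count_aux (n : ℕ) : ∀ (D L E : Type) [Finite D] (C : CD D L E), Nat.card D ≤ n → C.Concl := by
  induction n with
  | zero =>
    intro D L E _ C h
    have hD : IsEmpty D := by
      rcases Nat.card_eq_zero.1 (Nat.le_zero.1 h) with h | h
      · exact h
      · exact absurd ‹Finite D› (by simpa using h)
    have : {d | ¬ C.X (C.lab d) ∧ ¬ C.Ps (C.lab d)} = ∅ := Set.eq_empty_of_isEmpty _
    unfold Concl
    rw [this]; simp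
  | succ n ih =>
    intro D L E _ C h
    by_cases hr : ∀ d, C.X (C.lab d) → C.opp d = C.M.σ (C.M.σ d)
    · have := (C.toRD hr).count C.M rfl rfl rfl (fun d hd => (C.four hd).ge) (fun d hd => C.Ps6 d hd)
      refine ⟨this.1, fun h1 h2 => this.2.1 h1 fun d h3 h4 => ?_, this.2.2⟩
      exact C.labne d (h2 _ _ (C.ed_α d) h4 h3)
    · obtain ⟨q, hq, h1, h2⟩ := C.touch hr
      obtain ⟨C', e1, e2, e3, e4⟩ := C.resolve hq h1 h2
      have hc : Nat.card {d // C.lab d ≠ C.lab q} < Nat.card D :=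
        Finite.card_subtype_lt (x := q) (by simp)
      have main := ih _ _ _ C' (by omega)
      have s1 : {d | ¬ C.X (C.lab d) ∧ ¬ C.Ps (C.lab d)} =
          Subtype.val '' {d | ¬ C'.X (C'.lab d) ∧ ¬ C'.Ps (C'.lab d)} := by
        ext x
        constructor
        · intro hx
          refine ⟨⟨x, fun k => ?_⟩, ?_, rfl⟩
          · exact hx.1 (k ▸ hq)
          · simp only [e1, e2, e3, Set.mem_ofPred_eq]; exact hx
        · rintro ⟨y, hy, rfl⟩
          simpa only [e1, e2, e3, Set.mem_ofPred_eq] using hy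
      have s2 : (C.lab '' {d | ¬ C.X (C.lab d) ∧ ¬ C.Ps (C.lab d)}) =
          C'.lab '' {d | ¬ C'.X (C'.lab d) ∧ ¬ C'.Ps (C'.lab d)} := by
        rw [s1, Set.image_image]
        exact Set.image_congr fun d _ => (e1 d).symm
      unfold Concl at main ⊢
      rw [s2, s1, Set.ncard_image_of_injective _ Subtype.val_injective]
      refine ⟨main.1, fun h1 h2 => main.2.1 ?_ ?_, fun h1 h2 => main.2.2 ?_ ?_⟩
      · intro d; rw [e3, e1]; exact h1 _
      · intro d d'; rw [e1, e1, e2, e4, e4]; exact h2 _ _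
      · intro d; rw [e3, e1]; exact h1 _
      · intro d; rw [e2, e1]; exact h2 _

theorem count [Finite D] : C.Concl := count_aux _ _ _ _ C le_rfl

end CD
end BCL


namespace BCL
open Set

/-- An abstract system of arcs in the plane, pairwise meeting at most once. -/
structure AS (V E : Type) where
  vert : V → ℝ × ℝ
  vinj : Function.Injective vert
  arc : E → ℝ → ℝ × ℝ
  cont : ∀ e, ContinuousOn (arc e) (Icc 0 1)
  inj : ∀ e, InjOn (arc e) (Icc 0 1)
  u : E → V
  v : E → V
  h0 : ∀ e, arc e 0 = vert (u e)
  h1 : ∀ e, arc e 1 = vert (v e)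
  hvert : ∀ e, ∀ t ∈ Icc (0:ℝ) 1, ∀ w, arc e t = vert w → w = u e ∨ w = v e
  meet : ∀ e f, e ≠ f → ((arc e '' Icc (0:ℝ) 1) ∩ (arc f '' Icc (0:ℝ) 1)).Subsingleton
  c : V → Bool
  hc : ∀ e, c (u e) ≠ c (v e)

namespace AS
variable {V E : Type} (A : AS V E)

def img (e : E) : Set (ℝ × ℝ) := A.arc e '' Icc (0:ℝ) 1
def Cr (e f : E) : Prop := e ≠ f ∧ ∃ p ∈ A.img e ∩ A.img f, ∀ w, A.vert w ≠ p
def Q : Set (ℝ × ℝ) := range A.vert ∪ {p | ∃ e f, e ≠ f ∧ p ∈ A.img e ∩ A.img f}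
def T (e : E) : Set ℝ := {t | t ∈ Icc (0:ℝ) 1 ∧ A.arc e t ∈ A.Q}

lemma Q_fin [Finite V] [Finite E] : A.Q.Finite := by
  refine (finite_range _).union ?_
  have : {p | ∃ e f, e ≠ f ∧ p ∈ A.img e ∩ A.img f} =
      ⋃ e : E, ⋃ f : E, ⋃ _ : e ≠ f, A.img e ∩ A.img f := by
    ext p; simp only [mem_iUnion, mem_ofPred_eq, exists_prop]
  rw [this]
  refine finite_iUnion fun e => finite_iUnion fun f => finite_iUnion fun h => ?_
  exact (A.meet e f h).finite

lemma T_fin [Finite V] [Finite E] (e : E) : (A.T e).Finite := by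
  refine Finite.of_finite_image (f := A.arc e) (A.Q_fin.subset ?_) ?_
  · rintro _ ⟨t, ht, rfl⟩; exact ht.2
  · exact (A.inj e).mono fun t ht => ht.1

lemma T0 (e : E) : (0:ℝ) ∈ A.T e := ⟨by simp, Or.inl ⟨_, (A.h0 e).symm⟩⟩
lemma T1 (e : E) : (1:ℝ) ∈ A.T e := ⟨by simp, Or.inl ⟨_, (A.h1 e).symm⟩⟩

/-- segments between consecutive special parameters -/
def Sg : Type := {x : E × ℝ × ℝ // x.2.1 ∈ A.T x.1 ∧ x.2.2 ∈ A.T x.1 ∧ x.2.1 < x.2.2 ∧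
  ∀ t ∈ A.T x.1, x.2.1 < t → x.2.2 ≤ t}

namespace Sg
variable {A}
def e (s : A.Sg) : E := s.1.1
def a (s : A.Sg) : ℝ := s.1.2.1
def b (s : A.Sg) : ℝ := s.1.2.2
lemma ha (s : A.Sg) : s.a ∈ A.T s.e := s.2.1
lemma hb (s : A.Sg) : s.b ∈ A.T s.e := s.2.2.1
lemma lt (s : A.Sg) : s.a < s.b := s.2.2.2.1
lemma nx (s : A.Sg) : ∀ t ∈ A.T s.e, s.a < t → s.b ≤ t := s.2.2.2.2
lemma ext {s s' : A.Sg} (h : s.e = s'.e) (ha : s.a = s'.a) (hb : s.b = s'.b) : s = s' :=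
  Subtype.ext (Prod.ext h (Prod.ext ha hb))
lemma ext_a {s s' : A.Sg} (h : s.e = s'.e) (ha : s.a = s'.a) : s = s' := by
  refine ext h ha (le_antisymm ?_ ?_)
  · exact s.nx _ (h ▸ s'.hb) (ha ▸ s'.lt)
  · exact s'.nx _ (h ▸ s.hb) (ha ▸ s.lt)
lemma ext_b {s s' : A.Sg} (h : s.e = s'.e) (hb : s.b = s'.b) : s = s' := by
  refine ext h (le_antisymm ?_ ?_) hb
  · by_contra k
    push Not at k
    have := s'.nx _ (h ▸ s.ha) k
    rw [← hb] at this
    exact absurd s.lt this.not_gt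
  · by_contra k
    push Not at k
    have := s.nx _ (h ▸ s'.ha) k
    rw [hb] at this
    exact absurd s'.lt this.not_gt
/-- parametrization -/
def γ (s : A.Sg) (t : ℝ) : ℝ × ℝ := A.arc s.e (s.a + t * (s.b - s.a))
lemma mem (s : A.Sg) {t : ℝ} (ht : t ∈ Icc (0:ℝ) 1) :
    s.a + t * (s.b - s.a) ∈ Icc s.a s.b := by
  have := s.lt
  constructor <;> nlinarith [ht.1, ht.2]
lemma mem1 (s : A.Sg) {x : ℝ} (hx : x ∈ Icc s.a s.b) : x ∈ Icc (0:ℝ) 1 :=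
  ⟨s.ha.1.1.trans hx.1, hx.2.trans s.hb.1.2⟩
end Sg

instance [Finite V] [Finite E] : Finite A.Sg := by
  have : ({x : E × ℝ × ℝ | x.2.1 ∈ A.T x.1 ∧ x.2.2 ∈ A.T x.1 ∧ x.2.1 < x.2.2 ∧
    ∀ t ∈ A.T x.1, x.2.1 < t → x.2.2 ≤ t}).Finite := by
    have hU : (⋃ e, A.T e).Finite := finite_iUnion A.T_fin
    refine ((Set.finite_univ (α := E)).prod (hU.prod hU)).subset ?_
    rintro ⟨e, a, b⟩ ⟨h1, h2, -⟩
    exact ⟨trivial, mem_iUnion.2 ⟨e, h1⟩, mem_iUnion.2 ⟨e, h2⟩⟩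
  exact this.to_subtype

lemma next [Finite V] [Finite E] {e : E} {t : ℝ} (ht : t ∈ A.T e) (h : t < 1) :
    ∃ s : A.Sg, s.e = e ∧ s.a = t := by
  obtain ⟨m, hm, hm'⟩ := Set.exists_min_image {x | x ∈ A.T e ∧ t < x} id
    ((A.T_fin e).subset fun x hx => hx.1) ⟨1, A.T1 e, h⟩
  exact ⟨⟨(e, t, m), ht, hm.1, hm.2, fun x hx hx' => hm' x ⟨hx, hx'⟩⟩, rfl, rfl⟩

lemma prev [Finite V] [Finite E] {e : E} {t : ℝ} (ht : t ∈ A.T e) (h : 0 < t) :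
    ∃ s : A.Sg, s.e = e ∧ s.b = t := by
  obtain ⟨m, hm, hm'⟩ := Set.exists_max_image {x | x ∈ A.T e ∧ x < t} id
    ((A.T_fin e).subset fun x hx => hx.1) ⟨0, A.T0 e, h⟩
  refine ⟨⟨(e, m, t), hm.1, ht, hm.2, fun x hx hx' => ?_⟩, rfl, rfl⟩
  by_contra k
  push Not at k
  exact absurd hx' (hm' x ⟨hx, k⟩).not_gt

abbrev Dt : Type := A.Sg × Bool
variable {A}
def ed (d : A.Dt) : E := d.1.e
def pr (d : A.Dt) : ℝ := if d.2 then d.1.b else d.1.a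
def lb (d : A.Dt) : ℝ × ℝ := A.arc (ed d) (pr d)

lemma pr_T (d : A.Dt) : pr d ∈ A.T (ed d) := by
  unfold pr; split_ifs
  · exact d.1.hb
  · exact d.1.ha

lemma topo' [Finite V] [Finite E] [Nonempty V] : ∃ M : PMap A.Dt (ℝ × ℝ),
    (∀ s b, M.α (s, b) = (s, !b)) ∧ ∀ d, M.lab d = lb d := by
  have hex := topo A.Q A.Q_fin ⟨A.vert (Classical.arbitrary V), Or.inl ⟨_, rfl⟩⟩
    (fun s : A.Sg => s.γ) ?_ ?_ ?_ ?_ ?_ ?_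
  · obtain ⟨M, h1, h2, h3⟩ := hex
    refine ⟨M, h1, ?_⟩
    rintro ⟨s, b⟩
    cases b
    · rw [h2]; simp [Sg.γ, lb, ed, pr]
    · rw [h3]; simp [Sg.γ, lb, ed, pr]
  · intro s
    refine (A.cont s.e).comp (by fun_prop) ?_
    intro t ht; exact s.mem1 (s.mem ht)
  · intro s t ht t' ht' h
    have := A.inj s.e (s.mem1 (s.mem ht)) (s.mem1 (s.mem ht')) h
    have l := s.lt
    have : (t - t') * (s.b - s.a) = 0 := by linarith
    rcases mul_eq_zero.1 this with h | h <;> linarith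
  · intro s; simpa [Sg.γ] using s.ha.2
  · intro s; simpa [Sg.γ] using s.hb.2
  · intro s t ht h
    have l := s.lt
    have m := s.mem (Ioo_subset_Icc_self ht)
    have := s.nx _ ⟨s.mem1 m, h⟩ (by nlinarith [ht.1])
    nlinarith [ht.2]
  · intro s s' hs t ht t' ht' h
    by_contra hQ
    have m := s.mem ht
    have m' := s'.mem ht'
    by_cases he : s.e = s'.e
    · unfold Sg.γ at h hQ
      generalize s.a + t * (s.b - s.a) = x at *
      generalize hy : s'.a + t' * (s'.b - s'.a) = y at *
      have hxy : x = y := A.inj s.e (s.mem1 m) (by have := s'.mem1 m'; exact this) (by rw [h, he])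
      subst hxy
      have na : s'.a ≠ x := by intro k; apply hQ; rw [← k, he]; exact s'.ha.2
      have na2 : s.a ≠ x := by intro k; apply hQ; rw [← k]; exact s.ha.2
      have l1 := lt_of_le_of_ne m'.1 na
      have l2 := lt_of_le_of_ne m.1 na2
      refine hs (Sg.ext_a he (le_antisymm ?_ ?_))
      · by_contra k
        push Not at k
        have b1 := s'.nx _ (he ▸ s.ha) k
        linarith [m'.2]
      · by_contra k
        push Not at k
        have b1 := s.nx _ (he.symm ▸ s'.ha) k
        linarith [m.2]
    · apply hQ
      refine Or.inr ⟨s.e, s'.e, he, ⟨_, s.mem1 m, rfl⟩, ⟨_, s'.mem1 m', h.symm⟩⟩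

end AS
end BCL


namespace BCL
open Set
namespace AS
variable {V E : Type} {A : AS V E}

variable (A) in
def thru (l : ℝ × ℝ) : Set E := {e | l ∈ A.img e}
variable (A) in
def IX (l : ℝ × ℝ) : Prop := l ∉ range A.vert ∧ (A.thru l).ncard = 2
variable (A) in
def IP (l : ℝ × ℝ) : Prop := l ∉ range A.vert ∧ 3 ≤ (A.thru l).ncard

lemma lb_img (d : A.Dt) : lb d ∈ A.img (ed d) := ⟨_, (pr_T d).1, rfl⟩
lemma lb_Q (d : A.Dt) : lb d ∈ A.Q := (pr_T d).2

lemma real_vert [Finite E] {d : A.Dt} (h1 : ¬ A.IX (lb d)) (h2 : ¬ A.IP (lb d)) :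
    lb d ∈ range A.vert := by
  by_contra h
  rcases lb_Q d with k | ⟨e, f, hne, he, hf⟩
  · exact h k
  have : ({e, f} : Set E) ⊆ A.thru (lb d) := by
    rintro x (rfl | rfl)
    · exact he
    · exact hf
  have := ncard_le_ncard this (toFinite _)
  rw [ncard_pair hne] at this
  by_cases k : (A.thru (lb d)).ncard = 2
  · exact h1 ⟨h, k⟩
  · exact h2 ⟨h, by omega⟩

lemma vert_pr {d : A.Dt} (h : lb d ∈ range A.vert) :
    (pr d = 0 ∧ lb d = A.vert (A.u (ed d)) ∧ d.2 = false) ∨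
    (pr d = 1 ∧ lb d = A.vert (A.v (ed d)) ∧ d.2 = true) := by
  obtain ⟨w, hw⟩ := h
  have l := d.1.lt
  have i0 : (0:ℝ) ∈ Icc (0:ℝ) 1 := by simp
  have i1 : (1:ℝ) ∈ Icc (0:ℝ) 1 := by simp
  rcases A.hvert (ed d) _ (pr_T d).1 w hw.symm with k | k
  · left
    have e : pr d = 0 := A.inj _ (pr_T d).1 i0 (by rw [A.h0, ← k]; exact hw.symm)
    refine ⟨e, by rw [← k, hw], ?_⟩
    unfold pr at e
    by_contra k
    rw [if_pos (by simpa using k)] at e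
    linarith [d.1.ha.1.1]
  · right
    have e : pr d = 1 := A.inj _ (pr_T d).1 i1 (by rw [A.h1, ← k]; exact hw.symm)
    refine ⟨e, by rw [← k, hw], ?_⟩
    unfold pr at e
    by_contra k
    rw [if_neg (by simpa using k)] at e
    linarith [d.1.hb.1.2]

lemma exists_dart [Finite V] [Finite E] {e : E} {l : ℝ × ℝ} (h : l ∈ A.img e) (hQ : l ∈ A.Q)
    (hn : l ∉ range A.vert) (b : Bool) : ∃ d : A.Dt, ed d = e ∧ lb d = l ∧ d.2 = b := by
  obtain ⟨t, ht, rfl⟩ := h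
  have n0 : t ≠ 0 := by rintro rfl; exact hn ⟨_, (A.h0 e).symm⟩
  have n1 : t ≠ 1 := by rintro rfl; exact hn ⟨_, (A.h1 e).symm⟩
  have p0 : 0 < t := lt_of_le_of_ne ht.1 n0.symm
  have p1 : t < 1 := lt_of_le_of_ne ht.2 n1
  cases b
  · obtain ⟨s, hs, ha⟩ := A.next (e := e) ⟨ht, hQ⟩ p1
    exact ⟨(s, false), hs, by simp [lb, ed, pr, hs, ha], rfl⟩
  · obtain ⟨s, hs, hb⟩ := A.prev (e := e) ⟨ht, hQ⟩ p0
    exact ⟨(s, true), hs, by simp [lb, ed, pr, hs, hb], rfl⟩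

lemma ed_lb_uniq {d d' : A.Dt} (h1 : ed d = ed d') (h2 : lb d = lb d') (h3 : d.2 = d'.2) :
    d = d' := by
  have hp : pr d = pr d' := A.inj (ed d) (pr_T d).1 (pr_T d').1 (by
    have : lb d = A.arc (ed d) (pr d) := rfl
    rw [← this, h2, h1]; rfl)
  refine Prod.ext ?_ h3
  unfold pr at hp
  rw [← h3] at hp
  split_ifs at hp
  · exact Sg.ext_b h1 hp
  · exact Sg.ext_a h1 hp

lemma cr_of {e f : E} {l : ℝ × ℝ} (h : e ≠ f) (he : l ∈ A.img e) (hf : l ∈ A.img f)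
    (hn : l ∉ range A.vert) : A.Cr e f :=
  ⟨h, l, ⟨he, hf⟩, fun w hw => hn ⟨w, hw⟩⟩

lemma two_ne {e f : E} {l l' : ℝ × ℝ} (hl : l ≠ l') {g : E} (he : l ∈ A.img e) (he' : l' ∈ A.img e)
    (hf : f ≠ e) (hg : g ≠ e) (h1 : l ∈ A.img f) (h2 : l' ∈ A.img g) : f ≠ g := by
  rintro rfl
  exact hl (A.meet e f hf.symm ⟨he, h1⟩ ⟨he', h2⟩)

lemma IX_other [Finite E] {e : E} {l : ℝ × ℝ} (h : A.IX l) (he : l ∈ A.img e) :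
    ∃ f, f ≠ e ∧ l ∈ A.img f ∧ ∀ g, l ∈ A.img g → g = e ∨ g = f := by
  obtain ⟨x, y, hxy, hs⟩ := ncard_eq_two.1 h.2
  have m : ∀ g, l ∈ A.img g ↔ g = x ∨ g = y := by
    intro g
    show g ∈ A.thru l ↔ _
    rw [hs]; simp
  rcases (m e).1 he with rfl | rfl
  · exact ⟨y, hxy.symm, (m y).2 (Or.inr rfl), fun g hg => (m g).1 hg⟩
  · exact ⟨x, hxy, (m x).2 (Or.inl rfl), fun g hg => ((m g).1 hg).symm⟩

lemma IP_other [Finite E] {e : E} {l : ℝ × ℝ} (h : A.IP l) (he : l ∈ A.img e) :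
    ∃ f g, f ≠ e ∧ g ≠ e ∧ f ≠ g ∧ l ∈ A.img f ∧ l ∈ A.img g := by
  have h3 := h.2
  have : 1 < (A.thru l \ {e}).ncard := by
    rw [ncard_sdiff_singleton_of_mem (show e ∈ A.thru l from he)]; omega
  obtain ⟨f, g, hf, hg, hfg⟩ := (one_lt_ncard_iff (toFinite _)).1 this
  exact ⟨f, g, hf.2, hg.2, hfg, hf.1, hg.1⟩

noncomputable def par (e : E) (l : ℝ × ℝ) : ℝ := Function.invFunOn (A.arc e) (Icc 0 1) l

lemma par_lb (d d' : A.Dt) (h : ed d' = ed d) : par (A := A) (ed d) (lb d') = pr d' := by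
  have hm : ∃ a ∈ Icc (0:ℝ) 1, A.arc (ed d) a = lb d' := ⟨pr d', (pr_T d').1, by rw [← h]; rfl⟩
  have h1 := Function.invFunOn_mem hm
  have h2 := Function.invFunOn_eq hm
  exact A.inj (ed d) h1 (pr_T d').1 (h2.trans (by rw [← h]; rfl))

open scoped Classical in
noncomputable def opp (d : A.Dt) : A.Dt :=
  if h : ∃ d' : A.Dt, ed d' = ed d ∧ lb d' = lb d ∧ d'.2 = !d.2 then h.choose else d

lemma opp_spec [Finite V] [Finite E] {d : A.Dt} (h : A.IX (lb d)) :
    ed (opp d) = ed d ∧ lb (opp d) = lb d ∧ (opp d).2 = !d.2 := by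
  have := exists_dart (lb_img d) (lb_Q d) h.1 (!d.2)
  unfold opp
  rw [dif_pos this]
  exact this.choose_spec

open scoped Classical in
noncomputable def pcol (l : ℝ × ℝ) : Bool := if h : ∃ w, A.vert w = l then A.c h.choose else false
lemma pcol_vert (w : V) : pcol (A := A) (A.vert w) = A.c w := by
  have : ∃ w', A.vert w' = A.vert w := ⟨w, rfl⟩
  unfold pcol
  rw [dif_pos this, A.vinj this.choose_spec]

theorem exists_CD [Finite V] [Finite E] [Nonempty V]
    (h3 : ∀ e f g k, A.Cr e f → A.Cr e g → A.Cr e k → f ≠ g → f ≠ k → g ≠ k → False)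
    (hdeg : ∀ e w, (w = A.u e ∨ w = A.v e) → ∃ f, f ≠ e ∧ (w = A.u f ∨ w = A.v f)) :
    ∃ C : CD A.Dt (ℝ × ℝ) E, (∀ d, C.M.lab d = lb d) ∧ C.X = A.IX ∧ C.Ps = A.IP ∧ C.ed = ed := by
  obtain ⟨M, hα, hl⟩ := topo' (A := A)
  have hedα : ∀ d, ed (M.α d) = ed d := by rintro ⟨s, b⟩; rw [hα]; rfl
  have hfw : ∀ d, (par (A := A) (ed d) (M.lab d) < par (A := A) (ed d) (M.lab (M.α d)) ↔ d.2 = false) ∧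
      par (A := A) (ed d) (M.lab d) ≠ par (A := A) (ed d) (M.lab (M.α d)) := by
    intro d
    rw [hl, hl, par_lb _ _ rfl, par_lb _ _ (hedα d)]
    obtain ⟨s, b⟩ := d
    rw [hα]
    have := s.lt
    cases b
    · simp [pr, this, this.ne]
    · simp [pr, this.le, this.ne']
  have hP6 : ∀ d : A.Dt, A.IP (lb d) → 6 ≤ {d' : A.Dt | lb d' = lb d}.ncard := by
    intro d hd
    choose F F1 F2 F3 using fun (x : A.thru (lb d)) (b : Bool) => exists_dart x.2 (lb_Q d) hd.1 b
    have hF : Function.Injective (fun x : (A.thru (lb d)) × Bool =>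
        (⟨F x.1 x.2, F2 x.1 x.2⟩ : {d' : A.Dt | lb d' = lb d})) := by
      rintro ⟨x, b⟩ ⟨y, b'⟩ h
      have h' : F x b = F y b' := congrArg Subtype.val h
      have k1 := F1 x b
      have k2 := F3 x b
      rw [h', F1] at k1
      rw [h', F3] at k2
      exact Prod.ext (Subtype.ext k1.symm) k2.symm
    have := Nat.card_le_card_of_injective _ hF
    rw [Nat.card_prod, Nat.card_coe_set_eq, Nat.card_coe_set_eq, Nat.card_eq_fintype_card,
      Fintype.card_bool] at this
    have := hd.2
    omega
  have hru : ∀ d d' : A.Dt, ¬ A.IX (lb d) → ¬ A.IP (lb d) → ed d = ed d' → lb d = lb d' → d = d' := by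
    intro d d' h1 h2 h3 h4
    have v1 := real_vert h1 h2
    have v2 := v1
    rw [h4] at v2
    refine ed_lb_uniq h3 h4 ?_
    have i := A.inj (ed d) (pr_T d).1 (pr_T d').1 (by
      have : lb d = A.arc (ed d) (pr d) := rfl
      rw [← this, h4, h3]; rfl)
    rcases vert_pr v1 with ⟨a1, a2, a3⟩ | ⟨a1, a2, a3⟩ <;>
      rcases vert_pr v2 with ⟨b1, b2, b3⟩ | ⟨b1, b2, b3⟩
    · rw [a3, b3]
    · rw [a1, b1] at i; norm_num at i
    · rw [a1, b1] at i; norm_num at i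
    · rw [a3, b3]
  refine ⟨{
    M := M
    X := A.IX
    Ps := A.IP
    col := pcol (A := A)
    ed := ed
    par := par (A := A)
    opp := opp
    ed_α := hedα
    par_ne := fun d => (hfw d).2
    fw_uniq := ?_
    opp_lab := ?_
    opp_ed := ?_
    opp_ne := ?_
    Xtwo := ?_
    share := ?_
    no3 := ?_
    XPs := ?_
    PsPs := ?_
    Ps6 := ?_
    real_uniq := ?_
    real_col := ?_
    deg := ?_ }, hl, rfl, rfl, rfl⟩
  · intro d d' h1 h2 h3
    rw [(hfw d).1, (hfw d').1] at h3
    rw [hl, hl] at h2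
    refine ed_lb_uniq h1 h2 ?_
    revert h3
    generalize d.2 = x; generalize d'.2 = y
    revert x y; decide
  · intro d hd
    rw [hl] at hd ⊢
    rw [hl]; exact (opp_spec hd).2.1
  · intro d hd
    rw [hl] at hd
    exact (opp_spec hd).1
  · intro d hd k
    rw [hl] at hd
    have := (opp_spec hd).2.2
    rw [k] at this
    simp at this
  · intro d hd
    rw [hl] at hd
    obtain ⟨f, hf, hf2, hf3⟩ := IX_other hd (lb_img d)
    obtain ⟨d', e1, e2, -⟩ := exists_dart hf2 (lb_Q d) hd.1 true
    refine ⟨d', by rw [hl, hl, e2], by rw [e1]; exact hf, ?_⟩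
    intro d'' hd''
    rw [hl, hl] at hd''
    rw [e1]
    exact hf3 _ (hd'' ▸ lb_img d'')
  · intro d e d' e'
    rw [hl, hl, hl, hl]
    intro a1 a2 a3 a4 a5
    by_contra k
    refine a5 (A.meet _ _ k ⟨lb_img d, ?_⟩ ⟨?_, ?_⟩)
    · rw [a3]; exact lb_img d'
    · rw [a1]; exact lb_img e
    · rw [a2, a4]; exact lb_img e'
  · intro d e f
    rw [hl, hl, hl]
    intro x1 x2 x3 e1 e2 n1 n2 n3
    have i1 := lb_img d
    have i2 := lb_img e
    have i3 := lb_img f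
    rw [← e1] at i2
    rw [← e2] at i3
    obtain ⟨f1, p1, q1, -⟩ := IX_other x1 i1
    obtain ⟨f2, p2, q2, -⟩ := IX_other x2 i2
    obtain ⟨f3, p3, q3, -⟩ := IX_other x3 i3
    exact h3 _ f1 f2 f3 (cr_of p1.symm i1 q1 x1.1) (cr_of p2.symm i2 q2 x2.1)
      (cr_of p3.symm i3 q3 x3.1) (two_ne n1 i1 i2 p1 p2 q1 q2) (two_ne n2 i1 i3 p1 p3 q1 q3)
      (two_ne n3 i2 i3 p2 p3 q2 q3)
  · intro d d'
    rw [hl, hl]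
    intro e1 x1 x2
    have i1 := lb_img d
    have i2 := lb_img d'
    rw [← e1] at i2
    obtain ⟨f1, p1, q1, -⟩ := IX_other x1 i1
    obtain ⟨f2, f3, p2, p3, n, q2, q3⟩ := IP_other x2 i2
    have nn : lb d ≠ lb d' := by
      intro k
      rw [← k] at x2
      have := x1.2; have := x2.2; omega
    exact h3 _ f1 f2 f3 (cr_of p1.symm i1 q1 x1.1) (cr_of p2.symm i2 q2 x2.1)
      (cr_of p3.symm i2 q3 x2.1) (two_ne nn i1 i2 p1 p2 q1 q2) (two_ne nn i1 i2 p1 p3 q1 q3) n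
  · intro d d'
    rw [hl, hl]
    intro e1 x1 x2
    have i1 := lb_img d
    have i2 := lb_img d'
    rw [← e1] at i2
    obtain ⟨f1, -, p1, -, -, q1, -⟩ := IP_other x1 i1
    obtain ⟨f2, f3, p2, p3, n, q2, q3⟩ := IP_other x2 i2
    by_contra nn
    exact h3 _ f1 f2 f3 (cr_of p1.symm i1 q1 x1.1) (cr_of p2.symm i2 q2 x2.1)
      (cr_of p3.symm i2 q3 x2.1) (two_ne nn i1 i2 p1 p2 q1 q2) (two_ne nn i1 i2 p1 p3 q1 q3) n
  · intro d hd
    simp only [hl] at hd ⊢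
    exact hP6 d hd
  · intro d d'
    rw [hl, hl]
    exact hru d d'
  · intro d d'
    rw [hl, hl]
    intro a1 a2 a3 a4 a5 a6
    have hc := A.hc (ed d)
    rcases vert_pr (real_vert a1 a2) with ⟨b1, b2, b3⟩ | ⟨b1, b2, b3⟩ <;>
      rcases vert_pr (real_vert a3 a4) with ⟨c1, c2, c3⟩ | ⟨c1, c2, c3⟩
    · exact absurd (hru d d' a1 a2 a5 (by rw [b2, c2, a5])) a6
    · rw [b2, c2, pcol_vert, pcol_vert, ← a5]; exact hc
    · rw [b2, c2, pcol_vert, pcol_vert, ← a5]; exact hc.symm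
    · exact absurd (hru d d' a1 a2 a5 (by rw [b2, c2, a5])) a6
  · intro d hd hs
    rw [hl] at hd
    have only : ∀ d' : A.Dt, lb d' = lb d → d' = d := by
      intro d' h
      exact M.trans (fun x => x = d) (by rintro x rfl; exact hs) d d' (by rw [hl, hl, h]) rfl
    by_cases hp : A.IP (lb d)
    · have := hP6 d hp
      have k : {d' : A.Dt | lb d' = lb d} ⊆ {d} := fun x hx => only x hx
      have := ncard_le_ncard k (toFinite _)
      rw [ncard_singleton] at this
      omega
    · obtain ⟨w, hw⟩ := real_vert hd hp
      obtain ⟨f, hf, hf'⟩ := hdeg (ed d) w (A.hvert _ _ (pr_T d).1 w hw.symm)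
      rcases hf' with k | k
      · obtain ⟨s, hs, ha⟩ := A.next (A.T0 f) (by norm_num)
        have := only (s, false) (by rw [← hw, k, ← A.h0, ← hs]; simp [lb, ed, pr, ha])
        apply hf
        rw [← this]; exact hs.symm
      · obtain ⟨s, hs, ha⟩ := A.prev (A.T1 f) (by norm_num)
        have := only (s, true) (by rw [← hw, k, ← A.h1, ← hs]; simp [lb, ed, pr, ha])
        apply hf
        rw [← this]; exact hs.symm

/-- incident vertices -/
def inc (A : AS V E) : Set V := {w | ∃ e, w = A.u e ∨ w = A.v e}

theorem bounds [Finite V] [Finite E]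
    (hdeg : ∀ e w, (w = A.u e ∨ w = A.v e) → ∃ f, f ≠ e ∧ (w = A.u f ∨ w = A.v f)) :
    ((∀ e f g k, A.Cr e f → A.Cr e g → A.Cr e k → f ≠ g → f ≠ k → g ≠ k → False) →
      2 * Nat.card E ≤ 7 * A.inc.ncard) ∧
    ((∀ e f g, A.Cr e f → A.Cr e g → f ≠ g → False) → 2 * Nat.card E ≤ 6 * A.inc.ncard) ∧
    ((∀ e f, ¬ A.Cr e f) → 2 * Nat.card E ≤ 4 * A.inc.ncard) := by
  rcases isEmpty_or_nonempty E with hE | hE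
  · simp
  have hV : Nonempty V := ⟨A.u (Classical.arbitrary E)⟩
  have main : (∀ e f g k, A.Cr e f → A.Cr e g → A.Cr e k → f ≠ g → f ≠ k → g ≠ k → False) →
      ∃ C : CD A.Dt (ℝ × ℝ) E, (∀ d, C.M.lab d = lb d) ∧ C.X = A.IX ∧ C.Ps = A.IP ∧ C.ed = ed ∧
      2 * Nat.card E ≤ {d | ¬ C.X (C.lab d) ∧ ¬ C.Ps (C.lab d)}.ncard ∧
      (C.lab '' {d | ¬ C.X (C.lab d) ∧ ¬ C.Ps (C.lab d)}).ncard ≤ A.inc.ncard := by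
    intro h3
    obtain ⟨C, hl, hX, hP, he⟩ := exists_CD h3 hdeg
    refine ⟨C, hl, hX, hP, he, ?_, ?_⟩
    · rw [hX, hP]
      choose s hs ha using fun e => A.next (A.T0 e) (by norm_num)
      choose t ht hb using fun e => A.prev (A.T1 e) (by norm_num)
      have hs' : ∀ e, lb ((s e, false) : A.Dt) = A.vert (A.u e) := by
        intro e; rw [← A.h0]; simp [lb, ed, pr, ha, hs]
      have ht' : ∀ e, lb ((t e, true) : A.Dt) = A.vert (A.v e) := by
        intro e; rw [← A.h1]; simp [lb, ed, pr, hb, ht]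
      let F : E × Bool → {d | ¬ A.IX (C.lab d) ∧ ¬ A.IP (C.lab d)} := fun x =>
        if x.2 then ⟨(t x.1, true), by
          simp only [CD.lab, hl, mem_ofPred_eq, ht']
          exact ⟨fun h => h.1 ⟨_, rfl⟩, fun h => h.1 ⟨_, rfl⟩⟩⟩
        else ⟨(s x.1, false), by
          simp only [CD.lab, hl, mem_ofPred_eq, hs']
          exact ⟨fun h => h.1 ⟨_, rfl⟩, fun h => h.1 ⟨_, rfl⟩⟩⟩
      have hF : Function.Injective F := by
        rintro ⟨e, b⟩ ⟨e', b'⟩ h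
        have h' := congrArg Subtype.val h
        cases b <;> cases b'
        · have : s e = s e' := congrArg Prod.fst h'
          have : e = e' := by rw [← hs e, ← hs e', this]
          rw [this]
        · have := congrArg Prod.snd h'; simp [F] at this
        · have := congrArg Prod.snd h'; simp [F] at this
        · have : t e = t e' := congrArg Prod.fst h'
          have : e = e' := by rw [← ht e, ← ht e', this]
          rw [this]
      have := Nat.card_le_card_of_injective _ hF
      rw [Nat.card_prod, Nat.card_coe_set_eq, Nat.card_eq_fintype_card (α := Bool),
        Fintype.card_bool] at this
      omega
    · rw [← ncard_image_of_injective _ A.vinj]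
      refine ncard_le_ncard ?_ (toFinite _)
      rw [hX, hP]
      rintro _ ⟨d, ⟨h1, h2⟩, rfl⟩
      simp only [CD.lab, hl] at h1 h2 ⊢
      rcases vert_pr (real_vert h1 h2) with ⟨b1, b2, b3⟩ | ⟨b1, b2, b3⟩
      · exact ⟨_, ⟨_, Or.inl rfl⟩, b2.symm⟩
      · exact ⟨_, ⟨_, Or.inr rfl⟩, b2.symm⟩
  refine ⟨fun h => ?_, fun h => ?_, fun h => ?_⟩
  · obtain ⟨C, -, -, -, -, h1, h2⟩ := main h
    have := C.count.1
    omega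
  · obtain ⟨C, hl, hX, hP, he, h1, h2⟩ := main (fun e f g k a b _ c _ _ => h e f g a b c)
    have := C.count.2.1 ?_ ?_
    · omega
    · intro d
      rw [hP, CD.lab, hl]
      intro k
      obtain ⟨f, g, p1, p2, n, q1, q2⟩ := IP_other k (lb_img d)
      exact h _ f g (cr_of p1.symm (lb_img d) q1 k.1) (cr_of p2.symm (lb_img d) q2 k.1) n
    · intro d d'
      rw [hX, he, CD.lab, CD.lab, hl, hl]
      intro e1 x1 x2
      have i2 := lb_img d'
      rw [← e1] at i2
      by_contra n
      obtain ⟨f1, p1, q1, -⟩ := IX_other x1 (lb_img d)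
      obtain ⟨f2, p2, q2, -⟩ := IX_other x2 i2
      exact h _ f1 f2 (cr_of p1.symm (lb_img d) q1 x1.1) (cr_of p2.symm i2 q2 x2.1)
        (two_ne n (lb_img d) i2 p1 p2 q1 q2)
  · obtain ⟨C, hl, hX, hP, he, h1, h2⟩ := main (fun e f g k a b _ c _ _ => h e f a)
    have := C.count.2.2 ?_ ?_
    · omega
    · intro d
      rw [hP, CD.lab, hl]
      intro k
      obtain ⟨f, g, p1, p2, n, q1, q2⟩ := IP_other k (lb_img d)
      exact h _ f (cr_of p1.symm (lb_img d) q1 k.1)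
    · intro d
      rw [hX, CD.lab, hl]
      intro x1
      obtain ⟨f1, p1, q1, -⟩ := IX_other x1 (lb_img d)
      exact h _ f1 (cr_of p1.symm (lb_img d) q1 x1.1)

end AS
end BCL


namespace BCL
open Set
namespace AS
variable {V E : Type}

/-- restriction to a set of edges -/
def restrict (A : AS V E) (S : Set E) : AS V S where
  vert := A.vert
  vinj := A.vinj
  arc e := A.arc e
  cont e := A.cont e
  inj e := A.inj e
  u e := A.u e
  v e := A.v e
  h0 e := A.h0 e
  h1 e := A.h1 e
  hvert e := A.hvert e
  meet e f h := A.meet e f fun k => h (Subtype.ext k)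
  c := A.c
  hc e := A.hc e

lemma restrict_Cr (A : AS V E) (S : Set E) (e f : S) : (A.restrict S).Cr e f → A.Cr e f :=
  fun h => ⟨fun k => h.1 (Subtype.ext k), h.2⟩

lemma Cr_symm {A : AS V E} {e f : E} (h : A.Cr e f) : A.Cr f e := by
  obtain ⟨h1, p, h2, h3⟩ := h
  exact ⟨h1.symm, p, h2.symm, h3⟩

open scoped Classical in
/-- vertices incident to a set of edges -/
noncomputable def vs (A : AS V E) (S : Finset E) : Finset V := S.image A.u ∪ S.image A.v

lemma mem_vs {A : AS V E} {S : Finset E} {w : V} :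
    w ∈ A.vs S ↔ ∃ e ∈ S, w = A.u e ∨ w = A.v e := by
  classical
  simp only [vs, Finset.mem_union, Finset.mem_image]
  constructor
  · rintro (⟨e, h, k⟩ | ⟨e, h, k⟩)
    · exact ⟨e, h, Or.inl k.symm⟩
    · exact ⟨e, h, Or.inr k.symm⟩
  · rintro ⟨e, h, k | k⟩
    · exact Or.inl ⟨e, h, k.symm⟩
    · exact Or.inr ⟨e, h, k.symm⟩

lemma peel (A : AS V E) (k : ℕ) (hk : 2 ≤ k) (P : Finset E → Prop)
    (her : ∀ S T, T ⊆ S → P S → P T)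
    (base : ∀ S, P S → (∀ e ∈ S, ∀ w, (w = A.u e ∨ w = A.v e) →
      ∃ f ∈ S, f ≠ e ∧ (w = A.u f ∨ w = A.v f)) → 2 * S.card ≤ k * (A.vs S).card) :
    ∀ S, P S → 2 * S.card ≤ k * (A.vs S).card := by
  classical
  intro S
  induction S using Finset.strongInduction with
  | _ S ih =>
    intro hP
    by_cases h : ∀ e ∈ S, ∀ w, (w = A.u e ∨ w = A.v e) →
      ∃ f ∈ S, f ≠ e ∧ (w = A.u f ∨ w = A.v f)
    · exact base S hP h
    push Not at h
    obtain ⟨e, he, w, hw, hn⟩ := h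
    have h1 := ih (S.erase e) (Finset.erase_ssubset he) (her _ _ (Finset.erase_subset _ _) hP)
    have h2 : A.vs (S.erase e) ⊆ (A.vs S).erase w := by
      intro x hx
      obtain ⟨f, hf, hx⟩ := mem_vs.1 hx
      rw [Finset.mem_erase] at hf
      refine Finset.mem_erase.2 ⟨?_, mem_vs.2 ⟨f, hf.2, hx⟩⟩
      rintro rfl
      have := hn f hf.2 hf.1
      tauto
    have h3 := Finset.card_le_card h2
    have hwS : w ∈ A.vs S := mem_vs.2 ⟨e, he, hw⟩
    have h4 := Finset.card_erase_add_one hwS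
    have h5 := Finset.card_erase_add_one he
    calc 2 * S.card = 2 * (S.erase e).card + 2 := by omega
      _ ≤ k * (A.vs (S.erase e)).card + k := by omega
      _ ≤ k * ((A.vs S).erase w).card + k := by gcongr
      _ = k * (A.vs S).card := by rw [← h4]; ring

lemma restrict_base [Finite V] (A : AS V E) (S : Finset E)
    (h : ∀ e ∈ S, ∀ w, (w = A.u e ∨ w = A.v e) → ∃ f ∈ S, f ≠ e ∧ (w = A.u f ∨ w = A.v f)) :
    ((∀ e ∈ S, ∀ f ∈ S, ∀ g ∈ S, ∀ k ∈ S, A.Cr e f → A.Cr e g → A.Cr e k →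
      f ≠ g → f ≠ k → g ≠ k → False) → 2 * S.card ≤ 7 * (A.vs S).card) ∧
    ((∀ e ∈ S, ∀ f ∈ S, ∀ g ∈ S, A.Cr e f → A.Cr e g → f ≠ g → False) →
      2 * S.card ≤ 6 * (A.vs S).card) ∧
    ((∀ e ∈ S, ∀ f ∈ S, ¬ A.Cr e f) → 2 * S.card ≤ 4 * (A.vs S).card) := by
  have hb := bounds (A := A.restrict (S : Set E)) (by
    rintro ⟨e, he⟩ w hw
    obtain ⟨f, hf, hne, hf2⟩ := h e he w hw
    exact ⟨⟨f, hf⟩, fun k => hne (congrArg Subtype.val k), hf2⟩)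
  have hc : Nat.card (S : Set E) = S.card := by simp
  have hi : (A.restrict (S : Set E)).inc = (A.vs S : Set V) := by
    ext w
    rw [Finset.mem_coe, mem_vs]
    constructor
    · rintro ⟨⟨e, he⟩, k⟩; exact ⟨e, he, k⟩
    · rintro ⟨e, he, k⟩; exact ⟨⟨e, he⟩, k⟩
  rw [hc, hi, ncard_coe_finset] at hb
  refine ⟨fun k => hb.1 ?_, fun k => hb.2.1 ?_, fun k => hb.2.2 ?_⟩
  · intro e f g l h1 h2 h3 h4 h5 h6
    exact k e e.2 f f.2 g g.2 l l.2 (restrict_Cr _ _ _ _ h1) (restrict_Cr _ _ _ _ h2)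
      (restrict_Cr _ _ _ _ h3) (fun k => h4 (Subtype.ext k)) (fun k => h5 (Subtype.ext k))
      (fun k => h6 (Subtype.ext k))
  · intro e f g h1 h2 h4
    exact k e e.2 f f.2 g g.2 (restrict_Cr _ _ _ _ h1) (restrict_Cr _ _ _ _ h2)
      (fun k => h4 (Subtype.ext k))
  · intro e f h1
    exact k e e.2 f f.2 (restrict_Cr _ _ _ _ h1)

lemma sub_bounds [Finite V] (A : AS V E) (S : Finset E) :
    ((∀ e ∈ S, ∀ f ∈ S, ∀ g ∈ S, ∀ k ∈ S, A.Cr e f → A.Cr e g → A.Cr e k →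
      f ≠ g → f ≠ k → g ≠ k → False) → 2 * S.card ≤ 7 * (A.vs S).card) ∧
    ((∀ e ∈ S, ∀ f ∈ S, ∀ g ∈ S, A.Cr e f → A.Cr e g → f ≠ g → False) →
      2 * S.card ≤ 6 * (A.vs S).card) ∧
    ((∀ e ∈ S, ∀ f ∈ S, ¬ A.Cr e f) → 2 * S.card ≤ 4 * (A.vs S).card) := by
  refine ⟨?_, ?_, ?_⟩
  · refine A.peel 7 (by norm_num) (fun S => ∀ e ∈ S, ∀ f ∈ S, ∀ g ∈ S, ∀ k ∈ S,
      A.Cr e f → A.Cr e g → A.Cr e k → f ≠ g → f ≠ k → g ≠ k → False) ?_ ?_ S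
    · intro S T h k e he f hf g hg l hl
      exact k e (h he) f (h hf) g (h hg) l (h hl)
    · intro S h k
      exact (A.restrict_base S k).1 h
  · refine A.peel 6 (by norm_num) (fun S => ∀ e ∈ S, ∀ f ∈ S, ∀ g ∈ S,
      A.Cr e f → A.Cr e g → f ≠ g → False) ?_ ?_ S
    · intro S T h k e he f hf g hg
      exact k e (h he) f (h hf) g (h hg)
    · intro S h k
      exact (A.restrict_base S k).2.1 h
  · refine A.peel 4 (by norm_num) (fun S => ∀ e ∈ S, ∀ f ∈ S, ¬ A.Cr e f) ?_ ?_ S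
    · intro S T h k e he f hf
      exact k e (h he) f (h hf)
    · intro S h k
      exact (A.restrict_base S k).2.2 h

open scoped Classical in
/-- ordered crossing pairs -/
noncomputable def cp (A : AS V E) (S : Finset E) : Finset (E × E) :=
  (S ×ˢ S).filter fun x => A.Cr x.1 x.2

lemma mem_cp {A : AS V E} {S : Finset E} {x : E × E} :
    x ∈ A.cp S ↔ (x.1 ∈ S ∧ x.2 ∈ S) ∧ A.Cr x.1 x.2 := by
  classical
  simp [cp]

open scoped Classical in
lemma rem (A : AS V E) (S : Finset E) {e : E} (he : e ∈ S) (F : Finset E)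
    (hF : ∀ f ∈ F, f ∈ S ∧ A.Cr e f) :
    (A.cp (S.erase e)).card + 2 * F.card ≤ (A.cp S).card := by
  have d1 : Disjoint (F.image fun f => (e, f)) (F.image fun f => (f, e)) := by
    rw [Finset.disjoint_left]
    intro x hx hy
    simp only [Finset.mem_image] at hx hy
    obtain ⟨f, hf, rfl⟩ := hx
    obtain ⟨g, hg, h⟩ := hy
    have : f = e := (congrArg Prod.snd h).symm
    exact (hF f hf).2.1 this.symm
  have d2 : Disjoint (A.cp (S.erase e)) ((F.image fun f => (e, f)) ∪ (F.image fun f => (f, e))) := by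
    rw [Finset.disjoint_left]
    intro x hx hy
    obtain ⟨⟨h1, h2⟩, -⟩ := mem_cp.1 hx
    simp only [Finset.mem_image, Finset.mem_union] at hy
    rcases hy with ⟨f, hf, rfl⟩ | ⟨f, hf, rfl⟩
    · simp at h1
    · simp at h2
  have hs : A.cp (S.erase e) ∪ ((F.image fun f => (e, f)) ∪ (F.image fun f => (f, e))) ⊆ A.cp S := by
    intro x hx
    simp only [Finset.mem_image, Finset.mem_union] at hx
    rcases hx with h | ⟨f, hf, rfl⟩ | ⟨f, hf, rfl⟩
    · obtain ⟨⟨h1, h2⟩, h3⟩ := mem_cp.1 h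
      exact mem_cp.2 ⟨⟨Finset.mem_of_mem_erase h1, Finset.mem_of_mem_erase h2⟩, h3⟩
    · exact mem_cp.2 ⟨⟨he, (hF f hf).1⟩, (hF f hf).2⟩
    · exact mem_cp.2 ⟨⟨(hF f hf).1, he⟩, Cr_symm (hF f hf).2⟩
  have := Finset.card_le_card hs
  rw [Finset.card_union_of_disjoint d2, Finset.card_union_of_disjoint d1,
    Finset.card_image_of_injective, Finset.card_image_of_injective] at this
  · omega
  · intro a b h; exact congrArg Prod.fst h
  · intro a b h; exact congrArg Prod.snd h

lemma vs_mono (A : AS V E) {S T : Finset E} (h : T ⊆ S) : A.vs T ⊆ A.vs S := by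
  intro w hw
  obtain ⟨e, he, k⟩ := mem_vs.1 hw
  exact mem_vs.2 ⟨e, h he, k⟩

lemma lin1 [Finite V] (A : AS V E) (n : ℕ) (S : Finset E) :
    (A.vs S).card ≤ n → 2 * S.card ≤ 4 * n + (A.cp S).card := by
  classical
  induction S using Finset.strongInduction with
  | _ S ih =>
    intro hn
    by_cases h : 2 * S.card ≤ 4 * n
    · omega
    have hb := (A.sub_bounds S).2.2
    have : ¬ ∀ e ∈ S, ∀ f ∈ S, ¬ A.Cr e f := fun k => by have := hb k; omega
    push Not at this
    obtain ⟨e, he, f, hf, hc⟩ := this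
    have i := ih (S.erase e) (Finset.erase_ssubset he)
      ((Finset.card_le_card (A.vs_mono (Finset.erase_subset _ _))).trans hn)
    have r := A.rem S he {f} (by simpa using ⟨hf, hc⟩)
    have h5 := Finset.card_erase_add_one he
    rw [Finset.card_singleton] at r
    omega

lemma lin2 [Finite V] (A : AS V E) (n : ℕ) (S : Finset E) :
    (A.vs S).card ≤ n → 4 * S.card ≤ 10 * n + (A.cp S).card := by
  classical
  induction S using Finset.strongInduction with
  | _ S ih =>
    intro hn
    by_cases h : 2 * S.card ≤ 6 * n
    · have := A.lin1 n S hn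
      omega
    have hb := (A.sub_bounds S).2.1
    have : ¬ ∀ e ∈ S, ∀ f ∈ S, ∀ g ∈ S, A.Cr e f → A.Cr e g → f ≠ g → False :=
      fun k => by have := hb k; omega
    push Not at this
    obtain ⟨e, he, f, hf, g, hg, h1, h2, hfg, -⟩ := this
    have i := ih (S.erase e) (Finset.erase_ssubset he)
      ((Finset.card_le_card (A.vs_mono (Finset.erase_subset _ _))).trans hn)
    have r := A.rem S he {f, g} (by
      intro x hx
      simp only [Finset.mem_insert, Finset.mem_singleton] at hx
      rcases hx with rfl | rfl
      · exact ⟨hf, h1⟩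
      · exact ⟨hg, h2⟩)
    have h5 := Finset.card_erase_add_one he
    rw [Finset.card_pair hfg] at r
    omega

lemma lin3 [Finite V] (A : AS V E) (n : ℕ) (S : Finset E) :
    (A.vs S).card ≤ n → 6 * S.card ≤ 17 * n + (A.cp S).card := by
  classical
  induction S using Finset.strongInduction with
  | _ S ih =>
    intro hn
    by_cases h : 2 * S.card ≤ 7 * n
    · have := A.lin2 n S hn
      omega
    have hb := (A.sub_bounds S).1
    have : ¬ ∀ e ∈ S, ∀ f ∈ S, ∀ g ∈ S, ∀ k ∈ S, A.Cr e f → A.Cr e g → A.Cr e k →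
      f ≠ g → f ≠ k → g ≠ k → False :=
      fun k => by have := hb k; omega
    push Not at this
    obtain ⟨e, he, f, hf, g, hg, k, hk, h1, h2, h3, hfg, hfk, hgk, -⟩ := this
    have i := ih (S.erase e) (Finset.erase_ssubset he)
      ((Finset.card_le_card (A.vs_mono (Finset.erase_subset _ _))).trans hn)
    have r := A.rem S he {f, g, k} (by
      intro x hx
      simp only [Finset.mem_insert, Finset.mem_singleton] at hx
      rcases hx with rfl | rfl | rfl
      · exact ⟨hf, h1⟩
      · exact ⟨hg, h2⟩
      · exact ⟨hk, h3⟩)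
    have h5 := Finset.card_erase_add_one he
    rw [Finset.card_eq_three.2 ⟨f, g, k, hfg, hfk, hgk, rfl⟩] at r
    omega

end AS

lemma sample {V : Type} [Fintype V] [DecidableEq V] (p : ℝ) (B : Finset V) :
    ∑ W : Finset V, (if B ⊆ W then p ^ W.card * (1 - p) ^ (Wᶜ).card else 0) = p ^ B.card := by
  have h := Finset.prod_add (fun _ : V => p) (fun i => if i ∈ B then 0 else 1 - p) Finset.univ
  have hl : ∏ i : V, (p + if i ∈ B then 0 else 1 - p) = p ^ B.card := by
    have : ∀ i : V, (p + if i ∈ B then 0 else 1 - p) = if i ∈ B then p else 1 := by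
      intro i; split_ifs <;> ring
    simp only [this]
    rw [Finset.prod_ite_mem, Finset.univ_inter, Finset.prod_const]
  rw [← hl, h, Finset.powerset_univ]
  refine Finset.sum_congr rfl fun W _ => ?_
  rw [Finset.prod_const, ← Finset.compl_eq_univ_sdiff]
  split_ifs with hB
  · congr 1
    rw [← Finset.prod_const]
    refine Finset.prod_congr rfl fun i hi => ?_
    rw [if_neg]
    intro k
    exact (Finset.mem_compl.1 hi) (hB k)
  · obtain ⟨i, hi, hi'⟩ := Finset.not_subset.1 hB
    rw [Finset.prod_eq_zero (i := i) (Finset.mem_compl.2 hi') (by simp [hi]), mul_zero]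

namespace AS
variable {V E : Type}

lemma Cr_disj {A : AS V E} {e f : E} (h : A.Cr e f) :
    A.u e ≠ A.u f ∧ A.u e ≠ A.v f ∧ A.v e ≠ A.u f ∧ A.v e ≠ A.v f := by
  obtain ⟨hne, p, hp, hn⟩ := h
  have i0 : (0:ℝ) ∈ Icc (0:ℝ) 1 := by simp
  have i1 : (1:ℝ) ∈ Icc (0:ℝ) 1 := by simp
  have key : ∀ w, A.vert w ∈ A.img e → A.vert w ∈ A.img f → False := fun w h1 h2 =>
    hn w (A.meet e f hne ⟨h1, h2⟩ hp)
  have ku : ∀ e, A.vert (A.u e) ∈ A.img e := fun e => ⟨0, i0, A.h0 e⟩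
  have kv : ∀ e, A.vert (A.v e) ∈ A.img e := fun e => ⟨1, i1, A.h1 e⟩
  refine ⟨fun k => key _ (ku e) (k ▸ ku f), fun k => key _ (ku e) (k ▸ kv f),
    fun k => key _ (kv e) (k ▸ ku f), fun k => key _ (kv e) (k ▸ kv f)⟩

lemma sampled [Fintype V] [Fintype E] (A : AS V E) (p : ℝ) (hp0 : 0 ≤ p) (hp1 : p ≤ 1) :
    6 * (p ^ 2 * Fintype.card E) ≤
      17 * (p * Fintype.card V) + p ^ 4 * (A.cp Finset.univ).card := by
  classical
  let wt : Finset V → ℝ := fun W => p ^ W.card * (1 - p) ^ (Wᶜ).card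
  have wt0 : ∀ W, 0 ≤ wt W := fun W => by
    have : 0 ≤ 1 - p := by linarith
    positivity
  have ev : ∀ {ι : Type} (s : Finset ι) (B : ι → Finset V) (k : ℕ), (∀ i ∈ s, (B i).card = k) →
      ∑ W, wt W * ((s.filter fun i => B i ⊆ W).card : ℝ) = p ^ k * s.card := by
    intro ι s B k hk
    have : ∀ W, wt W * ((s.filter fun i => B i ⊆ W).card : ℝ) =
        ∑ i ∈ s, if B i ⊆ W then wt W else 0 := by
      intro W
      rw [← Finset.sum_filter, Finset.sum_const, nsmul_eq_mul, mul_comm]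
    simp only [this]
    rw [Finset.sum_comm]
    have : ∀ i ∈ s, ∑ W, (if B i ⊆ W then wt W else 0) = p ^ k := by
      intro i hi
      rw [← hk i hi]; exact sample p (B i)
    rw [Finset.sum_congr rfl this, Finset.sum_const, nsmul_eq_mul, mul_comm]
  let SW : Finset V → Finset E := fun W => Finset.univ.filter fun e => {A.u e, A.v e} ⊆ W
  have main : ∀ W, 6 * (wt W * ((SW W).card : ℝ)) ≤ 17 * (wt W * (W.card : ℝ)) +
      wt W * ((A.cp (SW W)).card : ℝ) := by
    intro W
    have h := A.lin3 W.card (SW W) (Finset.card_le_card (by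
      intro w hw
      obtain ⟨e, he, k⟩ := mem_vs.1 hw
      have he := (Finset.mem_filter.1 he).2
      apply he
      simpa using k))
    have h' : (6:ℝ) * (SW W).card ≤ 17 * W.card + (A.cp (SW W)).card := by exact_mod_cast h
    have := mul_le_mul_of_nonneg_left h' (wt0 W)
    linarith
  have hsum := Finset.sum_le_sum fun W (_ : W ∈ Finset.univ) => main W
  rw [Finset.sum_add_distrib, ← Finset.mul_sum, ← Finset.mul_sum] at hsum
  have e1 := ev (Finset.univ : Finset E) (fun e => {A.u e, A.v e}) 2 (by
    intro e _
    exact Finset.card_pair fun k => A.hc e (by rw [k]))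
  have e2 := ev (Finset.univ : Finset V) (fun w => {w}) 1 (by simp)
  have e3 := ev (A.cp Finset.univ) (fun x => {A.u x.1, A.v x.1, A.u x.2, A.v x.2}) 4 (by
    intro x hx
    have hx := (mem_cp.1 hx).2
    obtain ⟨h1, h2, h3, h4⟩ := Cr_disj hx
    have h5 : A.u x.1 ≠ A.v x.1 := fun k => A.hc x.1 (by rw [k])
    have h6 : A.u x.2 ≠ A.v x.2 := fun k => A.hc x.2 (by rw [k])
    rw [Finset.card_insert_of_notMem (by simp [h1, h2, h5]),
      Finset.card_insert_of_notMem (by simp [h3, h4]), Finset.card_pair h6])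
  have f2 : ∀ W : Finset V, (Finset.univ.filter fun i => ({i} : Finset V) ⊆ W) = W := by
    intro W; ext i; simp
  have f3 : ∀ W : Finset V, ((A.cp Finset.univ).filter fun x =>
      ({A.u x.1, A.v x.1, A.u x.2, A.v x.2} : Finset V) ⊆ W) = A.cp (SW W) := by
    intro W; ext x
    rw [Finset.mem_filter, mem_cp, mem_cp]
    simp only [SW, Finset.mem_filter, Finset.mem_univ, true_and, Finset.insert_subset_iff,
      Finset.singleton_subset_iff]
    tauto
  simp only [f2] at e2
  simp only [f3] at e3
  rw [e1, e2, e3, pow_one, Finset.card_univ, Finset.card_univ] at hsum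
  exact hsum

theorem final [Fintype V] [Fintype E] (A : AS V E)
    (hm : 17 / 4 * (Fintype.card V : ℝ) ≤ Fintype.card E) :
    32 / 289 * (Fintype.card E : ℝ) ^ 3 / (Fintype.card V : ℝ) ^ 2 ≤ (A.cp Finset.univ).card := by
  set n : ℝ := (Fintype.card V : ℝ) with hn
  set m : ℝ := (Fintype.card E : ℝ) with hmm
  set N : ℝ := ((A.cp Finset.univ).card : ℝ) with hN
  have hN0 : 0 ≤ N := by rw [hN]; positivity
  have hn0 : 0 ≤ n := by rw [hn]; positivity
  rcases hn0.eq_or_lt with h | h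
  · rw [← h]; simpa using hN0
  have hm0 : 0 < m := by linarith
  have hs := A.sampled (17 * n / (4 * m)) (by positivity) (by
    rw [div_le_one (by positivity)]; linarith)
  rw [← hn, ← hmm, ← hN] at hs
  have k1 : (17 * n / (4 * m)) ^ 2 * m = (17 / 4) ^ 2 * n ^ 2 / m := by field_simp
  have k2 : (17 * n / (4 * m)) * n = 17 / 4 * n ^ 2 / m := by field_simp
  have k3 : (17 * n / (4 * m)) ^ 4 * N = (17 / 4) ^ 4 * n ^ 4 * N / m ^ 4 := by field_simp
  rw [k1, k2, k3] at hs
  have hs2 : (6 * (17 / 4) ^ 2 - 17 * (17 / 4)) * n ^ 2 / m ≤ (17 / 4) ^ 4 * n ^ 4 * N / m ^ 4 := by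
    have : (6 * (17 / 4) ^ 2 - 17 * (17 / 4)) * n ^ 2 / m =
      6 * ((17 / 4) ^ 2 * n ^ 2 / m) - 17 * (17 / 4 * n ^ 2 / m) := by ring
    rw [this]; linarith
  rw [div_le_div_iff₀ hm0 (by positivity)] at hs2
  rw [div_le_iff₀ (by positivity)]
  have hpos : 0 < n ^ 2 * m := by positivity
  refine le_of_mul_le_mul_right ?_ hpos
  nlinarith [hs2]

end AS
end BCL


namespace BCL
open Set

lemma exists_drawing {n : ℕ} (G : SimpleGraph (Fin n)) : Nonempty (Drawing G) := by
  have hex : ∀ e : G.edgeSet, ∃ a b : Fin n, (e : Sym2 (Fin n)) = s(a, b) ∧ a ≠ b := by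
    rintro ⟨e, he⟩
    induction e using Sym2.ind with
    | _ a b => exact ⟨a, b, rfl, G.ne_of_adj he⟩
  choose a b hab hne using hex
  let X : Fin n → ℝ := fun i => (i : ℕ)
  have hX : Function.Injective X := by
    intro i j h
    exact Fin.ext (Nat.cast_injective h)
  have hmem : ∀ (e : G.edgeSet) (w : Fin n), w ∈ (e : Sym2 (Fin n)) ↔ w = a e ∨ w = b e := by
    intro e w; rw [hab]; exact Sym2.mem_iff
  let arc : G.edgeSet → ℝ → ℝ × ℝ := fun e t =>
    (X (a e) + t * (X (b e) - X (a e)), X (a e) ^ 2 + t * (X (b e) ^ 2 - X (a e) ^ 2))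
  have line : ∀ e, ∀ p ∈ arc e '' Icc (0:ℝ) 1,
      p.2 = (X (a e) + X (b e)) * p.1 - X (a e) * X (b e) := by
    rintro e _ ⟨t, -, rfl⟩
    simp only [arc]; ring
  have hXne : ∀ e, X (b e) - X (a e) ≠ 0 := fun e h => hne e (hX (sub_eq_zero.1 h)).symm
  have share : ∀ (x y z : ℝ) (p : ℝ × ℝ), y ≠ z → p.2 = (x + y) * p.1 - x * y →
      p.2 = (x + z) * p.1 - x * z → p = (x, x ^ 2) := by
    intro x y z p h h1 h2
    have : (y - z) * (p.1 - x) = 0 := by linear_combination h2 - h1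
    have hx : p.1 = x := by
      rcases mul_eq_zero.1 this with k | k
      · exact absurd (sub_eq_zero.1 k) h
      · exact sub_eq_zero.1 k
    refine Prod.ext hx ?_
    rw [h1, hx]; ring
  refine ⟨{
    vert := fun i => (X i, X i ^ 2)
    vert_inj := fun i j h => hX (congrArg Prod.fst h)
    arc := arc
    arc_cont := ?_
    arc_inj := ?_
    arc_ends := ?_
    arc_vertex := ?_
    adj_meet := ?_
    nonadj_meet := ?_ }⟩
  · intro e
    apply Continuous.continuousOn
    simp only [arc]
    fun_prop
  · intro e s _ t _ h
    have h1 : X (a e) + s * (X (b e) - X (a e)) = X (a e) + t * (X (b e) - X (a e)) :=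
      congrArg Prod.fst h
    exact mul_right_cancel₀ (hXne e) (add_left_cancel h1)
  · intro e u v h
    have h0 : arc e 0 = (X (a e), X (a e) ^ 2) := by simp [arc]
    have h1 : arc e 1 = (X (b e), X (b e) ^ 2) := by simp [arc]
    rw [h0, h1]
    rw [hab, Sym2.eq_iff] at h
    rcases h with ⟨h, k⟩ | ⟨h, k⟩
    · rw [h, k]
    · rw [h, k, pair_comm]
  · intro e t ht w h
    have l := line e _ ⟨t, ht, rfl⟩
    rw [h] at l
    simp only at l
    have : (X w - X (a e)) * (X w - X (b e)) = 0 := by linear_combination l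
    rw [hmem]
    rcases mul_eq_zero.1 this with k | k
    · exact Or.inl (hX (sub_eq_zero.1 k))
    · exact Or.inr (hX (sub_eq_zero.1 k))
  · rintro e f hef ⟨w, he, hf⟩ p hp hq
    refine ⟨w, he, hf, ?_⟩
    have l1 := line e p hp
    have l2 := line f p hq
    have g : ∀ (e : G.edgeSet) (w : Fin n), w ∈ (e : Sym2 (Fin n)) → p.2 = (X (a e) + X (b e)) * p.1 - X (a e) * X (b e) →
        ∃ y, (e : Sym2 (Fin n)) = s(w, y) ∧ p.2 = (X w + X y) * p.1 - X w * X y := by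
      intro e w h l
      rcases (hmem e w).1 h with rfl | rfl
      · exact ⟨_, hab e, l⟩
      · exact ⟨a e, by rw [hab e, Sym2.eq_swap], by rw [l]; ring⟩
    obtain ⟨y, y1, y2⟩ := g e w he l1
    obtain ⟨z, z1, z2⟩ := g f w hf l2
    refine share (X w) (X y) (X z) p ?_ y2 z2
    intro k
    apply hef
    apply Subtype.ext
    rw [y1, z1, hX k]
  · intro e f hn p hp q hq
    have l1 := line e p hp.1
    have l2 := line f p hp.2
    have l3 := line e q hq.1
    have l4 := line f q hq.2
    have hx : p.1 = q.1 := by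
      by_contra k
      have s1 : (X (a e) + X (b e) - X (a f) - X (b f)) * (p.1 - q.1) = 0 := by
        linear_combination l2 - l1 + l3 - l4
      have s2 : X (a e) + X (b e) - X (a f) - X (b f) = 0 := by
        rcases mul_eq_zero.1 s1 with h | h
        · exact h
        · exact absurd (sub_eq_zero.1 h) k
      have s3 : (X (a e) - X (a f)) * (X (a e) - X (b f)) = 0 := by
        linear_combination (X (a e) - p.1) * s2 + l2 - l1
      rcases mul_eq_zero.1 s3 with h | h
      · exact hn ⟨a e, (hmem _ _).2 (Or.inl rfl), (hmem _ _).2 (Or.inl (hX (sub_eq_zero.1 h)))⟩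
      · exact hn ⟨a e, (hmem _ _).2 (Or.inl rfl), (hmem _ _).2 (Or.inr (hX (sub_eq_zero.1 h)))⟩
    refine Prod.ext hx ?_
    rw [l1, l3, hx]

lemma exists_AS {n : ℕ} {G : SimpleGraph (Fin n)} (hb : IsBipartite G) (D : Drawing G) :
    ∃ A : AS (Fin n) G.edgeSet, A.vert = D.vert ∧ A.arc = D.arc := by
  obtain ⟨c, hc⟩ := hb
  have hex : ∀ e : G.edgeSet, ∃ a b : Fin n, (e : Sym2 (Fin n)) = s(a, b) ∧
      D.arc e 0 = D.vert a ∧ D.arc e 1 = D.vert b := by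
    intro e
    have : ∃ a b : Fin n, (e : Sym2 (Fin n)) = s(a, b) := by
      obtain ⟨e, he⟩ := e
      induction e using Sym2.ind with
      | _ a b => exact ⟨a, b, rfl⟩
    obtain ⟨a, b, h⟩ := this
    rcases pair_eq_pair_iff.1 (D.arc_ends e a b h) with ⟨h1, h2⟩ | ⟨h1, h2⟩
    · exact ⟨a, b, h, h1, h2⟩
    · exact ⟨b, a, by rw [h, Sym2.eq_swap], h1, h2⟩
  choose a b hab h0 h1 using hex
  refine ⟨{
    vert := D.vert
    vinj := D.vert_inj
    arc := D.arc
    cont := D.arc_cont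
    inj := D.arc_inj
    u := a
    v := b
    h0 := h0
    h1 := h1
    hvert := ?_
    meet := ?_
    c := c
    hc := ?_ }, rfl, rfl⟩
  · intro e t ht w h
    have := D.arc_vertex e t ht w h
    rw [hab] at this
    exact Sym2.mem_iff.1 this
  · intro e f hne
    by_cases hs : ∃ w, w ∈ (e : Sym2 (Fin n)) ∧ w ∈ (f : Sym2 (Fin n))
    · intro p hp q hq
      obtain ⟨w, w1, w2, rfl⟩ := D.adj_meet e f hne hs p hp.1 hp.2
      obtain ⟨z, z1, z2, rfl⟩ := D.adj_meet e f hne hs q hq.1 hq.2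
      by_contra k
      have k' : w ≠ z := fun h => k (by rw [h])
      have e1 := (Sym2.mem_and_mem_iff k').1 ⟨w1, z1⟩
      have e2 := (Sym2.mem_and_mem_iff k').1 ⟨w2, z2⟩
      exact hne (Subtype.ext (e1.trans e2.symm))
    · exact D.nonadj_meet e f hs
  · intro e
    apply hc
    have := e.2
    rw [hab] at this
    exact this

lemma cp_even {V E : Type} [Fintype E] (A : AS V E) : Even (A.cp Finset.univ).card := by
  rw [← ZMod.natCast_eq_zero_iff_even]
  have : ∑ _x ∈ A.cp Finset.univ, (1 : ZMod 2) = 0 := by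
    refine Finset.sum_involution (fun x _ => (x.2, x.1)) ?_ ?_ ?_ ?_
    · intros; decide
    · intro x hx _ k
      have := (AS.mem_cp.1 hx).2.1
      exact this (congrArg Prod.snd k)
    · intro x hx
      have := AS.mem_cp.1 hx
      exact AS.mem_cp.2 ⟨⟨this.1.2, this.1.1⟩, AS.Cr_symm this.2⟩
    · intros; rfl
  simpa using this

lemma count_bound {n : ℕ} {G : SimpleGraph (Fin n)} (hb : IsBipartite G)
    (hm : 17 / 4 * (n : ℝ) ≤ (G.edgeSet.ncard : ℝ)) (D : Drawing G) :
    16 / 289 * (G.edgeSet.ncard : ℝ) ^ 3 / (n : ℝ) ^ 2 ≤ (D.crossingCount : ℝ) := by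
  classical
  obtain ⟨A, hv, ha⟩ := exists_AS hb D
  have : Fintype G.edgeSet := Fintype.ofFinite _
  have hcE : G.edgeSet.ncard = Fintype.card G.edgeSet := by
    rw [← Nat.card_coe_set_eq, Nat.card_eq_fintype_card]
  have hf := A.final (by rw [← hcE, Fintype.card_fin]; exact hm)
  rw [← hcE, Fintype.card_fin] at hf
  have hC : ∀ e f, A.Cr e f ↔ D.Crosses e f := by
    intro e f
    unfold AS.Cr AS.img Drawing.Crosses Drawing.img
    rw [hv, ha]
  have hset : {p : G.edgeSet × G.edgeSet | D.Crosses p.1 p.2} = (A.cp Finset.univ : Set _) := by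
    ext x
    rw [Finset.mem_coe, AS.mem_cp, hC]
    simp
  obtain ⟨k, hk⟩ := cp_even A
  have hcc : D.crossingCount = k := by
    unfold Drawing.crossingCount
    rw [hset, ncard_coe_finset, hk]; omega
  rw [hcc]
  rw [hk] at hf
  push_cast at hf
  have : 32 / 289 * (G.edgeSet.ncard : ℝ) ^ 3 / (n : ℝ) ^ 2 =
    2 * (16 / 289 * (G.edgeSet.ncard : ℝ) ^ 3 / (n : ℝ) ^ 2) := by ring
  linarith

end BCL

theorem bipartite_crossing_lemma (n : ℕ) (G : SimpleGraph (Fin n))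
    (hbip : IsBipartite G) (hm : 17 / 4 * (n : ℝ) ≤ (G.edgeSet.ncard : ℝ)) :
    16 / 289 * (G.edgeSet.ncard : ℝ) ^ 3 / (n : ℝ) ^ 2 ≤ (crossingNumber G : ℝ) := by
  obtain ⟨D0⟩ := BCL.exists_drawing G
  have hne : (Set.range fun D : Drawing G => D.crossingCount).Nonempty := ⟨_, D0, rfl⟩
  obtain ⟨D, hD⟩ := Nat.sInf_mem hne
  unfold crossingNumber
  rw [← hD]
  exact BCL.count_bound hbip hm D
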